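/- Let K ⊂ S² be a convex body of width w with 0 < w ≤ π/2, and let T_w ⊂ S² be a regular spherical triangle of width w. Then area(K) ≥ area(T_w), and equality holds if and only if K is congruent (isometric by a rotation of S²) to T_w. -/

import Mathlib

open scoped RealInnerProductSpace
open Real MeasureTheory

noncomputable section

namespace SphericalPal

/-- Ambient Euclidean space of the sphere `Sⁿ`. -/
abbrev E (n : ℕ) := EuclideanSpace ℝ (Fin (n + 1))

/-- The unit sphere `Sⁿ ⊂ ℝⁿ⁺¹`. -/
def unitSphere (n : ℕ) : Set (E n) := Metric.sphere 0 1

variable {n : ℕ}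

/-- Geodesic (angular) distance on the unit sphere. -/
def gdist (x y : E n) : ℝ := Real.arccos ⟪x, y⟫

/-- The geodesic segment joining `x` and `y` on the sphere. -/
def seg (x y : E n) : Set (E n) :=
  {z ∈ unitSphere n | gdist x z + gdist z y = gdist x y}

/-- A subset of the sphere is spherically convex if it lies on the sphere, is contained
in an open hemisphere and contains the geodesic segment joining any two of its points. -/
def SConvex (X : Set (E n)) : Prop :=
  X ⊆ unitSphere n ∧
  (∃ u ∈ unitSphere n, ∀ x ∈ X, 0 < ⟪u, x⟫) ∧
  ∀ x ∈ X, ∀ y ∈ X, seg x y ⊆ X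

/-- Spherical convex hull. -/
def sconv (X : Set (E n)) : Set (E n) := ⋂₀ {C | SConvex C ∧ X ⊆ C}

/-- Relative (spherical) interior of a subset of the sphere. -/
def sInterior (X : Set (E n)) : Set (E n) :=
  {x ∈ X | ∃ ε > 0, ∀ y ∈ unitSphere n, gdist x y < ε → y ∈ X}

/-- A spherical convex body: compact, spherically convex, with nonempty relative interior. -/
def IsConvexBody (K : Set (E n)) : Prop :=
  SConvex K ∧ IsCompact K ∧ (sInterior K).Nonempty

/-- The lune determined by `u` and `v` (intersection of the closed hemispheres
opposite to `u` and to `v`). -/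
def lune (u v : E n) : Set (E n) := {x ∈ unitSphere n | ⟪x, u⟫ ≤ 0 ∧ ⟪x, v⟫ ≤ 0}

/-- The bounding hemisphere of `lune u v` contained in the great sphere orthogonal to `u`. -/
def luneFace (u v : E n) : Set (E n) := {x ∈ unitSphere n | ⟪x, u⟫ = 0 ∧ ⟪x, v⟫ ≤ 0}

/-- The center (midpoint) of the bounding hemisphere `luneFace u v`. -/
def luneFaceCenter (u v : E n) : E n :=
  ‖(⟪u, v⟫ • u - v : E n)‖⁻¹ • (⟪u, v⟫ • u - v)

/-- The breadth of the lune `lune u v`: the geodesic distance of the centers of the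
two bounding hemispheres. -/
def breadth (u v : E n) : ℝ := gdist (luneFaceCenter u v) (luneFaceCenter v u)

/-- `lune u v` is a supporting lune of `K`. -/
def IsSupportingLune (K : Set (E n)) (u v : E n) : Prop :=
  u ∈ unitSphere n ∧ v ∈ unitSphere n ∧ u ≠ v ∧ u ≠ -v ∧
  K ⊆ lune u v ∧ (K ∩ luneFace u v).Nonempty ∧ (K ∩ luneFace v u).Nonempty

/-- The (minimal) width of a spherical convex body. -/
def width (K : Set (E n)) : ℝ :=
  sInf {b | ∃ u v : E n, IsSupportingLune K u v ∧ b = breadth u v}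

/-- The width of `K` with respect to the supporting great hypersphere orthogonal to `u`:
the minimal breadth among supporting lunes of `K` having one bounding hemisphere
contained in that great hypersphere. -/
def widthAt (K : Set (E n)) (u : E n) : ℝ :=
  sInf {b | ∃ v : E n, IsSupportingLune K u v ∧ b = breadth u v}

/-- The great hypersphere orthogonal to `u` supports `K`. -/
def IsSupportingSphere (K : Set (E n)) (u : E n) : Prop :=
  u ∈ unitSphere n ∧ (∀ x ∈ K, ⟪x, u⟫ ≤ 0) ∧ ∃ x ∈ K, ⟪x, u⟫ = 0

/-- `K` is of constant width `w`. -/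
def HasConstantWidth (K : Set (E n)) (w : ℝ) : Prop :=
  ∀ u : E n, IsSupportingSphere K u → widthAt K u = w

/-- `K` is a reduced convex body. -/
def IsReduced (K : Set (E n)) : Prop :=
  IsConvexBody K ∧ ∀ L : Set (E n), IsConvexBody L → L ⊆ K → L ≠ K → width L < width K

/-- The spherical polar set. -/
def polar (A : Set (E n)) : Set (E n) := {u ∈ unitSphere n | ∀ a ∈ A, ⟪a, u⟫ ≤ 0}

/-- Closed geodesic ball on the sphere. -/
def gball (p : E n) (r : ℝ) : Set (E n) := {x ∈ unitSphere n | gdist p x ≤ r}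

/-- The inradius of `K`: the largest `r` such that some geodesic ball of radius `r`
is contained in `K`. -/
def inradius (K : Set (E n)) : ℝ :=
  sSup {r | 0 ≤ r ∧ ∃ p ∈ unitSphere n, gball p r ⊆ K}

/-- Geodesic distance from a point to a set. -/
def sdist (x : E n) (A : Set (E n)) : ℝ := sInf (gdist x '' A)

/-- Hausdorff distance with respect to the geodesic metric. -/
def hausdorffG (A B : Set (E n)) : ℝ :=
  max (sSup ((fun x => sdist x B) '' A)) (sSup ((fun y => sdist y A) '' B))

/-- Two subsets of the sphere are congruent, i.e., isometric by an orthogonal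
transformation of the ambient Euclidean space. -/
def Congruent (A B : Set (E n)) : Prop :=
  ∃ f : E n ≃ₗᵢ[ℝ] E n, f '' A = B

/-- Spherical surface measure on `S²` (2-dimensional Hausdorff measure). -/
def area (X : Set (E 2)) : ℝ := (μH[2] X).toReal

/-- The spherical angle `∠(x, p, y)` at `p` between the geodesic segments `[p,x]`, `[p,y]`. -/
def sangle (x p y : E 2) : ℝ :=
  InnerProductGeometry.angle (x - ⟪p, x⟫ • p) (y - ⟪p, y⟫ • p)

/-- `T` is a regular spherical triangle: the spherical convex hull of three points
with equal pairwise geodesic distances, not lying on a common great circle. -/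
def IsRegularTriangle (T : Set (E 2)) : Prop :=
  ∃ v₁ v₂ v₃ : E 2, v₁ ∈ unitSphere 2 ∧ v₂ ∈ unitSphere 2 ∧ v₃ ∈ unitSphere 2 ∧
    LinearIndependent ℝ ![v₁, v₂, v₃] ∧
    gdist v₁ v₂ = gdist v₂ v₃ ∧ gdist v₂ v₃ = gdist v₁ v₃ ∧
    T = sconv {v₁, v₂, v₃}

/-- Three points on the sphere with equal pairwise geodesic distance `a`
(the vertices of a regular spherical triangle of side length `a`). -/
def IsRegularCenters (x₁ x₂ x₃ : E 2) (a : ℝ) : Prop :=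
  x₁ ∈ unitSphere 2 ∧ x₂ ∈ unitSphere 2 ∧ x₃ ∈ unitSphere 2 ∧
  gdist x₁ x₂ = a ∧ gdist x₂ x₃ = a ∧ gdist x₁ x₃ = a

/-- `U` is a spherical Reuleaux triangle: intersection of three geodesic balls of radius `r`
whose centers have pairwise geodesic distance `r`. -/
def IsReuleaux (U : Set (E 2)) (r : ℝ) : Prop :=
  ∃ x₁ x₂ x₃ : E 2, IsRegularCenters x₁ x₂ x₃ r ∧
    U = gball x₁ r ∩ gball x₂ r ∩ gball x₃ r

/-- The body `U°_{π-w}` for `w > π/2`: the spherical convex hull of three geodesic balls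
of radius `w - π/2` (whose centers are meant to form a regular triangle of side `π - w`). -/
def polarReuleaux (x₁ x₂ x₃ : E 2) (w : ℝ) : Set (E 2) :=
  sconv (gball x₁ (w - π / 2) ∪ gball x₂ (w - π / 2) ∪ gball x₃ (w - π / 2))

end SphericalPal

open SphericalPal

namespace SphericalPal

section PartA1
open Filter Topology Metric Set
open scoped ENNReal

lemma unique_aux (ρ m : Measure (E 2)) [IsFiniteMeasure ρ] [IsFiniteMeasure m]
    (hac : ρ ≪ m) (hm0 : m ≠ 0) (hmS : m (sphere (0 : E 2) 1)ᶜ = 0)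
    (hρ : ∀ (f : E 2 ≃ₗᵢ[ℝ] E 2) (x : E 2) (r : ℝ), ρ (closedBall (f x) r) = ρ (closedBall x r))
    (hm : ∀ (f : E 2 ≃ₗᵢ[ℝ] E 2) (x : E 2) (r : ℝ), m (closedBall (f x) r) = m (closedBall x r)) :
    ∃ κ : ℝ≥0∞, ρ = κ • m := by
  have h1 := Besicovitch.ae_tendsto_rnDeriv ρ m
  have h2 : ∀ᵐ x ∂m, x ∈ sphere (0 : E 2) 1 := by
    rw [ae_iff]; exact hmS
  have h3 := h1.and h2
  have : NeZero m := ⟨hm0⟩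
  obtain ⟨x0, hx0, hx0S⟩ := h3.exists
  refine ⟨ρ.rnDeriv m x0, ?_⟩
  have h4 : ∀ᵐ x ∂m, ρ.rnDeriv m x = ρ.rnDeriv m x0 := by
    filter_upwards [h3] with x hx
    have hn : ‖x‖ = ‖x0‖ := by
      have a := hx.2; simp at a hx0S; rw [a, hx0S]
    set f : E 2 ≃ₗᵢ[ℝ] E 2 := (Submodule.reflection (ℝ ∙ (x - x0))ᗮ)
    have hf : f x = x0 := Submodule.reflection_sub hn
    have := hx.1
    simp_rw [← hρ f x, ← hm f x, hf] at this
    exact tendsto_nhds_unique this hx0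
  have hLD : ρ.HaveLebesgueDecomposition m := Measure.haveLebesgueDecomposition_of_sigmaFinite ρ m
  have h5 := Measure.withDensity_rnDeriv_eq ρ m hac
  rw [withDensity_congr_ae h4, withDensity_const] at h5
  exact h5.symm

/-- Hausdorff measure on the sphere. -/
def muS : Measure (E 2) := (μH[2] : Measure (E 2)).restrict (sphere (0 : E 2) 1)

/-- Cone measure on the sphere. -/
def sigS : Measure (E 2) :=
  ((volume : Measure (E 2)).restrict (ball (0 : E 2) 1 \ {0})).map (fun x => ‖x‖⁻¹ • x)

lemma meas_normalize : Measurable (fun x : E 2 => ‖x‖⁻¹ • x) := by fun_prop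

instance : IsFiniteMeasure sigS := by
  have : IsFiniteMeasure ((volume : Measure (E 2)).restrict (ball (0 : E 2) 1 \ {0})) := by
    constructor
    rw [Measure.restrict_apply_univ]
    exact lt_of_le_of_lt (measure_mono sdiff_subset) measure_ball_lt_top
  unfold sigS
  infer_instance

lemma sigS_apply {A : Set (E 2)} (hA : MeasurableSet A) :
    sigS A = volume ({x : E 2 | ‖x‖⁻¹ • x ∈ A} ∩ (ball (0 : E 2) 1 \ {0})) := by
  rw [sigS, Measure.map_apply meas_normalize hA, Measure.restrict_apply (meas_normalize hA)]
  rfl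

lemma sigS_compl : sigS (sphere (0 : E 2) 1)ᶜ = 0 := by
  rw [sigS_apply (isClosed_sphere.measurableSet.compl)]
  convert measure_empty (μ := (volume : Measure (E 2)))
  ext x
  simp only [mem_inter_iff, mem_ofPred_eq, mem_compl_iff, mem_sphere_iff_norm, sub_zero, Set.mem_sdiff,
    mem_singleton_iff, mem_empty_iff_false, iff_false, not_and, norm_smul, norm_inv, norm_norm]
  intro h _ h3
  apply h3
  by_contra h0
  exact h (inv_mul_cancel₀ (norm_ne_zero_iff.mpr h0))

lemma sigS_ne_zero : sigS ≠ 0 := by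
  intro h
  have h1 : sigS univ = 0 := by rw [h]; simp
  rw [sigS_apply MeasurableSet.univ] at h1
  have : IsOpen ({x : E 2 | ‖x‖⁻¹ • x ∈ (univ : Set (E 2))} ∩ (ball (0 : E 2) 1 \ {0})) := by
    simp only [mem_univ, ofPred_true, univ_inter]
    exact isOpen_ball.sdiff isClosed_singleton
  rw [this.measure_eq_zero_iff (volume : Measure (E 2))] at h1
  have h2 : (EuclideanSpace.single 0 (1/2) : E 2) ∈ (∅ : Set (E 2)) := by
    rw [← h1]
    simp
    norm_num
  simp at h2

lemma sigS_inv (f : E 2 ≃ₗᵢ[ℝ] E 2) (x : E 2) (r : ℝ) :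
    sigS (closedBall (f x) r) = sigS (closedBall x r) := by
  rw [sigS_apply isClosed_closedBall.measurableSet, sigS_apply isClosed_closedBall.measurableSet]
  rw [← f.measurePreserving.measure_preimage_emb f.toHomeomorph.measurableEmbedding]
  congr 1
  ext y
  have : ‖y‖⁻¹ • f y - f x = f (‖y‖⁻¹ • y - x) := by simp
  have h2 : ‖‖y‖⁻¹ • f y - f x‖ = ‖‖y‖⁻¹ • y - x‖ := by rw [this, f.norm_map]
  simp only [mem_preimage, mem_inter_iff, mem_ofPred_eq, mem_closedBall, dist_eq_norm, Set.mem_sdiff,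
    f.norm_map, h2, mem_ball_zero_iff, mem_singleton_iff, map_eq_zero_iff f f.injective, sub_zero]

lemma muS_inv (f : E 2 ≃ₗᵢ[ℝ] E 2) (x : E 2) (r : ℝ) :
    muS (closedBall (f x) r) = muS (closedBall x r) := by
  rw [muS, Measure.restrict_apply isClosed_closedBall.measurableSet,
    Measure.restrict_apply isClosed_closedBall.measurableSet,
    ← f.toIsometryEquiv.hausdorffMeasure_image 2 (closedBall x r ∩ sphere 0 1)]
  congr 1
  rw [image_inter f.toIsometryEquiv.injective]
  simp

lemma muS_compl : muS (sphere (0 : E 2) 1)ᶜ = 0 := by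
  rw [muS, Measure.restrict_apply (isClosed_sphere.measurableSet.compl)]
  simp

/-- spherical coordinates -/
def sphC (v : Fin 2 → ℝ) : E 2 := !₂[Real.cos (v 0) * Real.cos (v 1),
  Real.cos (v 0) * Real.sin (v 1), Real.sin (v 0)]

lemma sphC_contDiff : ContDiff ℝ 1 sphC := by
  unfold sphC
  rw [contDiff_euclidean]
  intro i
  fin_cases i <;> simp <;> fun_prop

lemma sphC_surj : sphere (0 : E 2) 1 ⊆ sphC '' (Icc (fun _ => -4) (fun _ => 4)) := by
  intro x hx
  have hx1 : x 0 ^ 2 + x 1 ^ 2 + x 2 ^ 2 = 1 := by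
    simp [EuclideanSpace.norm_eq, Fin.sum_univ_three] at hx
    exact hx
  set z : ℂ := ⟨x 0, x 1⟩
  have hz : ‖z‖ = √(1 - x 2 ^ 2) := by
    rw [Complex.norm_def, Complex.normSq_apply]; congr 1; simp [z]; nlinarith
  refine ⟨![Real.arcsin (x 2), Complex.arg z], ?_, ?_⟩
  · have h3 := Real.pi_lt_d2
    have := Real.arcsin_le_pi_div_two (x 2)
    have := Real.neg_pi_div_two_le_arcsin (x 2)
    have := Complex.arg_le_pi z
    have := Complex.neg_pi_lt_arg z
    constructor <;> intro i <;> fin_cases i <;> simp <;> linarith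
  · have h1 : Real.sin (Real.arcsin (x 2)) = x 2 := Real.sin_arcsin (by nlinarith [sq_nonneg (x 0), sq_nonneg (x 1)]) (by nlinarith [sq_nonneg (x 0), sq_nonneg (x 1)])
    ext i
    fin_cases i
    · simp [sphC, Real.cos_arcsin, ← hz, Complex.norm_mul_cos_arg, z]
    · simp [sphC, Real.cos_arcsin, ← hz, Complex.norm_mul_sin_arg, z]
    · simp [sphC, h1]

lemma mu_sphere_lt_top : (μH[2] : Measure (E 2)) (sphere (0 : E 2) 1) < ⊤ := by
  have hconv : Convex ℝ (Icc (fun _ => -4 : Fin 2 → ℝ) (fun _ => 4)) := convex_Icc _ _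
  obtain ⟨C, hC⟩ := sphC_contDiff.contDiffOn.exists_lipschitzOnWith (s := Icc (fun _ => -4 : Fin 2 → ℝ) (fun _ => 4)) (by simp) hconv isCompact_Icc
  calc _ ≤ μH[2] (sphC '' (Icc (fun _ => -4) (fun _ => 4))) := measure_mono sphC_surj
    _ ≤ (C : ℝ≥0∞) ^ (2:ℝ) * μH[2] (Icc (fun _ => -4 : Fin 2 → ℝ) (fun _ => 4)) :=
        hC.hausdorffMeasure_image_le (by norm_num)
    _ < ⊤ := by
        have : (μH[2] : Measure (Fin 2 → ℝ)) = volume := by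
          have := hausdorffMeasure_pi_real (ι := Fin 2)
          simpa using this
        rw [this]
        exact ENNReal.mul_lt_top (ENNReal.rpow_lt_top_of_nonneg (by norm_num) (by simp)) isCompact_Icc.measure_lt_top

lemma mu_sphere_pos : 0 < (μH[2] : Measure (E 2)) (sphere (0 : E 2) 1) := by
  have hL : LipschitzWith 1 (fun x : E 2 => (![x 0, x 1] : Fin 2 → ℝ)) := by
    apply LipschitzWith.of_dist_le_mul
    intro x y
    simp only [NNReal.coe_one, one_mul]
    rw [dist_pi_le_iff dist_nonneg]
    intro i
    have := fun j : Fin 3 => PiLp.norm_apply_le (x - y) j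
    fin_cases i
    · simpa [dist_eq_norm] using this 0
    · simpa [dist_eq_norm] using this 1
  have h := hL.hausdorffMeasure_image_le (d := 2) (by norm_num) (sphere (0 : E 2) 1)
  have h2 : (μH[2] : Measure (Fin 2 → ℝ)) = volume := by
    have := hausdorffMeasure_pi_real (ι := Fin 2)
    simpa using this
  have h3 : Icc (fun _ => -(1/2) : Fin 2 → ℝ) (fun _ => 1/2) ⊆ (fun x : E 2 => (![x 0, x 1] : Fin 2 → ℝ)) '' (sphere (0 : E 2) 1) := by
    intro v hv
    have a := hv.1 0
    have b := hv.1 1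
    have c := hv.2 0
    have d := hv.2 1
    simp only at a b c d
    refine ⟨!₂[v 0, v 1, √(1 - v 0 ^ 2 - v 1 ^ 2)], ?_, ?_⟩
    · simp [EuclideanSpace.norm_eq, Fin.sum_univ_three]
      rw [Real.sq_sqrt (by nlinarith)]; ring
    · ext i; fin_cases i <;> simp
  have h4 : 0 < volume (Icc (fun _ => -(1/2) : Fin 2 → ℝ) (fun _ => 1/2)) := by
    rw [Real.volume_Icc_pi]; simp
    norm_num
  rw [h2] at h
  have h5 := lt_of_lt_of_le h4 (measure_mono h3)
  simpa using lt_of_lt_of_le h5 h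

instance : IsFiniteMeasure muS := by
  constructor; rw [muS, Measure.restrict_apply_univ]; exact mu_sphere_lt_top

/-- Hausdorff measure is a constant multiple of the cone measure. -/
lemma exists_const : ∃ c : ℝ, 0 < c ∧ ∀ A : Set (E 2), MeasurableSet A → A ⊆ sphere 0 1 →
    μH[2] A = ENNReal.ofReal c * sigS A := by
  have hm0 : muS + sigS ≠ 0 := by
    intro h; apply sigS_ne_zero; have h2 : (muS + sigS) univ = 0 := by rw [h]; simp
    rw [← Measure.measure_univ_eq_zero]
    simp only [Measure.add_apply, add_eq_zero] at h2
    exact h2.2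
  have hS : (muS + sigS) (sphere (0 : E 2) 1)ᶜ = 0 := by
    simp [muS_compl, sigS_compl]
  have hi : ∀ (f : E 2 ≃ₗᵢ[ℝ] E 2) (x : E 2) (r : ℝ), (muS + sigS) (closedBall (f x) r) = (muS + sigS) (closedBall x r) := by
    intro f x r; simp [muS_inv, sigS_inv]
  obtain ⟨κ, hκ⟩ := unique_aux muS (muS + sigS) (Measure.absolutelyContinuous_of_le (Measure.le_add_right le_rfl)) hm0 hS muS_inv hi
  obtain ⟨η, hη⟩ := unique_aux sigS (muS + sigS) (Measure.absolutelyContinuous_of_le (Measure.le_add_left le_rfl)) hm0 hS sigS_inv hi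
  have hη0 : η ≠ 0 := by
    intro h; rw [h] at hη; simp at hη; exact sigS_ne_zero hη
  have hm : (muS + sigS) univ ≠ 0 := by rwa [Ne, Measure.measure_univ_eq_zero]
  have hmt : (muS + sigS) univ ≠ ⊤ := measure_ne_top _ _
  have hηt : η ≠ ⊤ := by
    intro h
    have := congrArg (fun m : Measure (E 2) => m univ) hη
    simp only [Measure.smul_apply, smul_eq_mul, h, ENNReal.top_mul hm] at this
    exact measure_ne_top _ _ this
  have hκt : κ ≠ ⊤ := by
    intro h
    have := congrArg (fun m : Measure (E 2) => m univ) hκ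
    simp only [Measure.smul_apply, smul_eq_mul, h, ENNReal.top_mul hm] at this
    exact measure_ne_top _ _ this
  have hκ0 : κ ≠ 0 := by
    intro h; rw [h] at hκ; simp at hκ
    have := mu_sphere_pos
    have h2 : muS univ = 0 := by rw [hκ]; simp
    rw [muS, Measure.restrict_apply_univ] at h2
    exact this.ne' h2
  refine ⟨(κ / η).toReal, ENNReal.toReal_pos (by simp [hκ0, hηt]) (ENNReal.div_ne_top hκt hη0), ?_⟩
  intro A hA hAS
  rw [ENNReal.ofReal_toReal (ENNReal.div_ne_top hκt hη0)]
  have e1 : μH[2] A = muS A := by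
    rw [muS, Measure.restrict_apply hA, inter_eq_left.mpr hAS]
  have e2 := congrArg (fun m : Measure (E 2) => m A) hκ
  have e3 := congrArg (fun m : Measure (E 2) => m A) hη
  simp only [Measure.smul_apply, smul_eq_mul] at e2 e3
  rw [e1, e2, e3, ← mul_assoc, ENNReal.div_mul_cancel hη0 hηt]

end PartA1

section PartA2
open Filter Topology Metric Set
open scoped ENNReal

/-- coordinates in an orthonormal frame -/
def coordMap (B : OrthonormalBasis (Fin 3) ℝ (E 2)) (x : E 2) : ℝ × (ℝ × ℝ) :=
  (⟪B 0, x⟫, (⟪B 1, x⟫, ⟪B 2, x⟫))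

lemma coordMap_mp (B : OrthonormalBasis (Fin 3) ℝ (E 2)) :
    MeasurePreserving (coordMap B) volume volume := by
  have h1 := B.measurePreserving_repr
  have h2 := PiLp.volume_preserving_ofLp (Fin 3)
  have h3 := volume_preserving_piFinSuccAbove (fun _ : Fin 3 => ℝ) 0
  have h4 := (MeasurePreserving.id (volume : Measure ℝ)).prod (volume_preserving_finTwoArrow ℝ)
  have h := h4.comp (h3.comp (h2.comp h1))
  have e : coordMap B = Prod.map id ⇑MeasurableEquiv.finTwoArrow ∘ ⇑(MeasurableEquiv.piFinSuccAbove (fun x => ℝ) 0) ∘ WithLp.ofLp ∘ ⇑B.repr := by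
    funext x
    simp only [Function.comp, coordMap, Prod.map, ← OrthonormalBasis.repr_apply_apply]
    rfl
  rw [e]; exact h

lemma norm_sq_coord (B : OrthonormalBasis (Fin 3) ℝ (E 2)) (x : E 2) :
    ‖x‖ ^ 2 = ⟪B 0, x⟫ ^ 2 + ⟪B 1, x⟫ ^ 2 + ⟪B 2, x⟫ ^ 2 := by
  rw [← B.sum_sq_norm_inner_right x, Fin.sum_univ_three]; simp

/-- The part of the sphere over the gnomonic region `Q`. -/
def gset (B : OrthonormalBasis (Fin 3) ℝ (E 2)) (Q : Set (ℝ × ℝ)) : Set (E 2) :=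
  {x ∈ sphere (0 : E 2) 1 | 0 < ⟪B 0, x⟫ ∧ (⟪B 1, x⟫ / ⟪B 0, x⟫, ⟪B 2, x⟫ / ⟪B 0, x⟫) ∈ Q}

lemma gset_meas (B : OrthonormalBasis (Fin 3) ℝ (E 2)) {Q : Set (ℝ × ℝ)} (hQ : MeasurableSet Q) :
    MeasurableSet (gset B Q) := by
  have h0 : MeasurableSet {x : E 2 | 0 < ⟪B 0, x⟫} := measurableSet_lt measurable_const (by fun_prop)
  refine isClosed_sphere.measurableSet.inter (h0.inter ?_)
  have : Measurable fun x : E 2 => (⟪B 1, x⟫ / ⟪B 0, x⟫, ⟪B 2, x⟫ / ⟪B 0, x⟫) := by fun_prop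
  exact this hQ

lemma inner_z_sq (m : ℝ) (hm : 0 < m) :
    ∫⁻ z : ℝ, (if 0 < z ∧ z ^ 2 * m ^ 2 < 1 then ENNReal.ofReal (z ^ 2) else 0)
      = ENNReal.ofReal (1 / (3 * m ^ 3)) := by
  have h1 : ∀ z : ℝ, (if 0 < z ∧ z ^ 2 * m ^ 2 < 1 then ENNReal.ofReal (z ^ 2) else 0)
      = (Ioo 0 (1 / m)).indicator (fun z => ENNReal.ofReal (z ^ 2)) z := by
    intro z
    rw [indicator_apply]
    congr 1
    simp only [mem_Ioo, eq_iff_iff, and_congr_right_iff]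
    intro hz
    rw [lt_div_iff₀ hm, ← mul_pow]
    constructor
    · intro h; nlinarith [mul_pos hz hm]
    · intro h; nlinarith [mul_pos hz hm]
  simp_rw [h1]
  rw [lintegral_indicator measurableSet_Ioo, ← ofReal_integral_eq_lintegral_ofReal]
  · rw [← integral_Ioc_eq_integral_Ioo, ← intervalIntegral.integral_of_le (by positivity), integral_pow]
    congr 1; field_simp; norm_num; exact mul_inv_cancel₀ (by positivity)
  · exact (Continuous.integrableOn_Icc (by fun_prop)).mono_set Ioo_subset_Icc_self
  · filter_upwards with z; positivity

lemma sigS_gset (B : OrthonormalBasis (Fin 3) ℝ (E 2)) {Q : Set (ℝ × ℝ)} (hQ : MeasurableSet Q) :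
    sigS (gset B Q) = ∫⁻ q in Q, ENNReal.ofReal (1 / (3 * √(1 + q.1 ^ 2 + q.2 ^ 2) ^ 3)) := by
  rw [sigS_apply (gset_meas B hQ)]
  set C : Set (ℝ × (ℝ × ℝ)) := {c | 0 < c.1 ∧ c.1 ^ 2 + c.2.1 ^ 2 + c.2.2 ^ 2 < 1 ∧
    c.1⁻¹ • c.2 ∈ Q} with hC
  have hCm : MeasurableSet C := by
    have h0 : MeasurableSet {c : ℝ × (ℝ × ℝ) | 0 < c.1} := measurableSet_lt measurable_const (by fun_prop)
    have h1 : MeasurableSet {c : ℝ × (ℝ × ℝ) | c.1 ^ 2 + c.2.1 ^ 2 + c.2.2 ^ 2 < 1} := measurableSet_lt (by fun_prop) measurable_const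
    refine h0.inter (h1.inter ?_)
    have : Measurable fun c : ℝ × (ℝ × ℝ) => c.1⁻¹ • c.2 := by fun_prop
    exact this hQ
  have e1 : ({x : E 2 | ‖x‖⁻¹ • x ∈ gset B Q} ∩ (ball (0 : E 2) 1 \ {0})) = coordMap B ⁻¹' C := by
    ext x
    have hn := norm_sq_coord B x
    simp only [mem_inter_iff, mem_ofPred_eq, gset, mem_sphere_iff_norm, sub_zero, mem_ball_zero_iff,
      Set.mem_sdiff, mem_singleton_iff, mem_preimage, hC, coordMap, inner_smul_right, Prod.smul_mk, smul_eq_mul]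
    by_cases hx : x = 0
    · simp [hx]
    have hp : 0 < ‖x‖ := norm_pos_iff.mpr hx
    have hp' : 0 < ‖x‖⁻¹ := by positivity
    rw [mul_div_mul_left _ _ hp'.ne', mul_div_mul_left _ _ hp'.ne', norm_smul, norm_inv, norm_norm,
      inv_mul_cancel₀ hp.ne', mul_pos_iff_of_pos_left hp', ← hn, inv_mul_eq_div, inv_mul_eq_div]
    have : ‖x‖ < 1 ↔ ‖x‖ ^ 2 < 1 := by constructor <;> intro h <;> nlinarith
    rw [this]; tauto
  rw [e1, (coordMap_mp B).measure_preimage hCm.nullMeasurableSet, Measure.volume_eq_prod,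
    Measure.prod_apply hCm]
  have e2 : ∀ z : ℝ, volume (Prod.mk z ⁻¹' C) = ∫⁻ q in Q, (if 0 < z ∧ z ^ 2 * √(1 + q.1 ^ 2 + q.2 ^ 2) ^ 2 < 1 then ENNReal.ofReal (z ^ 2) else 0) := by
    intro z
    by_cases hz : 0 < z
    · set Qz : Set (ℝ × ℝ) := {q | q ∈ Q ∧ z ^ 2 * √(1 + q.1 ^ 2 + q.2 ^ 2) ^ 2 < 1} with hQz
      have hm1 : MeasurableSet {q : ℝ × ℝ | z ^ 2 * √(1 + q.1 ^ 2 + q.2 ^ 2) ^ 2 < 1} :=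
        measurableSet_lt (by fun_prop) measurable_const
      have : Prod.mk z ⁻¹' C = (fun q : ℝ × ℝ => z⁻¹ • q) ⁻¹' Qz := by
        ext q
        simp only [hC, hQz, mem_preimage, mem_ofPred_eq, hz, true_and, Prod.smul_fst, Prod.smul_snd, smul_eq_mul]
        rw [Real.sq_sqrt (by positivity), and_comm]
        have : z ^ 2 * (1 + (z⁻¹ * q.1) ^ 2 + (z⁻¹ * q.2) ^ 2) = z ^ 2 + q.1 ^ 2 + q.2 ^ 2 := by
          field_simp
        rw [this]
      rw [this, Measure.addHaar_preimage_smul _ (inv_ne_zero hz.ne')]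
      simp only [hz, true_and]
      have e3 : ∀ q : ℝ × ℝ, (if z ^ 2 * √(1 + q.1 ^ 2 + q.2 ^ 2) ^ 2 < 1 then ENNReal.ofReal (z ^ 2) else 0) = ({q : ℝ × ℝ | z ^ 2 * √(1 + q.1 ^ 2 + q.2 ^ 2) ^ 2 < 1}).indicator (fun _ => ENNReal.ofReal (z ^ 2)) q := by
        intro q; rw [indicator_apply]; rfl
      simp_rw [e3]
      rw [lintegral_indicator hm1, lintegral_const, Measure.restrict_restrict hm1, Measure.restrict_apply_univ, inter_comm]
      simp [abs_of_pos hz]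
      rfl
    · have : Prod.mk z ⁻¹' C = ∅ := by ext q; simp [hC, hz]
      rw [this]; simp [hz]
  simp_rw [e2]
  rw [lintegral_lintegral_swap]
  · congr 1; ext q
    rw [inner_z_sq _ (by positivity)]
  · apply Measurable.aemeasurable
    apply Measurable.ite
    · have h0 : MeasurableSet {c : ℝ × (ℝ × ℝ) | 0 < c.1} := measurableSet_lt measurable_const (by fun_prop)
      have h1 : MeasurableSet {c : ℝ × (ℝ × ℝ) | c.1 ^ 2 * √(1 + c.2.1 ^ 2 + c.2.2 ^ 2) ^ 2 < 1} := measurableSet_lt (by fun_prop) measurable_const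
      exact h0.inter h1
    · fun_prop
    · fun_prop
end PartA2

section PartA3
open Filter Topology Metric Set
open scoped ENNReal

lemma radial_int (a b : ℝ) (ha : 0 ≤ a) (hab : a ≤ b) :
    ∫⁻ s in Ioc a b, ENNReal.ofReal (s * (1 / (3 * √(1 + s ^ 2) ^ 3)))
      = ENNReal.ofReal (1 / 3 * (1 / √(1 + a ^ 2) - 1 / √(1 + b ^ 2))) := by
  have hc : Continuous fun s : ℝ => s * (1 / (3 * √(1 + s ^ 2) ^ 3)) := by
    have : ∀ s : ℝ, 3 * √(1 + s ^ 2) ^ 3 ≠ 0 := fun s => by positivity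
    fun_prop (disch := assumption)
  rw [← ofReal_integral_eq_lintegral_ofReal]
  · congr 1
    rw [← intervalIntegral.integral_of_le hab]
    have := intervalIntegral.integral_eq_sub_of_hasDerivAt (a := a) (b := b)
      (f := fun s => - (1 / 3) * (1 / √(1 + s ^ 2))) (f' := fun s => s * (1 / (3 * √(1 + s ^ 2) ^ 3)))
      (fun s _ => ?_) (hc.intervalIntegrable _ _)
    · rw [this]; ring
    · have hp : 0 < 1 + s ^ 2 := by positivity
      have h1 : HasDerivAt (fun s : ℝ => 1 + s ^ 2) (2 * s) s := by
        simpa using (hasDerivAt_pow 2 s).const_add 1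
      have h2 := (h1.sqrt hp.ne').inv (by positivity)
      have h3 := h2.const_mul (-(1/3 : ℝ))
      have e : (fun s : ℝ => - (1 / 3) * (1 / √(1 + s ^ 2))) = fun s => - (1/3 : ℝ) * (√(1 + s ^ 2))⁻¹ := by
        funext s; rw [one_div (√_)]
      rw [e]
      refine HasDerivAt.congr_deriv h3 ?_
      field_simp
  · exact (hc.integrableOn_Icc).mono_set Ioc_subset_Icc_self
  · filter_upwards [ae_restrict_mem measurableSet_Ioc] with s hs
    have : 0 ≤ s := by linarith [hs.1]
    positivity

lemma polar_gen {Q : Set (ℝ × ℝ)} (hQ : MeasurableSet Q) {Θ : Set ℝ} (hΘ : MeasurableSet Θ)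
    (hΘ2 : Θ ⊆ Ioo (-π) π) (α β : ℝ → ℝ) (hα : ∀ θ ∈ Θ, 0 ≤ α θ) (hβ : ∀ θ ∈ Θ, α θ ≤ β θ)
    (h : ∀ s > 0, ∀ θ ∈ Ioo (-π) π, (s * cos θ, s * sin θ) ∈ Q ↔ θ ∈ Θ ∧ α θ < s ∧ s ≤ β θ) :
    ∫⁻ q in Q, ENNReal.ofReal (1 / (3 * √(1 + q.1 ^ 2 + q.2 ^ 2) ^ 3)) =
      ∫⁻ θ in Θ, ENNReal.ofReal (1 / 3 * (1 / √(1 + α θ ^ 2) - 1 / √(1 + β θ ^ 2))) := by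
  set g : ℝ × ℝ → ℝ≥0∞ := fun q => ENNReal.ofReal (1 / (3 * √(1 + q.1 ^ 2 + q.2 ^ 2) ^ 3)) with hg
  have hgm : Measurable g := by rw [hg]; fun_prop
  have hgi : Measurable (Q.indicator g) := hgm.indicator hQ
  rw [← lintegral_indicator hQ, ← lintegral_comp_polarCoord_symm]
  rw [polarCoord_target, Measure.volume_eq_prod, ← Measure.prod_restrict, lintegral_prod_symm]
  · rw [← lintegral_indicator measurableSet_Ioo, ← lintegral_indicator hΘ]
    congr 1; ext θ
    by_cases hθ : θ ∈ Ioo (-π) π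
    swap
    · rw [indicator_of_notMem hθ, indicator_of_notMem (fun h => hθ (hΘ2 h))]
    rw [indicator_of_mem hθ]
    by_cases hθ2 : θ ∈ Θ
    · rw [indicator_of_mem hθ2, ← radial_int _ _ (hα θ hθ2) (hβ θ hθ2), ← lintegral_indicator measurableSet_Ioi, ← lintegral_indicator measurableSet_Ioc]
      congr 1; ext s
      by_cases hs : 0 < s
      · rw [indicator_of_mem (show s ∈ Ioi 0 from hs)]
        simp only [polarCoord_symm_apply, smul_eq_mul]
        by_cases hsb : s ∈ Ioc (α θ) (β θ)
        · rw [indicator_of_mem hsb, indicator_of_mem ((h s hs θ hθ).2 ⟨hθ2, hsb⟩)]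
          simp only [g]
          rw [← ENNReal.ofReal_mul hs.le]
          have e9 : 1 + (s * cos θ) ^ 2 + (s * sin θ) ^ 2 = 1 + s ^ 2 := by nlinarith [sin_sq_add_cos_sq θ]
          rw [e9]
        · rw [indicator_of_notMem hsb, indicator_of_notMem (fun hh => hsb ((h s hs θ hθ).1 hh).2), mul_zero]
      · rw [indicator_of_notMem (show s ∉ Ioi 0 from hs), indicator_of_notMem]
        intro hh; exact hs (lt_of_le_of_lt (hα θ hθ2) hh.1)
    · rw [indicator_of_notMem hθ2]
      rw [setLIntegral_congr_fun (g := fun _ => 0) measurableSet_Ioi, lintegral_zero]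
      intro s hs
      simp only [polarCoord_symm_apply, smul_eq_mul]
      rw [indicator_of_notMem (fun hh => hθ2 ((h s hs θ hθ).1 hh).1), mul_zero]
  · apply Measurable.aemeasurable
    have hm : Measurable fun p : ℝ × ℝ => polarCoord.symm p := by
      simp only [polarCoord_symm_apply]; fun_prop
    have := hgi.comp hm
    simp only [smul_eq_mul]
    exact (by fun_prop : Measurable fun p : ℝ × ℝ => ENNReal.ofReal p.1).mul this

/-- Gnomonic disc. -/
def QD (t : ℝ) : Set (ℝ × ℝ) := {q | q.1 ^ 2 + q.2 ^ 2 ≤ t ^ 2}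
/-- Gnomonic open half-cap. -/
def QH (t φ : ℝ) : Set (ℝ × ℝ) :=
  {q | 0 < q.2 ∧ q.1 ≤ t ∧ q.2 * cos φ < q.1 * sin φ ∧ t ^ 2 < q.1 ^ 2 + q.2 ^ 2}
/-- Gnomonic closed half-cap. -/
def QC (t φ : ℝ) : Set (ℝ × ℝ) :=
  {q | 0 ≤ q.2 ∧ q.1 ≤ t ∧ q.2 * cos φ ≤ q.1 * sin φ ∧ t ^ 2 < q.1 ^ 2 + q.2 ^ 2}

lemma QD_meas (t : ℝ) : MeasurableSet (QD t) := measurableSet_le (by fun_prop) (by fun_prop)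
lemma QH_meas (t φ : ℝ) : MeasurableSet (QH t φ) := by
  have h1 : MeasurableSet {q : ℝ × ℝ | 0 < q.2} := measurableSet_lt (by fun_prop) (by fun_prop)
  have h2 : MeasurableSet {q : ℝ × ℝ | q.1 ≤ t} := measurableSet_le (by fun_prop) (by fun_prop)
  have h3 : MeasurableSet {q : ℝ × ℝ | q.2 * cos φ < q.1 * sin φ} := measurableSet_lt (by fun_prop) (by fun_prop)
  have h4 : MeasurableSet {q : ℝ × ℝ | t ^ 2 < q.1 ^ 2 + q.2 ^ 2} := measurableSet_lt (by fun_prop) (by fun_prop)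
  exact h1.inter (h2.inter (h3.inter h4))
lemma QC_meas (t φ : ℝ) : MeasurableSet (QC t φ) := by
  have h1 : MeasurableSet {q : ℝ × ℝ | 0 ≤ q.2} := measurableSet_le (by fun_prop) (by fun_prop)
  have h2 : MeasurableSet {q : ℝ × ℝ | q.1 ≤ t} := measurableSet_le (by fun_prop) (by fun_prop)
  have h3 : MeasurableSet {q : ℝ × ℝ | q.2 * cos φ ≤ q.1 * sin φ} := measurableSet_le (by fun_prop) (by fun_prop)
  have h4 : MeasurableSet {q : ℝ × ℝ | t ^ 2 < q.1 ^ 2 + q.2 ^ 2} := measurableSet_lt (by fun_prop) (by fun_prop)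
  exact h1.inter (h2.inter (h3.inter h4))

lemma sqrt_tan {r : ℝ} (h0 : 0 < r) (h1 : r < π / 2) : 1 / √(1 + tan r ^ 2) = cos r := by
  have hc : 0 < cos r := cos_pos_of_mem_Ioo ⟨by linarith, h1⟩
  rw [one_div, Real.inv_sqrt_one_add_tan_sq hc]

/-- angular integral of a half-cap -/
def FH (r φ : ℝ) : ℝ := φ * cos r - arcsin (sin φ * cos r)

lemma lint_disc {r : ℝ} (h0 : 0 < r) (h1 : r < π / 2) :
    ∫⁻ q in QD (tan r), ENNReal.ofReal (1 / (3 * √(1 + q.1 ^ 2 + q.2 ^ 2) ^ 3)) =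
      ENNReal.ofReal (1 / 3 * (2 * π * (1 - cos r))) := by
  have ht : 0 < tan r := tan_pos_of_pos_of_lt_pi_div_two h0 h1
  rw [polar_gen (QD_meas _) (Θ := Ioo (-π) π) measurableSet_Ioo subset_rfl (fun _ => 0) (fun _ => tan r)
    (fun _ _ => le_rfl) (fun _ _ => ht.le)]
  · simp only [sqrt_tan h0 h1]
    rw [setLIntegral_const, Real.volume_Ioo, ← ENNReal.ofReal_mul]
    · congr 1; norm_num; ring
    · have := cos_le_one r
      norm_num; exact this
  · intro s hs θ hθ
    simp only [hθ, true_and, QD, mem_ofPred_eq, hs]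
    have : (s * cos θ) ^ 2 + (s * sin θ) ^ 2 = s ^ 2 := by nlinarith [sin_sq_add_cos_sq θ]
    rw [this]
    constructor
    · intro h; nlinarith
    · intro h; nlinarith

lemma int_cap {r φ : ℝ} (h0 : 0 < r) (h1 : r < π / 2) (p0 : 0 < φ) (p1 : φ < π / 2) :
    ∫⁻ θ in Icc 0 φ, ENNReal.ofReal (1 / 3 * (1 / √(1 + tan r ^ 2) - 1 / √(1 + (tan r / cos θ) ^ 2)))
     = ENNReal.ofReal (1 / 3 * FH r φ) := by
  have ht : 0 < tan r := tan_pos_of_pos_of_lt_pi_div_two h0 h1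
  have hc : 0 < cos r := cos_pos_of_mem_Ioo ⟨by linarith, h1⟩
  have hcos : ∀ θ ∈ Icc 0 φ, 0 < cos θ := fun θ hθ => cos_pos_of_mem_Ioo ⟨by linarith [hθ.1], by linarith [hθ.2]⟩
  have hcont : ContinuousOn (fun θ => 1 / 3 * (1 / √(1 + tan r ^ 2) - 1 / √(1 + (tan r / cos θ) ^ 2))) (Icc 0 φ) := by
    have hne : ∀ θ ∈ Icc 0 φ, cos θ ≠ 0 := fun θ hθ => (hcos θ hθ).ne'
    have hne2 : ∀ θ ∈ Icc 0 φ, √(1 + (tan r / cos θ) ^ 2) ≠ 0 := fun θ hθ => by positivity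
    apply ContinuousOn.mul continuousOn_const
    apply ContinuousOn.sub continuousOn_const
    apply ContinuousOn.div continuousOn_const _ hne2
    apply ContinuousOn.sqrt
    apply ContinuousOn.add continuousOn_const
    apply ContinuousOn.pow
    exact ContinuousOn.div continuousOn_const continuous_cos.continuousOn hne
  rw [← ofReal_integral_eq_lintegral_ofReal]
  · congr 1
    rw [integral_Icc_eq_integral_Ioc, ← intervalIntegral.integral_of_le p0.le]
    have := intervalIntegral.integral_eq_sub_of_hasDerivAt (a := 0) (b := φ)
      (f := fun θ => 1 / 3 * (θ * cos r - arcsin (sin θ * cos r)))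
      (f' := fun θ => 1 / 3 * (1 / √(1 + tan r ^ 2) - 1 / √(1 + (tan r / cos θ) ^ 2)))
      (fun θ hθ => ?_) (by apply ContinuousOn.intervalIntegrable; rwa [uIcc_of_le p0.le])
    · rw [this]; simp [FH]
    · rw [uIcc_of_le p0.le] at hθ
      have hcθ := hcos θ hθ
      have hs0 : 0 ≤ sin θ := sin_nonneg_of_nonneg_of_le_pi hθ.1 (by linarith [hθ.2])
      have hsc : sin θ * cos r < 1 := by nlinarith [sin_sq_add_cos_sq θ, sin_le_one θ, cos_le_one r, sin_sq_add_cos_sq r]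
      have hd : HasDerivAt (fun θ => sin θ * cos r) (cos θ * cos r) θ := (hasDerivAt_sin θ).mul_const _
      have h2 := (Real.hasDerivAt_arcsin (x := sin θ * cos r) (by nlinarith [mul_nonneg hs0 hc.le]) hsc.ne).comp θ hd
      have h3 := (((hasDerivAt_id θ).mul_const (cos r)).sub h2).const_mul (1/3 : ℝ)
      refine HasDerivAt.congr_deriv h3 ?_
      rw [sqrt_tan h0 h1]
      have e1 : √(1 + (tan r / cos θ) ^ 2) = √(1 - (sin θ * cos r) ^ 2) / (cos θ * cos r) := by
        rw [eq_div_iff (by positivity)]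
        rw [← Real.sqrt_sq (show 0 ≤ cos θ * cos r by positivity), ← Real.sqrt_mul (by positivity)]
        congr 1
        rw [tan_eq_sin_div_cos]
        field_simp
        nlinarith [sin_sq_add_cos_sq θ, sin_sq_add_cos_sq r]
      rw [e1]
      have : 0 < √(1 - (sin θ * cos r) ^ 2) := Real.sqrt_pos.2 (by nlinarith [mul_nonneg hs0 hc.le])
      field_simp
  · exact hcont.integrableOn_Icc
  · filter_upwards [ae_restrict_mem measurableSet_Icc] with θ hθ
    have hcθ := hcos θ hθ
    have : √(1 + tan r ^ 2) ≤ √(1 + (tan r / cos θ) ^ 2) := by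
      apply Real.sqrt_le_sqrt
      have : tan r ≤ tan r / cos θ := by rw [le_div_iff₀ hcθ]; nlinarith [cos_le_one θ]
      nlinarith
    have : 1 / √(1 + (tan r / cos θ) ^ 2) ≤ 1 / √(1 + tan r ^ 2) := by
      apply one_div_le_one_div_of_le (by positivity) this
    simp only [Pi.zero_apply]
    linarith

lemma lint_capC {r φ : ℝ} (h0 : 0 < r) (h1 : r < π / 2) (p0 : 0 < φ) (p1 : φ < π / 2) :
    ∫⁻ q in QC (tan r) φ, ENNReal.ofReal (1 / (3 * √(1 + q.1 ^ 2 + q.2 ^ 2) ^ 3)) =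
      ENNReal.ofReal (1 / 3 * FH r φ) := by
  have ht : 0 < tan r := tan_pos_of_pos_of_lt_pi_div_two h0 h1
  have hcos : ∀ θ ∈ Icc 0 φ, 0 < cos θ := fun θ hθ => cos_pos_of_mem_Ioo ⟨by linarith [hθ.1], by linarith [hθ.2]⟩
  rw [polar_gen (QC_meas _ _) (Θ := Icc 0 φ) measurableSet_Icc (fun θ hθ => ⟨by linarith [hθ.1], by linarith [hθ.2]⟩)
    (fun _ => tan r) (fun θ => tan r / cos θ)
    (fun _ _ => ht.le) (fun θ hθ => by rw [le_div_iff₀ (hcos θ hθ)]; nlinarith [cos_le_one θ])]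
  · exact int_cap h0 h1 p0 p1
  · intro s hs θ hθ
    simp only [QC, mem_ofPred_eq, mem_Icc]
    have e : (s * cos θ) ^ 2 + (s * sin θ) ^ 2 = s ^ 2 := by nlinarith [sin_sq_add_cos_sq θ]
    have e2 : tan r ^ 2 < s ^ 2 ↔ tan r < s := by constructor <;> intro h <;> nlinarith
    have e3 : s * sin θ * cos φ ≤ s * cos θ * sin φ ↔ 0 ≤ sin (φ - θ) := by
      rw [sin_sub, ← mul_nonneg_iff_of_pos_left hs]
      constructor <;> intro h <;> nlinarith
    rw [e, e2, e3, mul_nonneg_iff_of_pos_left hs]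
    have e4 : 0 ≤ sin θ ↔ 0 ≤ θ := by
      constructor
      · intro h; by_contra h'; linarith [sin_neg_of_neg_of_neg_pi_lt (not_le.1 h') hθ.1]
      · intro h; exact sin_nonneg_of_nonneg_of_le_pi h hθ.2.le
    rw [e4]
    have e5 : 0 ≤ θ → (0 ≤ sin (φ - θ) ↔ θ ≤ φ) := by
      intro hθ0
      constructor
      · intro h; by_contra h'; linarith [sin_neg_of_neg_of_neg_pi_lt (show φ - θ < 0 by linarith) (by linarith [hθ.2])]
      · intro h; exact sin_nonneg_of_nonneg_of_le_pi (by linarith) (by linarith)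
    constructor
    · rintro ⟨a, b, c, d⟩
      have hc := (e5 a).1 c
      exact ⟨⟨a, hc⟩, d, by rw [le_div_iff₀ (hcos θ ⟨a, hc⟩)]; exact b⟩
    · rintro ⟨⟨a, hc⟩, d, b⟩
      rw [le_div_iff₀ (hcos θ ⟨a, hc⟩)] at b
      exact ⟨a, b, (e5 a).2 hc, d⟩

lemma lint_capH {r φ : ℝ} (h0 : 0 < r) (h1 : r < π / 2) (p0 : 0 < φ) (p1 : φ < π / 2) :
    ∫⁻ q in QH (tan r) φ, ENNReal.ofReal (1 / (3 * √(1 + q.1 ^ 2 + q.2 ^ 2) ^ 3)) =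
      ENNReal.ofReal (1 / 3 * FH r φ) := by
  have ht : 0 < tan r := tan_pos_of_pos_of_lt_pi_div_two h0 h1
  have hcos : ∀ θ ∈ Ioo 0 φ, 0 < cos θ := fun θ hθ => cos_pos_of_mem_Ioo ⟨by linarith [hθ.1], by linarith [hθ.2]⟩
  rw [polar_gen (QH_meas _ _) (Θ := Ioo 0 φ) measurableSet_Ioo (fun θ hθ => ⟨by linarith [hθ.1, pi_pos], by linarith [hθ.2]⟩)
    (fun _ => tan r) (fun θ => tan r / cos θ)
    (fun _ _ => ht.le) (fun θ hθ => by rw [le_div_iff₀ (hcos θ hθ)]; nlinarith [cos_le_one θ])]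
  · rw [← int_cap h0 h1 p0 p1]
    exact setLIntegral_congr Ioo_ae_eq_Icc
  · intro s hs θ hθ
    simp only [QH, mem_ofPred_eq, mem_Ioo]
    have e : (s * cos θ) ^ 2 + (s * sin θ) ^ 2 = s ^ 2 := by nlinarith [sin_sq_add_cos_sq θ]
    have e2 : tan r ^ 2 < s ^ 2 ↔ tan r < s := by constructor <;> intro h <;> nlinarith
    have e3 : s * sin θ * cos φ < s * cos θ * sin φ ↔ 0 < sin (φ - θ) := by
      rw [sin_sub, ← mul_pos_iff_of_pos_left hs]
      constructor <;> intro h <;> nlinarith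
    rw [e, e2, e3, mul_pos_iff_of_pos_left hs]
    have e4 : 0 < sin θ ↔ 0 < θ := by
      constructor
      · intro h; by_contra h'; linarith [sin_nonpos_of_nonpos_of_neg_pi_le (not_lt.1 h') hθ.1.le]
      · intro h; exact sin_pos_of_pos_of_lt_pi h hθ.2
    rw [e4]
    have e5 : 0 < θ → (0 < sin (φ - θ) ↔ θ < φ) := by
      intro hθ0
      constructor
      · intro h; by_contra h'; linarith [sin_nonpos_of_nonpos_of_neg_pi_le (show φ - θ ≤ 0 by linarith) (by linarith [hθ.2])]
      · intro h; exact sin_pos_of_pos_of_lt_pi (by linarith) (by linarith)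
    constructor
    · rintro ⟨a, b, c, d⟩
      have hc := (e5 a).1 c
      exact ⟨⟨a, hc⟩, d, by rw [le_div_iff₀ (hcos θ ⟨a, hc⟩)]; exact b⟩
    · rintro ⟨⟨a, hc⟩, d, b⟩
      rw [le_div_iff₀ (hcos θ ⟨a, hc⟩)] at b
      exact ⟨a, b, (e5 a).2 hc, d⟩

/-- Summary of the measure computations. -/
lemma measure_summary : ∃ c : ℝ, 0 < c ∧ ∀ (B : OrthonormalBasis (Fin 3) ℝ (E 2)) (r : ℝ), 0 < r → r < π / 2 →
    μH[2] (gset B (QD (tan r))) = ENNReal.ofReal (c * (2 * π * (1 - cos r))) ∧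
    ∀ φ : ℝ, 0 < φ → φ < π / 2 →
      μH[2] (gset B (QH (tan r) φ)) = ENNReal.ofReal (c * FH r φ) ∧
      μH[2] (gset B (QC (tan r) φ)) = ENNReal.ofReal (c * FH r φ) := by
  obtain ⟨c, hc, h⟩ := exists_const
  refine ⟨c * (1 / 3), by positivity, fun B r h0 h1 => ⟨?_, fun φ p0 p1 => ⟨?_, ?_⟩⟩⟩
  · rw [h _ (gset_meas B (QD_meas _)) (fun x hx => hx.1), sigS_gset B (QD_meas _), lint_disc h0 h1,
      ← ENNReal.ofReal_mul hc.le, mul_assoc c]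
  · rw [h _ (gset_meas B (QH_meas _ _)) (fun x hx => hx.1), sigS_gset B (QH_meas _ _), lint_capH h0 h1 p0 p1,
      ← ENNReal.ofReal_mul hc.le, mul_assoc]
  · rw [h _ (gset_meas B (QC_meas _ _)) (fun x hx => hx.1), sigS_gset B (QC_meas _ _), lint_capC h0 h1 p0 p1,
      ← ENNReal.ofReal_mul hc.le, mul_assoc]
end PartA3

section PartB
open Filter Topology Metric Set

lemma us_norm {x : E 2} : x ∈ unitSphere 2 ↔ ‖x‖ = 1 := by simp [unitSphere]
lemma us_inner {x : E 2} (h : x ∈ unitSphere 2) : ⟪x, x⟫ = 1 := by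
  rw [real_inner_self_eq_norm_sq, us_norm.1 h]; norm_num
lemma us_of_inner {x : E 2} (h : ⟪x, x⟫ = 1) : x ∈ unitSphere 2 := by
  rw [real_inner_self_eq_norm_sq] at h
  rw [us_norm]; nlinarith [norm_nonneg x]
lemma us_normalize {x : E 2} (h : x ≠ 0) : ‖x‖⁻¹ • x ∈ unitSphere 2 := by
  rw [us_norm, norm_smul, norm_inv, norm_norm, inv_mul_cancel₀ (norm_ne_zero_iff.2 h)]
lemma us_inner_le {x y : E 2} (hx : x ∈ unitSphere 2) (hy : y ∈ unitSphere 2) : ⟪x, y⟫ ≤ 1 := by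
  have := real_inner_le_norm x y
  rwa [us_norm.1 hx, us_norm.1 hy, one_mul] at this
lemma us_le_inner {x y : E 2} (hx : x ∈ unitSphere 2) (hy : y ∈ unitSphere 2) : -1 ≤ ⟪x, y⟫ := by
  have := neg_le_of_abs_le (abs_real_inner_le_norm x y)
  rwa [us_norm.1 hx, us_norm.1 hy, one_mul] at this
lemma us_eq {x y : E 2} (hx : x ∈ unitSphere 2) (hy : y ∈ unitSphere 2) (h : 1 ≤ ⟪x, y⟫) : x = y := by
  have h1 : ⟪x, y⟫ = 1 := le_antisymm (us_inner_le hx hy) h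
  exact (inner_eq_one_iff_of_norm_eq_one (us_norm.1 hx) (us_norm.1 hy)).1 h1

lemma seg_comb {x y : E 2} (hx : x ∈ unitSphere 2) (hy : y ∈ unitSphere 2) {s t : ℝ} (hs : 0 ≤ s)
    (ht : 0 ≤ t) (hz : s • x + t • y ∈ unitSphere 2) : s • x + t • y ∈ seg x y := by
  refine ⟨hz, ?_⟩
  unfold gdist
  have hxx := us_inner hx
  have hyy := us_inner hy
  have hzz := us_inner hz
  have hyx : ⟪y, x⟫ = ⟪x, y⟫ := real_inner_comm _ _
  set c := ⟪x, y⟫ with hc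
  have hc1 : c ≤ 1 := us_inner_le hx hy
  have hc2 : -1 ≤ c := us_le_inner hx hy
  have ha : ⟪x, s • x + t • y⟫ = s + t * c := by
    rw [inner_add_right, inner_smul_right, inner_smul_right, hxx]; ring
  have hb : ⟪s • x + t • y, y⟫ = s * c + t := by
    rw [inner_add_left, real_inner_smul_left, real_inner_smul_left, hyy]; ring
  have hn : s ^ 2 + t ^ 2 + 2 * s * t * c = 1 := by
    rw [inner_add_left, inner_add_right, inner_add_right] at hzz
    simp only [real_inner_smul_left, inner_smul_right, hxx, hyy, hyx] at hzz
    rw [← hc] at hzz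
    linarith
  rw [ha, hb]
  have b1 := us_inner_le hx hz
  have b2 := us_le_inner hx hz
  have b3 := us_inner_le hz hy
  have b4 := us_le_inner hz hy
  rw [ha] at b1 b2; rw [hb] at b3 b4
  have h1c : 0 ≤ 1 - c ^ 2 := by nlinarith
  have s1 : sin (arccos (s + t * c)) = t * √(1 - c ^ 2) := by
    rw [sin_arccos, show 1 - (s + t * c) ^ 2 = t ^ 2 * (1 - c ^ 2) by rw [← hn]; nlinarith [hn], Real.sqrt_mul (by positivity), Real.sqrt_sq ht]
  have s2 : sin (arccos (s * c + t)) = s * √(1 - c ^ 2) := by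
    rw [sin_arccos, show 1 - (s * c + t) ^ 2 = s ^ 2 * (1 - c ^ 2) by rw [← hn]; nlinarith [hn], Real.sqrt_mul (by positivity), Real.sqrt_sq hs]
  have hcos : cos (arccos (s + t * c) + arccos (s * c + t)) = c := by
    rw [cos_add, s1, s2, cos_arccos b2 b1, cos_arccos b4 b3]
    have := Real.mul_self_sqrt h1c
    have e : t * √(1 - c ^ 2) * (s * √(1 - c ^ 2)) = t * s * (1 - c ^ 2) := by linear_combination (t * s) * this
    rw [e]
    have : c = c * (s ^ 2 + t ^ 2 + 2 * s * t * c) := by rw [hn]; ring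
    linarith [this]
  have hle : arccos (s + t * c) + arccos (s * c + t) ≤ π := by
    have : arccos (s + t * c) ≤ arccos (-(s * c + t)) := arccos_le_arccos (by nlinarith)
    rw [arccos_neg] at this; linarith
  rw [← hcos, arccos_cos (add_nonneg (arccos_nonneg _) (arccos_nonneg _)) hle, hcos]

lemma seg_cone {x y z : E 2} (hx : x ∈ unitSphere 2) (hy : y ∈ unitSphere 2) (hxy : -1 < ⟪x, y⟫)
    (hz : z ∈ seg x y) : ∃ s t : ℝ, 0 ≤ s ∧ 0 ≤ t ∧ z = s • x + t • y := by
  obtain ⟨hz1, hz2⟩ := hz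
  unfold gdist at hz2
  have hxx := us_inner hx
  have hyy := us_inner hy
  have hzz := us_inner hz1
  set α := arccos ⟪x, z⟫ with hα
  set β := arccos ⟪z, y⟫ with hβ
  have ca : cos α = ⟪x, z⟫ := cos_arccos (us_le_inner hx hz1) (us_inner_le hx hz1)
  have cb : cos β = ⟪z, y⟫ := cos_arccos (us_le_inner hz1 hy) (us_inner_le hz1 hy)
  have cc : cos (α + β) = ⟪x, y⟫ := by rw [hz2]; exact cos_arccos (us_le_inner hx hy) (us_inner_le hx hy)
  have sa : 0 ≤ sin α := sin_nonneg_of_nonneg_of_le_pi (arccos_nonneg _) (arccos_le_pi _)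
  have sb : 0 ≤ sin β := sin_nonneg_of_nonneg_of_le_pi (arccos_nonneg _) (arccos_le_pi _)
  have sc : 0 ≤ sin (α + β) := by rw [hz2]; exact sin_nonneg_of_nonneg_of_le_pi (arccos_nonneg _) (arccos_le_pi _)
  have key : sin (α + β) • z - sin β • x - sin α • y = 0 := by
    rw [← inner_self_eq_zero (𝕜 := ℝ)]
    simp only [inner_sub_left, inner_sub_right, real_inner_smul_left, inner_smul_right]
    rw [hxx, hyy, hzz, real_inner_comm x z, real_inner_comm z y, real_inner_comm x y, ← ca, ← cb, ← cc, sin_add, cos_add]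
    have h1 := sin_sq_add_cos_sq α
    have h2 := sin_sq_add_cos_sq β
    have e1 : cos α ^ 2 = 1 - sin α ^ 2 := by linarith
    have e2 : cos β ^ 2 = 1 - sin β ^ 2 := by linarith
    ring_nf
    rw [e1, e2]; ring
  rcases sc.lt_or_eq with h | h
  · refine ⟨sin β / sin (α + β), sin α / sin (α + β), by positivity, by positivity, ?_⟩
    rw [sub_sub, sub_eq_zero] at key
    rw [div_eq_inv_mul, div_eq_inv_mul, mul_smul, mul_smul, ← smul_add, ← key, smul_smul, inv_mul_cancel₀ h.ne', one_smul]
  · have : cos (α + β) = 1 := by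
      have := sin_sq_add_cos_sq (α + β)
      rw [← h] at this
      rw [← cc] at hxy
      nlinarith
    rw [this] at cc
    have h0 : α + β = 0 := by rw [hz2, ← cc, arccos_one]
    have hα0 : α = 0 := by linarith [arccos_nonneg ⟪x, z⟫, arccos_nonneg ⟪z, y⟫]
    rw [hα0, cos_zero] at ca
    refine ⟨1, 0, by norm_num, le_rfl, ?_⟩
    rw [us_eq hx hz1 ca.le]; simp

/-- cone over a set -/
def Kcone (K : Set (E 2)) : Set (E 2) := {v | ∃ s : ℝ, 0 ≤ s ∧ ∃ x ∈ K, v = s • x}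

lemma Kcone_of_mem {K : Set (E 2)} {x : E 2} (hx : x ∈ K) : x ∈ Kcone K := ⟨1, by norm_num, x, hx, by simp⟩

lemma Kcone_smul {K : Set (E 2)} {v : E 2} (hv : v ∈ Kcone K) {t : ℝ} (ht : 0 ≤ t) : t • v ∈ Kcone K := by
  obtain ⟨s, hs, x, hx, rfl⟩ := hv
  exact ⟨t * s, by positivity, x, hx, by rw [smul_smul]⟩

lemma Kcone_unit {K : Set (E 2)} (hK : K ⊆ unitSphere 2) {v : E 2} (hv : v ∈ Kcone K) (h : v ∈ unitSphere 2) : v ∈ K := by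
  obtain ⟨s, hs, x, hx, rfl⟩ := hv
  have h1 := us_norm.1 h
  rw [norm_smul, us_norm.1 (hK hx), mul_one, Real.norm_of_nonneg hs] at h1
  rw [h1, one_smul]; exact hx

lemma Kcone_add {K : Set (E 2)} (hK : SConvex K) {u v : E 2} (hu : u ∈ Kcone K) (hv : v ∈ Kcone K) : u + v ∈ Kcone K := by
  obtain ⟨s, hs, x, hx, rfl⟩ := hu
  obtain ⟨t, ht, y, hy, rfl⟩ := hv
  by_cases h : s • x + t • y = 0
  · rw [h]; exact ⟨0, le_rfl, x, hx, by simp⟩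
  · have hn := us_normalize h
    have hp : 0 < ‖s • x + t • y‖ := norm_pos_iff.2 h
    refine ⟨‖s • x + t • y‖, hp.le, _, ?_, (by rw [smul_smul, mul_inv_cancel₀ hp.ne', one_smul] :
       s • x + t • y = ‖s • x + t • y‖ • (‖s • x + t • y‖⁻¹ • (s • x + t • y)))⟩
    set N := ‖s • x + t • y‖
    have e : N⁻¹ • (s • x + t • y) = (N⁻¹ * s) • x + (N⁻¹ * t) • y := by
      rw [smul_add, smul_smul, smul_smul]
    rw [e] at hn ⊢
    exact hK.2.2 x hx y hy (seg_comb (hK.1 hx) (hK.1 hy) (by positivity) (by positivity) hn)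

lemma Kcone_convex {K : Set (E 2)} (hK : SConvex K) : Convex ℝ (Kcone K) := by
  intro u hu v hv a b ha hb _
  exact Kcone_add hK (Kcone_smul hu ha) (Kcone_smul hv hb)

lemma hull_sub_Kcone {K : Set (E 2)} (hK : SConvex K) {v : E 2} (hv : v ∈ convexHull ℝ K) :
    ∃ s : ℝ, 0 < s ∧ ∃ x ∈ K, v = s • x := by
  have h1 : v ∈ Kcone K := convexHull_min (fun x hx => Kcone_of_mem hx) (Kcone_convex hK) hv
  obtain ⟨u, hu, hu2⟩ := hK.2.1
  have h2 : v ∈ {v : E 2 | 0 < ⟪u, v⟫} := by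
    refine convexHull_min hu2 ?_ hv
    intro a ha b hb s t hs ht hst
    have ha : 0 < ⟪u, a⟫ := ha
    have hb : 0 < ⟪u, b⟫ := hb
    show 0 < ⟪u, s • a + t • b⟫
    rw [inner_add_right, inner_smul_right, inner_smul_right]
    rcases hs.lt_or_eq with h | h
    · nlinarith [mul_pos h ha, mul_nonneg ht hb.le]
    · have : t = 1 := by linarith
      rw [← h, this]; linarith
  obtain ⟨s, hs, x, hx, rfl⟩ := h1
  refine ⟨s, ?_, x, hx, rfl⟩
  rcases hs.lt_or_eq with h | h
  · exact h
  · rw [← h] at h2; simp at h2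

lemma compact_hull {s : Set (E 2)} (hs : IsCompact s) : IsCompact (convexHull ℝ s) := by
  rcases s.eq_empty_or_nonempty with rfl | ⟨x1, hx1⟩
  · simp
  let Φ : (Fin 4 → ℝ) × (Fin 4 → E 2) → E 2 := fun p => ∑ i, p.1 i • p.2 i
  have hΦ : Continuous Φ := by fun_prop
  have hc : IsCompact ((stdSimplex ℝ (Fin 4)) ×ˢ (univ.pi fun _ : Fin 4 => s)) :=
    (isCompact_stdSimplex ℝ (Fin 4)).prod (isCompact_univ_pi fun _ => hs)
  convert hc.image hΦ using 1
  apply Subset.antisymm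
  · intro x hx
    obtain ⟨ι, hι, z, w, hz, haff, hw, hw1, hsum⟩ := eq_pos_convex_span_of_mem_convexHull hx
    have hcard : Fintype.card ι ≤ Fintype.card (Fin 4) := by
      have h1 := haff.card_le_finrank_succ
      have h2 := Submodule.finrank_le (vectorSpan ℝ (range z))
      simp at h2 ⊢; omega
    obtain ⟨e⟩ := Function.Embedding.nonempty_of_card_le hcard
    refine ⟨(Function.extend e w 0, Function.extend e z (fun _ => x1)), ⟨⟨?_, ?_⟩, ?_⟩, ?_⟩
    · intro j
      by_cases hj : ∃ i, e i = j
      · obtain ⟨i, rfl⟩ := hj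
        simp only [e.injective.extend_apply]; exact (hw i).le
      · simp only [Function.extend_apply' _ _ _ hj]; simp
    · rw [← hw1]; symm
      apply Fintype.sum_of_injective e e.injective
      · intro j hj
        simp only
        rw [Function.extend_apply' _ _ _ (by simpa using hj)]; rfl
      · intro i; simp only [e.injective.extend_apply]
    · intro j _
      by_cases hj : ∃ i, e i = j
      · obtain ⟨i, rfl⟩ := hj
        simp only [e.injective.extend_apply]; exact hz (mem_range_self i)
      · simp only [Function.extend_apply' _ _ _ hj]; exact hx1
    · rw [← hsum]; symm
      apply Fintype.sum_of_injective e e.injective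
      · intro j hj
        simp only
        rw [Function.extend_apply' _ _ _ (by simpa using hj)]; simp
      · intro i; simp only [e.injective.extend_apply]
  · rintro _ ⟨⟨w, z⟩, ⟨hw, hz⟩, rfl⟩
    exact (convex_convexHull ℝ s).sum_mem (fun i _ => hw.1 i) hw.2 (fun i _ => subset_convexHull ℝ s (hz i (mem_univ i)))

lemma sep {K D : Set (E 2)} (hK : IsCompact K) (hD : IsClosed D) (hDc : Convex ℝ D) (h0 : (0 : E 2) ∈ D)
    (hDs : ∀ d ∈ D, ∀ t : ℝ, 0 ≤ t → t • d ∈ D) (hdis : Disjoint (convexHull ℝ K) D) :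
    ∃ v : E 2, (∀ x ∈ K, ⟪x, v⟫ < 0) ∧ ∀ d ∈ D, 0 ≤ ⟪d, v⟫ := by
  obtain ⟨f, a, b, h1, h2, h3⟩ := geometric_hahn_banach_compact_closed (convex_convexHull ℝ K) (compact_hull hK) hDc hD hdis
  have hb : b < 0 := by simpa using h3 0 h0
  refine ⟨(InnerProductSpace.toDual ℝ (E 2)).symm f, fun x hx => ?_, fun d hd => ?_⟩
  · rw [real_inner_comm, InnerProductSpace.toDual_symm_apply]
    linarith [h1 x (subset_convexHull ℝ K hx)]
  · rw [real_inner_comm, InnerProductSpace.toDual_symm_apply]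
    by_contra hneg
    push Not at hneg
    have := h3 _ (hDs d hd (b / f d) (div_nonneg_of_nonpos hb.le hneg.le))
    rw [map_smul, smul_eq_mul, div_mul_cancel₀ _ hneg.ne] at this
    exact lt_irrefl _ this

lemma perturb {K : Set (E 2)} (hK : IsCompact K) (v z : E 2) (h : ∀ x ∈ K, ⟪x, v⟫ < 0) :
    ∃ δ : ℝ, 0 < δ ∧ ∀ x ∈ K, ⟪x, v + δ • z⟫ < 0 := by
  rcases K.eq_empty_or_nonempty with rfl | hne
  · exact ⟨1, by norm_num, by simp⟩
  obtain ⟨x1, hx1, hm⟩ := hK.exists_isMaxOn hne (f := fun x => ⟪x, v⟫) (by fun_prop)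
  obtain ⟨x2, hx2, hM⟩ := hK.exists_isMaxOn hne (f := fun x => ⟪x, z⟫) (by fun_prop)
  have hm' := h x1 hx1
  refine ⟨-⟪x1, v⟫ / (|⟪x2, z⟫| + 1), div_pos (by linarith) (by positivity), fun x hx => ?_⟩
  rw [inner_add_right, inner_smul_right]
  have e1 : ⟪x, v⟫ ≤ ⟪x1, v⟫ := hm hx
  have e2 : ⟪x, z⟫ ≤ ⟪x2, z⟫ := hM hx
  have e3 := le_abs_self ⟪x2, z⟫
  set A := |⟪x2, z⟫|
  have hA : 0 ≤ A := abs_nonneg _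
  have : -⟪x1, v⟫ / (A + 1) * ⟪x, z⟫ ≤ -⟪x1, v⟫ / (A + 1) * A :=
    mul_le_mul_of_nonneg_left (by linarith) (div_nonneg (by linarith) (by positivity))
  have : -⟪x1, v⟫ / (A + 1) * A < -⟪x1, v⟫ := by
    rw [div_mul_eq_mul_div, div_lt_iff₀ (by positivity)]; nlinarith
  linarith

lemma polar_normalize {K : Set (E 2)} {v : E 2} (hv : v ≠ 0) (h : ∀ a ∈ K, ⟪a, v⟫ ≤ 0) : ‖v‖⁻¹ • v ∈ polar K := by
  refine ⟨us_normalize hv, fun a ha => ?_⟩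
  rw [inner_smul_right]
  exact mul_nonpos_of_nonneg_of_nonpos (by positivity) (h a ha)

lemma bipolar {K : Set (E 2)} (hK : IsConvexBody K) {x : E 2} (hx : x ∈ unitSphere 2)
    (h : ∀ u ∈ polar K, ⟪x, u⟫ ≤ 0) : x ∈ K := by
  by_contra hxK
  have hxx := us_inner hx
  have hx0 : x ≠ 0 := by rintro rfl; simp at hxx
  have hD : ∃ v : E 2, (∀ x ∈ K, ⟪x, v⟫ < 0) ∧ ∀ d ∈ {v : E 2 | ∃ t : ℝ, 0 ≤ t ∧ v = t • x}, 0 ≤ ⟪d, v⟫ := by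
    apply sep hK.2.1
    · have : {v : E 2 | ∃ t : ℝ, 0 ≤ t ∧ v = t • x} = (fun t : ℝ => t • x) '' Ici 0 := by
        ext v; simp [eq_comm]
      rw [this]
      exact (isClosedEmbedding_smul_left hx0).isClosedMap _ isClosed_Ici
    · rintro _ ⟨s, hs, rfl⟩ _ ⟨t, ht, rfl⟩ a b ha hb _
      exact ⟨a * s + b * t, by positivity, by rw [smul_smul, smul_smul, add_smul]⟩
    · exact ⟨0, le_rfl, by simp⟩
    · rintro _ ⟨s, hs, rfl⟩ t ht
      exact ⟨t * s, by positivity, by rw [smul_smul]⟩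
    · rw [Set.disjoint_left]
      rintro v hv ⟨t, ht, rfl⟩
      obtain ⟨s, hs, y, hy, e⟩ := hull_sub_Kcone hK.1 hv
      have hn : ‖t • x‖ = ‖s • y‖ := by rw [e]
      rw [norm_smul, norm_smul, us_norm.1 hx, us_norm.1 (hK.1.1 hy), mul_one, mul_one, Real.norm_of_nonneg ht, Real.norm_of_nonneg hs.le] at hn
      rw [hn] at e
      have := smul_right_injective (E 2) hs.ne' e
      rw [this] at hxK; exact hxK hy
  obtain ⟨v, hv1, hv2⟩ := hD
  obtain ⟨δ, hδ, hv3⟩ := perturb hK.2.1 v x hv1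
  have h1 : 0 < ⟪x, v + δ • x⟫ := by
    rw [inner_add_right, inner_smul_right, hxx]
    linarith [hv2 x ⟨1, by norm_num, by simp⟩]
  have hne : v + δ • x ≠ 0 := by intro h; rw [h] at h1; simp at h1
  have := h _ (polar_normalize hne (fun a ha => (hv3 a ha).le))
  rw [inner_smul_right] at this
  have : 0 < ‖v + δ • x‖⁻¹ := by positivity
  nlinarith

lemma exists_int {K : Set (E 2)} (hK : IsConvexBody K) : ∃ x0 ∈ K, ∀ u ∈ polar K, ⟪x0, u⟫ < 0 := by
  obtain ⟨x0, hx0, ε, hε, h⟩ := hK.2.2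
  refine ⟨x0, hx0, fun u hu => lt_of_le_of_ne (hu.2 x0 hx0) fun h0 => ?_⟩
  set η := min (ε / 2) 1
  have hη : 0 < η := lt_min (by positivity) one_pos
  have hη1 : η ≤ 1 := min_le_right _ _
  have hη2 : η < ε := lt_of_le_of_lt (min_le_left _ _) (by linarith)
  have hxx := us_inner (hK.1.1 hx0)
  have huu := us_inner hu.1
  have hu0 : ⟪u, x0⟫ = 0 := by rw [real_inner_comm]; exact h0
  have hy : cos η • x0 + sin η • u ∈ K := by
    apply h
    · apply us_of_inner
      simp only [inner_add_left, inner_add_right, real_inner_smul_left, inner_smul_right, hxx, huu, h0, hu0]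
      nlinarith [sin_sq_add_cos_sq η]
    · unfold gdist
      rw [inner_add_right, inner_smul_right, inner_smul_right, hxx, h0, mul_one, mul_zero, add_zero, arccos_cos hη.le (by linarith [pi_gt_three])]
      exact hη2
  have := hu.2 _ hy
  rw [inner_add_left, real_inner_smul_left, real_inner_smul_left, h0, huu] at this
  have := sin_pos_of_pos_of_lt_pi hη (by linarith [pi_gt_three])
  linarith

lemma polar_compact (K : Set (E 2)) : IsCompact (polar K) := by
  have h : polar K = sphere (0 : E 2) 1 ∩ ⋂ a ∈ K, {u | ⟪a, u⟫ ≤ 0} := by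
    ext u; simp [polar, unitSphere]
  rw [h]
  apply (isCompact_sphere (0 : E 2) 1).inter_right
  exact isClosed_biInter fun a _ => isClosed_le (by fun_prop) (by fun_prop)

lemma polar_nonempty {K : Set (E 2)} (hK : SConvex K) : (polar K).Nonempty := by
  obtain ⟨u, hu, h⟩ := hK.2.1
  refine ⟨-u, by rw [us_norm, norm_neg]; exact us_norm.1 hu, fun a ha => ?_⟩
  rw [inner_neg_right, real_inner_comm]; linarith [h a ha]
end PartB

section PartC
open Filter Topology Metric Set

lemma breadth_eq {u v : E 2} (hu : u ∈ unitSphere 2) (hv : v ∈ unitSphere 2) (h1 : u ≠ v) (h2 : u ≠ -v) :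
    breadth u v = arccos (-⟪u, v⟫) := by
  have huu := us_inner hu
  have hvv := us_inner hv
  have hvu : ⟪v, u⟫ = ⟪u, v⟫ := real_inner_comm _ _
  have hc1 : ⟪u, v⟫ < 1 := lt_of_not_ge fun h => h1 (us_eq hu hv h)
  have hnv : -v ∈ unitSphere 2 := by rw [us_norm, norm_neg]; exact us_norm.1 hv
  have hc2 : -1 < ⟪u, v⟫ := lt_of_not_ge fun h => h2 (us_eq hu hnv (by rw [inner_neg_right]; linarith))
  unfold breadth gdist luneFaceCenter
  rw [hvu]
  set c := ⟪u, v⟫ with hc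
  have n1 : ‖(c • u - v : E 2)‖ ^ 2 = 1 - c ^ 2 := by
    rw [← real_inner_self_eq_norm_sq]
    simp only [inner_sub_left, inner_sub_right, real_inner_smul_left, inner_smul_right, huu, hvv, hvu, ← hc]
    ring
  have n2 : ‖(c • v - u : E 2)‖ ^ 2 = 1 - c ^ 2 := by
    rw [← real_inner_self_eq_norm_sq]
    simp only [inner_sub_left, inner_sub_right, real_inner_smul_left, inner_smul_right, huu, hvv, hvu, ← hc]
    ring
  have n3 : ‖(c • u - v : E 2)‖ = ‖(c • v - u : E 2)‖ := by
    rw [← sq_eq_sq₀ (norm_nonneg _) (norm_nonneg _), n1, n2]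
  have n4 : ⟪c • u - v, c • v - u⟫ = -c * (1 - c ^ 2) := by
    simp only [inner_sub_left, inner_sub_right, real_inner_smul_left, inner_smul_right, huu, hvv, hvu, ← hc]
    ring
  have hp : 0 < 1 - c ^ 2 := by nlinarith
  rw [real_inner_smul_left, inner_smul_right, n4, n3]
  congr 1
  set N := ‖(c • v - u : E 2)‖
  have : N ≠ 0 := by rintro h; rw [h] at n2; norm_num at n2; linarith
  rw [← n2]; field_simp

lemma width_contact {K : Set (E 2)} (hK : IsConvexBody K) {u v : E 2} (hu : u ∈ polar K) (hv : v ∈ polar K)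
    (hmin : ∀ u' ∈ polar K, ⟪u, v⟫ ≤ ⟪u', v⟫) (hc : ⟪u, v⟫ < 0) (hc1 : -1 < ⟪u, v⟫) :
    (K ∩ luneFace u v).Nonempty := by
  have huu := us_inner hu.1
  have hvv := us_inner hv.1
  have hvu : ⟪v, u⟫ = ⟪u, v⟫ := real_inner_comm _ _
  by_contra hne
  have hneg : ∀ x ∈ K, ⟪x, u⟫ < 0 := by
    intro x hx
    refine lt_of_le_of_ne (hu.2 x hx) fun h0 => hne ⟨x, hx, hK.1.1 hx, h0, hv.2 x hx⟩
  obtain ⟨δ, hδ, hd⟩ := perturb hK.2.1 u (-v) hneg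
  have e1 : u + δ • -v = u - δ • v := by rw [smul_neg, sub_eq_add_neg]
  rw [e1] at hd
  set c := ⟪u, v⟫ with hcdef
  have h1 : ⟪u - δ • v, v⟫ = c - δ := by
    rw [inner_sub_left, real_inner_smul_left, hvv]; ring
  have h2 : ‖u - δ • v‖ ^ 2 = 1 - 2 * δ * c + δ ^ 2 := by
    rw [← real_inner_self_eq_norm_sq]
    simp only [inner_sub_left, inner_sub_right, real_inner_smul_left, inner_smul_right, huu, hvv, hvu, ← hcdef]
    ring
  have hne0 : u - δ • v ≠ 0 := by intro h; rw [h] at h1; simp at h1; linarith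
  have hm := hmin _ (polar_normalize hne0 (fun a ha => (hd a ha).le))
  rw [real_inner_smul_left, h1] at hm
  have hN : 0 < ‖u - δ • v‖ := norm_pos_iff.2 hne0
  set N := ‖u - δ • v‖
  rw [inv_mul_eq_div, le_div_iff₀ hN] at hm
  have : 0 < (1 - c ^ 2) := by nlinarith
  have h3 : (δ - c) ^ 2 ≤ (-c * N) ^ 2 := by
    apply pow_le_pow_left₀ (by linarith); linarith
  rw [mul_pow, h2] at h3
  nlinarith [mul_pos hδ this, mul_pos (mul_pos hδ this) hδ, mul_pos (mul_pos hδ this) (neg_pos.2 hc)]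

lemma W1 {K : Set (E 2)} (hK : IsConvexBody K) {w : ℝ} (hw : width K = w) (hw0 : 0 < w) (hw1 : w ≤ π / 2)
    {u v : E 2} (hu : u ∈ polar K) (hv : v ∈ polar K) : -cos w ≤ ⟪u, v⟫ := by
  have hP := polar_compact K
  obtain ⟨⟨u1, v1⟩, ⟨hu1, hv1⟩, hmin⟩ := (hP.prod hP).exists_isMinOn ⟨(u, v), hu, hv⟩
    (f := fun p : E 2 × E 2 => ⟪p.1, p.2⟫) (by fun_prop)
  have hmin' : ∀ u' ∈ polar K, ∀ v' ∈ polar K, ⟪u1, v1⟫ ≤ ⟪u', v'⟫ := fun u' h1 v' h2 => hmin (a := (u', v')) ⟨h1, h2⟩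
  refine le_trans ?_ (hmin' u hu v hv)
  have hcw : 0 ≤ cos w := cos_nonneg_of_mem_Icc ⟨by linarith, hw1⟩
  by_contra hlt
  push Not at hlt
  have hc0 : ⟪u1, v1⟫ < 0 := by linarith
  simp only at hu1 hv1
  have huv : u1 ≠ -v1 := by
    intro h
    obtain ⟨x0, hx0, h0⟩ := exists_int hK
    have a1 := h0 u1 hu1
    have a2 := h0 v1 hv1
    rw [h, inner_neg_right] at a1; linarith
  have huv2 : u1 ≠ v1 := by rintro rfl; have := us_inner hu1.1; linarith
  have hnv : -v1 ∈ unitSphere 2 := by rw [us_norm, norm_neg]; exact us_norm.1 hv1.1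
  have hc2 : -1 < ⟪u1, v1⟫ := lt_of_not_ge fun h => huv (us_eq hu1.1 hnv (by rw [inner_neg_right]; linarith))
  have hvu : ⟪v1, u1⟫ = ⟪u1, v1⟫ := real_inner_comm _ _
  have c1 := width_contact hK hu1 hv1 (fun u' h => hmin' u' h v1 hv1) hc0 hc2
  have c2 := width_contact hK hv1 hu1 (fun u' h => by rw [hvu, real_inner_comm u1 u']; exact hmin' u1 hu1 u' h) (by rw [hvu]; exact hc0) (by rw [hvu]; exact hc2)
  have hsup : IsSupportingLune K u1 v1 :=
    ⟨hu1.1, hv1.1, huv2, huv, fun x hx => ⟨hK.1.1 hx, hu1.2 x hx, hv1.2 x hx⟩, c1, c2⟩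
  have hle : width K ≤ breadth u1 v1 := by
    apply csInf_le
    · exact ⟨0, by rintro b ⟨u, v, _, rfl⟩; exact arccos_nonneg _⟩
    · exact ⟨u1, v1, hsup, rfl⟩
  rw [hw, breadth_eq hu1.1 hv1.1 huv2 huv] at hle
  have := cos_le_cos_of_nonneg_of_le_pi hw0.le (arccos_le_pi _) hle
  rw [cos_arccos (by linarith) (by linarith)] at this
  linarith

lemma W2 {K : Set (E 2)} (hK : IsConvexBody K) {w : ℝ} (hw : width K = w) (hw0 : 0 < w) (hw1 : w ≤ π / 2)
    {u : E 2} (hu : u ∈ polar K) : ∃ y ∈ K, sin w ≤ -⟪y, u⟫ := by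
  by_contra hcon
  push Not at hcon
  have hsw : 0 < sin w := sin_pos_of_pos_of_lt_pi hw0 (by linarith [pi_pos])
  have hcw : 0 ≤ cos w := cos_nonneg_of_mem_Icc ⟨by linarith, hw1⟩
  have hcw1 : cos w < 1 := by nlinarith [sin_sq_add_cos_sq w]
  have huu := us_inner hu.1
  obtain ⟨v, hv1, hv2⟩ := sep (K := K) (D := {y : E 2 | sin w * ‖y‖ ≤ -⟪y, u⟫}) hK.2.1
    (isClosed_le (by fun_prop) (by fun_prop))
    (by
      intro a ha b hb s t hs ht _
      have ha : sin w * ‖a‖ ≤ -⟪a, u⟫ := ha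
      have hb : sin w * ‖b‖ ≤ -⟪b, u⟫ := hb
      show sin w * ‖s • a + t • b‖ ≤ -⟪s • a + t • b, u⟫
      rw [inner_add_left, real_inner_smul_left, real_inner_smul_left]
      have h1 := norm_add_le (s • a) (t • b)
      rw [norm_smul, norm_smul, Real.norm_of_nonneg hs, Real.norm_of_nonneg ht] at h1
      nlinarith [mul_le_mul_of_nonneg_left h1 hsw.le, mul_le_mul_of_nonneg_left ha hs, mul_le_mul_of_nonneg_left hb ht])
    (by simp)
    (by
      intro d hd t ht
      have hd : sin w * ‖d‖ ≤ -⟪d, u⟫ := hd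
      show sin w * ‖t • d‖ ≤ -⟪t • d, u⟫
      rw [real_inner_smul_left, norm_smul, Real.norm_of_nonneg ht]
      nlinarith [mul_le_mul_of_nonneg_left hd ht])
    (by
      rw [Set.disjoint_left]
      intro z hz hzD
      have hzD : sin w * ‖z‖ ≤ -⟪z, u⟫ := hzD
      obtain ⟨s, hs, y, hy, rfl⟩ := hull_sub_Kcone hK.1 hz
      rw [real_inner_smul_left, norm_smul, Real.norm_of_nonneg hs.le, us_norm.1 (hK.1.1 hy)] at hzD
      nlinarith [mul_pos hs (sub_pos.2 (hcon y hy))])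
  have hv2' : ∀ d : E 2, sin w * ‖d‖ ≤ -⟪d, u⟫ → 0 ≤ ⟪d, v⟫ := hv2
  set a := ⟪u, v⟫ with ha
  have hvu : ⟪v, u⟫ = a := real_inner_comm _ _
  have ha0 : a ≤ 0 := by
    have := hv2' (-u) (by rw [norm_neg, us_norm.1 hu.1, inner_neg_left, huu]; linarith [sin_le_one w])
    rw [inner_neg_left] at this; linarith
  set v' := v - a • u with hv'
  have hv'u : ⟪v', u⟫ = 0 := by rw [hv', inner_sub_left, real_inner_smul_left, huu, hvu]; ring
  have huv' : ⟪u, v'⟫ = 0 := by rw [real_inner_comm]; exact hv'u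
  set b := ‖v'‖ with hb
  have hb0 : 0 ≤ b := norm_nonneg _
  have hv'v' : ⟪v', v'⟫ = b ^ 2 := real_inner_self_eq_norm_sq _
  have hveq : v = a • u + v' := by rw [hv']; abel
  have hvn : ‖v‖ ^ 2 = a ^ 2 + b ^ 2 := by
    rw [← real_inner_self_eq_norm_sq, hveq]
    simp only [inner_add_left, inner_add_right, real_inner_smul_left, inner_smul_right, huu, hv'u, huv', hv'v']
    ring
  have hv'v : ⟪v', v⟫ = b ^ 2 := by
    rw [hveq, inner_add_right, inner_smul_right, hv'u, hv'v']; ring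
  have hkey : cos w ^ 2 * b ^ 2 ≤ sin w ^ 2 * a ^ 2 := by
    have hd := hv2' ((-(sin w * b)) • u - cos w • v') (by
      have hn : ‖(-(sin w * b)) • u - cos w • v'‖ ^ 2 = b ^ 2 := by
        rw [← real_inner_self_eq_norm_sq]
        simp only [inner_sub_left, inner_sub_right, real_inner_smul_left, inner_smul_right, huu, hv'u, huv', hv'v']
        nlinarith [sin_sq_add_cos_sq w]
      have hn2 : ‖(-(sin w * b)) • u - cos w • v'‖ = b := by
        rwa [sq_eq_sq₀ (norm_nonneg _) hb0] at hn
      rw [hn2, inner_sub_left, real_inner_smul_left, real_inner_smul_left, huu, hv'u]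
      linarith)
    rw [inner_sub_left, real_inner_smul_left, real_inner_smul_left, hv'v, ← ha] at hd
    rcases hb0.eq_or_lt with h | h
    · rw [← h]; have : 0 ≤ sin w ^ 2 * a ^ 2 := by positivity
      linarith
    · have h2 : cos w * b ≤ sin w * (-a) := by
        have : 0 ≤ b * (sin w * (-a) - cos w * b) := by nlinarith
        have := nonneg_of_mul_nonneg_right this h
        linarith
      have := pow_le_pow_left₀ (by positivity) h2 2
      nlinarith
  have hle : a ≤ -cos w * ‖v‖ := by
    have h1 : (cos w * ‖v‖) ^ 2 ≤ (-a) ^ 2 := by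
      rw [mul_pow, hvn]; nlinarith [sin_sq_add_cos_sq w]
    have := sq_le_sq.1 h1
    rw [abs_of_nonneg (by positivity), abs_of_nonneg (by linarith)] at this
    linarith
  obtain ⟨δ, hδ, hd⟩ := perturb hK.2.1 v (-u) hv1
  have e1 : v + δ • -u = v - δ • u := by rw [smul_neg, sub_eq_add_neg]
  rw [e1] at hd
  have hne0 : v - δ • u ≠ 0 := by
    obtain ⟨x0, hx0, _⟩ := exists_int hK
    intro h; have := hd x0 hx0; rw [h] at this; simp at this
  have := W1 hK hw hw0 hw1 hu (polar_normalize hne0 (fun a ha => (hd a ha).le))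
  have hN : 0 < ‖v - δ • u‖ := norm_pos_iff.2 hne0
  rw [inner_smul_right, inner_sub_right, inner_smul_right, huu, ← ha, inv_mul_eq_div, le_div_iff₀ hN] at this
  have h3 : ‖v - δ • u‖ ≤ ‖v‖ + δ := by
    have := norm_sub_le v (δ • u)
    rwa [norm_smul, us_norm.1 hu.1, mul_one, Real.norm_of_nonneg hδ.le] at this
  nlinarith [mul_le_mul_of_nonneg_left h3 hcw, mul_pos hδ (sub_pos.2 hcw1)]
end PartC

section PartD
open Filter Topology Metric Set

lemma incircle {K : Set (E 2)} (hK : IsConvexBody K) :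
    ∃ (p : E 2) (r : ℝ), p ∈ unitSphere 2 ∧ 0 < r ∧ r ≤ π / 2 ∧ (∀ u ∈ polar K, ⟪p, u⟫ ≤ -sin r) ∧
      ∃ (n : ℕ) (u : Fin n → E 2) (l : Fin n → ℝ), (∀ i, u i ∈ polar K) ∧ LinearIndependent ℝ u ∧
        (∀ i, 0 < l i) ∧ (∑ i, l i) * sin r = 1 ∧ ∑ i, l i • u i = -p ∧ ∀ i, ⟪p, u i⟫ = -sin r := by
  have hPc := compact_hull (polar_compact K)
  obtain ⟨u0, hu0⟩ := polar_nonempty hK.1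
  have hne : (convexHull ℝ (polar K)).Nonempty := ⟨u0, subset_convexHull ℝ _ hu0⟩
  have hcv := convex_convexHull ℝ (polar K)
  obtain ⟨q, hq, hqn⟩ := exists_norm_eq_iInf_of_complete_convex hne hPc.isComplete hcv 0
  have hq2 := (norm_eq_iInf_iff_real_inner_le_zero hcv hq).1 hqn
  have hqw : ∀ v ∈ convexHull ℝ (polar K), ‖q‖ ^ 2 ≤ ⟪q, v⟫ := by
    intro v hv
    have := hq2 v hv
    rw [zero_sub, inner_neg_left, inner_sub_right, real_inner_self_eq_norm_sq] at this
    linarith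
  obtain ⟨x0, hx0, hx0'⟩ := exists_int hK
  have hq0 : q ≠ 0 := by
    have : q ∈ {v : E 2 | ⟪x0, v⟫ < 0} := by
      refine convexHull_min hx0' ?_ hq
      intro a ha b hb s t hs ht hst
      have ha : ⟪x0, a⟫ < 0 := ha
      have hb : ⟪x0, b⟫ < 0 := hb
      show ⟪x0, s • a + t • b⟫ < 0
      rw [inner_add_right, inner_smul_right, inner_smul_right]
      rcases hs.lt_or_eq with h | h
      · nlinarith [mul_pos h (neg_pos.2 ha), mul_nonneg ht (neg_pos.2 hb).le]
      · have : t = 1 := by linarith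
        rw [← h, this]; linarith
    have h1 : ⟪x0, q⟫ < 0 := this
    rintro rfl; simp at h1
  have hQ : 0 < ‖q‖ := norm_pos_iff.2 hq0
  have hQ1 : ‖q‖ ≤ 1 := by
    have h1 := hqw u0 (subset_convexHull ℝ _ hu0)
    have h2 := real_inner_le_norm q u0
    rw [us_norm.1 hu0.1, mul_one] at h2
    nlinarith
  obtain ⟨ι, hι, z, w, hz, haff, hw, hw1, hsum⟩ := eq_pos_convex_span_of_mem_convexHull hq
  have hzP : ∀ i, z i ∈ polar K := fun i => hz (mem_range_self i)
  have hzi : ∀ i, ⟪q, z i⟫ = ‖q‖ ^ 2 := by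
    have h1 : ∑ i, w i * (⟪q, z i⟫ - ‖q‖ ^ 2) = 0 := by
      have : ⟪q, q⟫ = ∑ i, w i * ⟪q, z i⟫ := by
        nth_rewrite 2 [← hsum]
        rw [inner_sum]; simp only [inner_smul_right]
      rw [real_inner_self_eq_norm_sq] at this
      simp only [mul_sub, Finset.sum_sub_distrib, ← Finset.sum_mul]
      rw [hw1, ← this]; ring
    have h2 : ∀ i ∈ Finset.univ, 0 ≤ w i * (⟪q, z i⟫ - ‖q‖ ^ 2) := fun i _ =>
      mul_nonneg (hw i).le (sub_nonneg.2 (hqw _ (subset_convexHull ℝ _ (hzP i))))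
    intro i
    have := (Finset.sum_eq_zero_iff_of_nonneg h2).1 h1 i (Finset.mem_univ i)
    rcases mul_eq_zero.1 this with h | h
    · exact absurd h (hw i).ne'
    · linarith
  have hlin : LinearIndependent ℝ z := by
    rw [linearIndependent_iff']
    intro s g hg
    have h1 : ⟪q, ∑ i ∈ s, g i • z i⟫ = 0 := by rw [hg]; simp
    rw [inner_sum] at h1
    simp only [inner_smul_right, hzi, ← Finset.sum_mul] at h1
    have h2 : ∑ i ∈ s, g i = 0 := by
      rcases mul_eq_zero.1 h1 with h | h
      · exact h
      · exact absurd h (by positivity)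
    exact affineIndependent_iff.1 haff s g h2 hg
  set e := Fintype.equivFin ι
  have hsin : sin (arcsin ‖q‖) = ‖q‖ := sin_arcsin (by linarith) hQ1
  refine ⟨-(‖q‖⁻¹ • q), arcsin ‖q‖, ?_, arcsin_pos.2 hQ, arcsin_le_pi_div_two _, ?_, Fintype.card ι, z ∘ e.symm,
    fun i => ‖q‖⁻¹ * w (e.symm i), fun i => hzP _, hlin.comp _ e.symm.injective, fun i => ?_, ?_, ?_, fun i => ?_⟩
  · rw [us_norm, norm_neg]; exact us_norm.1 (us_normalize hq0)
  · intro u hu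
    rw [hsin, inner_neg_left, real_inner_smul_left]
    have := hqw u (subset_convexHull ℝ _ hu)
    have : ‖q‖ ≤ ‖q‖⁻¹ * ⟪q, u⟫ := by
      rw [inv_mul_eq_div, le_div_iff₀ hQ]; nlinarith
    linarith
  · have := hw (e.symm i); positivity
  · rw [e.symm.sum_comp (fun i => ‖q‖⁻¹ * w i), ← Finset.mul_sum, hw1, hsin]; field_simp
  · rw [neg_neg]
    simp only [Function.comp, mul_smul]
    rw [e.symm.sum_comp (fun i => ‖q‖⁻¹ • w i • z i), ← Finset.smul_sum, hsum]
  · simp only [Function.comp]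
    rw [hsin, inner_neg_left, real_inner_smul_left, hzi]
    field_simp

lemma inner_le_cs {p x u : E 2} (hp : p ∈ unitSphere 2) (hx : x ∈ unitSphere 2) (hu : u ∈ unitSphere 2) :
    ⟪x, u⟫ ≤ ⟪p, x⟫ * ⟪p, u⟫ + √(1 - ⟪p, x⟫ ^ 2) * √(1 - ⟪p, u⟫ ^ 2) := by
  have hpp := us_inner hp
  have hxx := us_inner hx
  have huu := us_inner hu
  have hxp : ⟪x, p⟫ = ⟪p, x⟫ := real_inner_comm _ _
  have hup : ⟪u, p⟫ = ⟪p, u⟫ := real_inner_comm _ _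
  have key := real_inner_le_norm (x - ⟪p, x⟫ • p) (u - ⟪p, u⟫ • p)
  have n1 : ‖x - ⟪p, x⟫ • p‖ = √(1 - ⟪p, x⟫ ^ 2) := by
    rw [← Real.sqrt_sq (norm_nonneg (x - _)), ← real_inner_self_eq_norm_sq]
    congr 1
    simp only [inner_sub_left, inner_sub_right, real_inner_smul_left, inner_smul_right, hpp, hxx, hxp]; ring
  have n2 : ‖u - ⟪p, u⟫ • p‖ = √(1 - ⟪p, u⟫ ^ 2) := by
    rw [← Real.sqrt_sq (norm_nonneg (u - _)), ← real_inner_self_eq_norm_sq]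
    congr 1
    simp only [inner_sub_left, inner_sub_right, real_inner_smul_left, inner_smul_right, hpp, huu, hup]; ring
  rw [n1, n2] at key
  simp only [inner_sub_left, inner_sub_right, real_inner_smul_left, inner_smul_right, hpp, hxp] at key
  linarith

lemma ball_sub {K : Set (E 2)} (hK : IsConvexBody K) {p : E 2} {r : ℝ} (hp : p ∈ unitSphere 2)
    (hr0 : 0 < r) (hr1 : r ≤ π / 2) (h : ∀ u ∈ polar K, ⟪p, u⟫ ≤ -sin r) {x : E 2} (hx : x ∈ unitSphere 2)
    (hxr : cos r ≤ ⟪p, x⟫) : x ∈ K := by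
  apply bipolar hK hx
  intro u hu
  have hc : 0 ≤ cos r := cos_nonneg_of_mem_Icc ⟨by linarith, hr1⟩
  have hs : 0 ≤ sin r := sin_nonneg_of_nonneg_of_le_pi hr0.le (by linarith [pi_pos])
  have h1 := inner_le_cs hp hx hu.1
  have h2 := h u hu
  have s1 : √(1 - ⟪p, x⟫ ^ 2) ≤ sin r := by
    rw [Real.sqrt_le_left hs]; nlinarith [sin_sq_add_cos_sq r]
  have s2 : √(1 - ⟪p, u⟫ ^ 2) ≤ cos r := by
    rw [Real.sqrt_le_left hc]; nlinarith [sin_sq_add_cos_sq r]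
  have := mul_le_mul s1 s2 (Real.sqrt_nonneg _) hs
  nlinarith [mul_nonneg (sub_nonneg.2 hxr) (show 0 ≤ -⟪p, u⟫ by linarith), mul_nonneg hc (show 0 ≤ -sin r - ⟪p, u⟫ by linarith)]

/-- distance bound -/
lemma far_point {p y u : E 2} {r w : ℝ} (hp : p ∈ unitSphere 2) (hy : y ∈ unitSphere 2) (hu : u ∈ unitSphere 2)
    (hr0 : 0 < r) (hw1 : w ≤ π / 2) (hrw : r < w) (hpu : ⟪p, u⟫ = -sin r) (hyu : sin w ≤ -⟪y, u⟫) :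
    ⟪p, y⟫ ≤ cos (w - r) := by
  by_contra hlt
  push Not at hlt
  have hnu : -u ∈ unitSphere 2 := by rw [us_norm, norm_neg]; exact us_norm.1 hu
  have h1 := inner_le_cs hp hy hnu
  rw [inner_neg_right, inner_neg_right, hpu, neg_neg] at h1
  have hc : 0 ≤ cos r := cos_nonneg_of_mem_Icc ⟨by linarith, by linarith⟩
  have e1 : √(1 - sin r ^ 2) = cos r := by
    rw [show 1 - sin r ^ 2 = cos r ^ 2 by linarith [sin_sq_add_cos_sq r], Real.sqrt_sq hc]
  rw [e1, ← sin_arccos] at h1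
  have e2 : cos (arccos ⟪p, y⟫) = ⟪p, y⟫ := cos_arccos (us_le_inner hp hy) (us_inner_le hp hy)
  set ρ := arccos ⟪p, y⟫
  have hρ0 : 0 ≤ ρ := arccos_nonneg _
  have hρ : ρ < w - r := by
    by_contra h
    have := cos_le_cos_of_nonneg_of_le_pi (show 0 ≤ w - r by linarith) (arccos_le_pi _) (not_lt.1 h)
    rw [← e2] at hlt
    linarith
  have h2 : sin (ρ + r) < sin w := sin_lt_sin_of_lt_of_le_pi_div_two (by linarith [pi_pos]) hw1 (by linarith)
  rw [sin_add, e2] at h2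
  nlinarith

/-- Three contact points of the incircle when it is small. -/
lemma three_contacts {K : Set (E 2)} (hK : IsConvexBody K) {w : ℝ} (hw : width K = w) (hw0 : 0 < w) (hw1 : w ≤ π / 2)
    {p : E 2} {r : ℝ} (hp : p ∈ unitSphere 2) (hr0 : 0 < r) (hr : r < w / 2)
    {n : ℕ} {u : Fin n → E 2} {l : Fin n → ℝ} (hu : ∀ i, u i ∈ polar K) (hlin : LinearIndependent ℝ u)
    (hl : ∀ i, 0 < l i) (hl1 : (∑ i, l i) * sin r = 1) (hlp : ∑ i, l i • u i = -p)
    (hpu : ∀ i, ⟪p, u i⟫ = -sin r) : n = 3 := by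
  have hn : n ≤ 3 := by
    have := hlin.fintype_card_le_finrank
    simpa using this
  have hpp := us_inner hp
  have hsr : sin r < sin (w / 2) := sin_lt_sin_of_lt_of_le_pi_div_two (by linarith [pi_pos]) (by linarith) hr
  have hsr0 : 0 < sin r := sin_pos_of_pos_of_lt_pi hr0 (by linarith)
  interval_cases n
  · simp at hl1
  · exfalso
    simp at hl1 hlp
    have h1 : ⟪l 0 • u 0, l 0 • u 0⟫ = 1 := by rw [hlp, inner_neg_left, inner_neg_right, hpp]; norm_num
    rw [real_inner_smul_left, inner_smul_right, us_inner (hu 0).1] at h1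
    have : l 0 = 1 := by nlinarith [hl 0]
    rw [this] at hl1
    linarith [sin_le_one (w / 2)]
  · exfalso
    rw [Fin.sum_univ_two] at hl1 hlp
    have h0 : ⟪u 0, l 0 • u 0 + l 1 • u 1⟫ = sin r := by
      rw [hlp, inner_neg_right, real_inner_comm, hpu]; ring
    have h1 : ⟪u 1, l 0 • u 0 + l 1 • u 1⟫ = sin r := by
      rw [hlp, inner_neg_right, real_inner_comm, hpu]; ring
    rw [inner_add_right, inner_smul_right, inner_smul_right, us_inner (hu 0).1] at h0
    rw [inner_add_right, inner_smul_right, inner_smul_right, us_inner (hu 1).1, real_inner_comm] at h1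
    have h2 := W1 hK hw hw0 hw1 (hu 0) (hu 1)
    have h3 : cos w = 1 - 2 * sin (w / 2) ^ 2 := by
      have := cos_two_mul (w / 2)
      rw [show 2 * (w / 2) = w by ring] at this
      nlinarith [sin_sq_add_cos_sq (w / 2)]
    have h4 : 2 * sin r ^ 2 = 1 + ⟪u 0, u 1⟫ := by
      have e1 : 2 * sin r = (l 0 + l 1) * (1 + ⟪u 0, u 1⟫) := by linarith
      calc 2 * sin r ^ 2 = (2 * sin r) * sin r := by ring
        _ = ((l 0 + l 1) * sin r) * (1 + ⟪u 0, u 1⟫) := by rw [e1]; ring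
        _ = _ := by rw [hl1, one_mul]
    nlinarith
  · rfl
end PartD

section PartF1
open Filter Topology Metric Set

lemma frame3 {a b c : E 2} (ha : ⟪a, a⟫ = 1) (hb : ⟪b, b⟫ = 1) (hc : ⟪c, c⟫ = 1) (hab : ⟪a, b⟫ = 0)
    (hac : ⟪a, c⟫ = 0) (hbc : ⟪b, c⟫ = 0) :
    ∃ B : OrthonormalBasis (Fin 3) ℝ (E 2), B 0 = a ∧ B 1 = b ∧ B 2 = c := by
  have hon : Orthonormal ℝ ![a, b, c] := by
    rw [orthonormal_iff_ite]
    intro i j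
    have hba : ⟪b, a⟫ = 0 := by rw [real_inner_comm]; exact hab
    have hca : ⟪c, a⟫ = 0 := by rw [real_inner_comm]; exact hac
    have hcb : ⟪c, b⟫ = 0 := by rw [real_inner_comm]; exact hbc
    fin_cases i <;> fin_cases j <;> simp [ha, hb, hc, hab, hac, hbc, hba, hca, hcb, -inner_self_eq_norm_sq_to_K]
  have hcard : Fintype.card (Fin 3) = Module.finrank ℝ (E 2) := by simp
  let B0 := basisOfOrthonormalOfCardEqFinrank hon hcard
  have hB0 : ⇑B0 = ![a, b, c] := coe_basisOfOrthonormalOfCardEqFinrank hon hcard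
  refine ⟨B0.toOrthonormalBasis (by rw [hB0]; exact hon), ?_, ?_, ?_⟩ <;> simp [hB0]

lemma frame2 {a b : E 2} (ha : ⟪a, a⟫ = 1) (hb : ⟪b, b⟫ = 1) (hab : ⟪a, b⟫ = 0) :
    ∃ c : E 2, ⟪c, c⟫ = 1 ∧ ⟪a, c⟫ = 0 ∧ ⟪b, c⟫ = 0 := by
  have hba : ⟪b, a⟫ = 0 := by rw [real_inner_comm]; exact hab
  have hcard : Module.finrank ℝ (E 2) = Fintype.card (Fin 3) := by simp
  have hon : Orthonormal ℝ (Set.restrict ({0, 1} : Set (Fin 3)) ![a, b, 0]) := by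
    rw [orthonormal_iff_ite]
    rintro ⟨i, hi⟩ ⟨j, hj⟩
    simp only [mem_insert_iff, mem_singleton_iff] at hi hj
    rcases hi with rfl | rfl <;> rcases hj with rfl | rfl <;>
      first | exact ha.trans (by simp) | exact hab.trans (by simp) | exact hba.trans (by simp) | exact hb.trans (by simp)
  obtain ⟨B, hB⟩ := hon.exists_orthonormalBasis_extension_of_card_eq hcard
  have h0 : B 0 = a := by simpa using hB 0 (by simp)
  have h1 : B 1 = b := by simpa using hB 1 (by simp)
  refine ⟨B 2, ?_, ?_, ?_⟩
  · have := orthonormal_iff_ite.1 B.orthonormal 2 2; simpa using this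
  · have := orthonormal_iff_ite.1 B.orthonormal 0 2; rw [h0] at this; simpa using this
  · have := orthonormal_iff_ite.1 B.orthonormal 1 2; rw [h1] at this; simpa using this

lemma exists_perp (a : E 2) (ha : ⟪a, a⟫ = 1) : ∃ b : E 2, ⟪b, b⟫ = 1 ∧ ⟪a, b⟫ = 0 := by
  have hcard : Module.finrank ℝ (E 2) = Fintype.card (Fin 3) := by simp
  have hon : Orthonormal ℝ (Set.restrict ({0} : Set (Fin 3)) ![a, 0, 0]) := by
    rw [orthonormal_iff_ite]
    rintro ⟨i, hi⟩ ⟨j, hj⟩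
    simp only [mem_singleton_iff] at hi hj
    subst hi; subst hj
    exact ha.trans (by simp)
  obtain ⟨B, hB⟩ := hon.exists_orthonormalBasis_extension_of_card_eq hcard
  have h0 : B 0 = a := by simpa using hB 0 (by simp)
  refine ⟨B 2, ?_, ?_⟩
  · have := orthonormal_iff_ite.1 B.orthonormal 2 2; simpa using this
  · have := orthonormal_iff_ite.1 B.orthonormal 0 2; rw [h0] at this; simpa using this

lemma frame_expand (B : OrthonormalBasis (Fin 3) ℝ (E 2)) (x : E 2) :
    x = ⟪B 0, x⟫ • B 0 + ⟪B 1, x⟫ • B 1 + ⟪B 2, x⟫ • B 2 := by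
  conv_lhs => rw [← B.sum_repr' x, Fin.sum_univ_three]

lemma gset_disc {B : OrthonormalBasis (Fin 3) ℝ (E 2)} {r : ℝ} (hr0 : 0 < r) (hr1 : r < π / 2) {x : E 2} :
    x ∈ gset B (QD (tan r)) ↔ x ∈ unitSphere 2 ∧ cos r ≤ ⟪B 0, x⟫ := by
  have hc : 0 < cos r := cos_pos_of_mem_Ioo ⟨by linarith, hr1⟩
  have key : ∀ z : ℝ, 0 < z → x ∈ unitSphere 2 → z = ⟪B 0, x⟫ → ((⟪B 1, x⟫ / z) ^ 2 + (⟪B 2, x⟫ / z) ^ 2 ≤ tan r ^ 2 ↔ cos r ≤ z) := by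
    intro z hz hx hzz
    have hn := norm_sq_coord B x
    rw [us_norm.1 hx, ← hzz] at hn
    rw [tan_eq_sin_div_cos, div_pow, div_pow, div_pow, ← add_div, div_le_div_iff₀ (by positivity) (by positivity)]
    have h1 := sin_sq_add_cos_sq r
    have e : (⟪B 1, x⟫ ^ 2 + ⟪B 2, x⟫ ^ 2) = 1 - z ^ 2 := by linarith
    rw [e, show sin r ^ 2 = 1 - cos r ^ 2 by linarith]
    constructor <;> intro h <;> nlinarith
  constructor
  · rintro ⟨h1, h2, h3⟩
    exact ⟨h1, (key _ h2 h1 rfl).1 h3⟩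
  · rintro ⟨h1, h2⟩
    exact ⟨h1, by linarith, (key _ (by linarith) h1 rfl).2 h2⟩

set_option maxHeartbeats 1600000 in
/-- The half-cap lemma: everything we need about one half-cap. -/
lemma half_cap {K : Set (E 2)} (hK : SConvex K) {p f g : E 2} {r R : ℝ} (hr0 : 0 < r) (hrR : r < R) (hR : R < π / 2)
    (hp : ⟪p, p⟫ = 1) (hf : ⟪f, f⟫ = 1) (hg : ⟪g, g⟫ = 1) (hpf : ⟪p, f⟫ = 0) (hpg : ⟪p, g⟫ = 0) (hfg : ⟪f, g⟫ = 0)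
    (hball : ∀ x ∈ unitSphere 2, cos r ≤ ⟪p, x⟫ → x ∈ K) (hY : cos R • p + sin R • f ∈ K)
    {φ : ℝ} (hφ0 : 0 < φ) (hφ1 : φ < π / 2) (hφ : cos φ * tan R = tan r) :
    ∃ B : OrthonormalBasis (Fin 3) ℝ (E 2), gset B (QH (tan r) φ) ⊆ K ∧ 
      ∀ x ∈ gset B (QH (tan r) φ), ⟪p, x⟫ < cos r ∧ ⟪g, x⟫ < 0 ∧ 
        cos φ * ‖x - ⟪p, x⟫ • p‖ < ⟪f, x⟫ := by
  have hgf : ⟪g, f⟫ = 0 := by rw [real_inner_comm]; exact hfg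
  have hcs := sin_sq_add_cos_sq φ
  have hcφ : 0 < cos φ := cos_pos_of_mem_Ioo ⟨by linarith, hφ1⟩
  have hsφ : 0 < sin φ := sin_pos_of_pos_of_lt_pi hφ0 (by linarith)
  have hcr : 0 < cos r := cos_pos_of_mem_Ioo ⟨by linarith, by linarith⟩
  have hsr : 0 < sin r := sin_pos_of_pos_of_lt_pi hr0 (by linarith)
  have hcR : 0 < cos R := cos_pos_of_mem_Ioo ⟨by linarith, by linarith⟩
  have htR : 0 < tan R := tan_pos_of_pos_of_lt_pi_div_two (by linarith) hR
  have htr : 0 < tan r := tan_pos_of_pos_of_lt_pi_div_two hr0 (by linarith)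
  obtain ⟨B, hB0, hB1, hB2⟩ := frame3 (a := p) (b := cos φ • f - sin φ • g) (c := sin φ • f + cos φ • g) hp
    (by simp only [inner_sub_left, inner_sub_right, real_inner_smul_left, inner_smul_right, hf, hg, hfg, hgf]; nlinarith)
    (by simp only [inner_add_left, inner_add_right, real_inner_smul_left, inner_smul_right, hf, hg, hfg, hgf]; nlinarith)
    (by simp only [inner_sub_right, inner_smul_right, hpf, hpg]; ring)
    (by simp only [inner_add_right, inner_smul_right, hpf, hpg]; ring)
    (by simp only [inner_sub_left, inner_add_right, real_inner_smul_left, inner_smul_right, hf, hg, hfg, hgf]; ring)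
  have hfeq : f = cos φ • B 1 + sin φ • B 2 := by
    rw [hB1, hB2, smul_sub, smul_add, smul_smul, smul_smul, smul_smul, smul_smul]
    have : f = (cos φ * cos φ + sin φ * sin φ) • f := by
      rw [show cos φ * cos φ + sin φ * sin φ = 1 by nlinarith, one_smul]
    conv_lhs => rw [this]
    module
  have hgeq : g = (-sin φ) • B 1 + cos φ • B 2 := by
    rw [hB1, hB2, smul_sub, smul_add, smul_smul, smul_smul, smul_smul, smul_smul]
    have : g = (cos φ * cos φ + sin φ * sin φ) • g := by
      rw [show cos φ * cos φ + sin φ * sin φ = 1 by nlinarith, one_smul]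
    conv_lhs => rw [this]
    module
  have hcoord : ∀ x ∈ gset B (QH (tan r) φ), ∃ z a b : ℝ, 0 < z ∧ z = ⟪p, x⟫ ∧ 0 < b ∧ 0 < a ∧ a ≤ tan r ∧ b * cos φ < a * sin φ ∧
      tan r ^ 2 < a ^ 2 + b ^ 2 ∧ x = z • (p + a • B 1 + b • B 2) ∧ z ^ 2 * (1 + a ^ 2 + b ^ 2) = 1 ∧ ⟪B 1, x⟫ = z * a ∧ ⟪B 2, x⟫ = z * b := by
    rintro x ⟨hx, hz, h1, h2, h3, h4⟩
    simp only at h1 h2 h3 h4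
    have hx1 := norm_sq_coord B x
    rw [us_norm.1 hx] at hx1
    have hexp := frame_expand B x
    rw [hB0] at hz h1 h2 h3 h4 hx1 hexp
    set z := ⟪p, x⟫
    refine ⟨z, _, _, hz, rfl, h1, ?_, h2, h3, h4, ?_, ?_, ?_, ?_⟩
    · by_contra hneg
      have := mul_nonpos_of_nonpos_of_nonneg (not_lt.1 hneg) hsφ.le
      have := mul_pos h1 hcφ
      linarith
    · conv_lhs => rw [hexp]
      rw [smul_add, smul_add, smul_smul, smul_smul, mul_div_cancel₀ _ hz.ne', mul_div_cancel₀ _ hz.ne']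
    · field_simp; linarith
    · rw [mul_div_cancel₀ _ hz.ne']
    · rw [mul_div_cancel₀ _ hz.ne']
  refine ⟨B, ?_, ?_⟩
  · intro x hx
    obtain ⟨z, a, b, hz, -, hb, ha, hat, hab, -, hxe, -, -, -⟩ := hcoord x hx
    apply Kcone_unit hK.1 _ hx.1
    rw [hxe]
    apply Kcone_smul _ hz.le
    have hp1 : p ∈ Kcone K := by
      apply Kcone_of_mem
      apply hball p (us_of_inner hp); rw [hp]; exact cos_le_one r
    have hb1 : ⟪B 1, B 1⟫ = 1 := by have := orthonormal_iff_ite.1 B.orthonormal 1 1; simpa using this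
    have hb01 : ⟪p, B 1⟫ = 0 := by have := orthonormal_iff_ite.1 B.orthonormal 0 1; rw [hB0] at this; simpa using this
    have hb10 : ⟪B 1, p⟫ = 0 := by rw [real_inner_comm]; exact hb01
    have hp2 : cos r • p + sin r • B 1 ∈ Kcone K := by
      apply Kcone_of_mem
      apply hball
      · apply us_of_inner
        simp only [inner_add_left, inner_add_right, real_inner_smul_left, inner_smul_right, hp, hb1, hb01, hb10]
        nlinarith [sin_sq_add_cos_sq r]
      · simp only [inner_add_right, inner_smul_right, hp, hb01]; linarith
    have hp3 := Kcone_of_mem hY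
    set β := b / (tan R * sin φ) with hβ
    have hβ0 : 0 < β := by positivity
    have hβb : β * tan R * sin φ = b := by rw [hβ]; field_simp
    set α := a / tan r - β with hα
    have hα0 : 0 ≤ α := by
      rw [hα, hβ, sub_nonneg, ← hφ, div_le_div_iff₀ (by positivity) (by positivity)]
      nlinarith
    have hαa : (α + β) * tan r = a := by rw [hα]; field_simp; ring
    have hα1 : 0 ≤ 1 - α - β := by
      have : a / tan r ≤ 1 := by rw [div_le_one htr]; exact hat
      rw [hα]; linarith
    have : p + a • B 1 + b • B 2 = (1 - α - β) • p + (α / cos r) • (cos r • p + sin r • B 1) + (β / cos R) • (cos R • p + sin R • f) := by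
      rw [hfeq]
      simp only [smul_add, smul_smul]
      rw [div_mul_cancel₀ _ hcr.ne', div_mul_cancel₀ _ hcR.ne']
      have e1 : a = α / cos r * sin r + β / cos R * (sin R * cos φ) := by
        rw [← hαa]
        have : β * tan r = β / cos R * (sin R * cos φ) := by rw [← hφ, tan_eq_sin_div_cos]; ring
        rw [← this, tan_eq_sin_div_cos]; ring
      have e2 : b = β / cos R * (sin R * sin φ) := by
        rw [← hβb, tan_eq_sin_div_cos]; ring
      conv_lhs => rw [e1, e2]
      module
    rw [this]
    exact Kcone_add hK (Kcone_add hK (Kcone_smul hp1 hα1) (Kcone_smul hp2 (by positivity))) (Kcone_smul hp3 (by positivity))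
  · intro x hx
    obtain ⟨z, a, b, hz, hzp, hb, ha, hat, hab, habt, hxe, hn, hx1, hx2⟩ := hcoord x hx
    rw [← hzp]
    refine ⟨?_, ?_, ?_⟩
    · by_contra h
      push Not at h
      rw [tan_eq_sin_div_cos, div_pow, div_lt_iff₀ (by positivity)] at habt
      have h2 : cos r ^ 2 ≤ z ^ 2 := pow_le_pow_left₀ hcr.le h 2
      have := mul_le_mul_of_nonneg_right h2 (show 0 ≤ 1 + a ^ 2 + b ^ 2 by positivity)
      nlinarith [sin_sq_add_cos_sq r]
    · rw [hgeq, inner_add_left, real_inner_smul_left, real_inner_smul_left, hx1, hx2]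
      nlinarith [mul_pos hz (sub_pos.2 hab)]
    · rw [hfeq, inner_add_left, real_inner_smul_left, real_inner_smul_left, hx1, hx2]
      have hN : ‖x - z • p‖ ^ 2 = z ^ 2 * (a ^ 2 + b ^ 2) := by
        have e : ‖x - z • p‖ ^ 2 = ‖x‖ ^ 2 - 2 * z * ⟪p, x⟫ + z ^ 2 := by
          rw [norm_sub_sq_real, inner_smul_right, norm_smul, mul_pow, ← real_inner_self_eq_norm_sq p, hp, real_inner_comm]
          simp; ring
        rw [e, us_norm.1 hx.1, ← hzp]; nlinarith
      have hpos : 0 < cos φ * (z * a) + sin φ * (z * b) := by positivity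
      apply lt_of_pow_lt_pow_left₀ 2 hpos.le
      rw [mul_pow, hN]
      have h5 : 0 < b * (2 * a * cos φ * sin φ + b * sin φ ^ 2 - b * cos φ ^ 2) := by
        apply mul_pos hb
        nlinarith [mul_pos hcφ (sub_pos.2 hab)]
      nlinarith [mul_pos (pow_pos hz 2) h5]
end PartF1

section PartF2
open Filter Topology Metric Set

/-- Configuration of the incircle, its three contact normals and the three far points. -/
structure Cfg (K : Set (E 2)) (w r : ℝ) (p : E 2) (u : Fin 3 → E 2) (l : Fin 3 → ℝ) (y : Fin 3 → E 2) : Prop where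
  hw0 : 0 < w
  hw1 : w ≤ π / 2
  hr0 : 0 < r
  hrw : r < w / 2
  hp : ⟪p, p⟫ = 1
  uu : ∀ i, ⟪u i, u i⟫ = 1
  yy : ∀ i, ⟪y i, y i⟫ = 1
  yK : ∀ i, y i ∈ K
  upol : ∀ i, u i ∈ polar K
  lin : LinearIndependent ℝ u
  lpos : ∀ i, 0 < l i
  lsum : (∑ i, l i) * sin r = 1
  leq : ∑ i, l i • u i = -p
  pu : ∀ i, ⟪p, u i⟫ = -sin r
  yu : ∀ i, sin w ≤ -⟪y i, u i⟫
  yj : ∀ i j, ⟪y i, u j⟫ ≤ 0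
  py : ∀ i, ⟪p, y i⟫ ≤ cos (w - r)
  ball : ∀ x ∈ unitSphere 2, cos r ≤ ⟪p, x⟫ → x ∈ K

lemma exists_cfg {K : Set (E 2)} (hK : IsConvexBody K) {w : ℝ} (hw : width K = w) (hw0 : 0 < w) (hw1 : w ≤ π / 2) :
    (∃ p ∈ unitSphere 2, ∀ x ∈ unitSphere 2, cos (w / 2) ≤ ⟪p, x⟫ → x ∈ K) ∨
    ∃ r p u l y, Cfg K w r p u l y := by
  obtain ⟨p, r, hp, hr0, hr1, hpol, n, u, l, hu, hlin, hl, hl1, hlp, hpu⟩ := incircle hK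
  rcases le_or_gt (w / 2) r with hr | hr
  · left
    refine ⟨p, hp, fun x hx hxr => ball_sub hK hp (by linarith) (by linarith) (fun u hu => ?_) hx hxr⟩
    have := hpol u hu
    have := sin_le_sin_of_le_of_le_pi_div_two (by linarith) hr1 hr
    linarith
  · right
    obtain rfl := three_contacts hK hw hw0 hw1 hp hr0 hr hu hlin hl hl1 hlp hpu
    choose y hyK hy using fun i => W2 hK hw hw0 hw1 (hu i)
    have hyS : ∀ i, y i ∈ unitSphere 2 := fun i => hK.1.1 (hyK i)
    exact ⟨r, p, u, l, y, hw0, hw1, hr0, hr, us_inner hp, fun i => us_inner (hu i).1, fun i => us_inner (hyS i), hyK, hu, hlin, hl, hl1, hlp, hpu,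
      hy, fun i j => (hu j).2 _ (hyK i), fun i => far_point hp (hyS i) (hu i).1 hr0 hw1 (by linarith) (hpu i) (hy i),
      fun x hx hxr => ball_sub hK hp hr0 hr1 hpol hx hxr⟩

namespace Cfg
variable {K : Set (E 2)} {w r : ℝ} {p : E 2} {u : Fin 3 → E 2} {l : Fin 3 → ℝ} {y : Fin 3 → E 2}

lemma sin_w (h : Cfg K w r p u l y) : 0 < sin w := sin_pos_of_pos_of_lt_pi h.hw0 (by linarith [h.hw1, pi_pos])
lemma sin_r (h : Cfg K w r p u l y) : 0 < sin r := sin_pos_of_pos_of_lt_pi h.hr0 (by linarith [h.hw1, h.hrw, pi_pos])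
lemma cos_r (h : Cfg K w r p u l y) : 0 < cos r := cos_pos_of_mem_Ioo ⟨by linarith [h.hr0, pi_pos], by linarith [h.hw1, h.hrw, h.hw0]⟩
lemma cos_R (h : Cfg K w r p u l y) : 0 < cos (w - r) := cos_pos_of_mem_Ioo ⟨by linarith [h.hw0, h.hrw, pi_pos], by linarith [h.hw1, h.hr0, h.hw0]⟩
lemma sin_R (h : Cfg K w r p u l y) : 0 < sin (w - r) := sin_pos_of_pos_of_lt_pi (by linarith [h.hw0, h.hrw]) (by linarith [h.hw1, h.hr0, pi_pos])

lemma py_eq (h : Cfg K w r p u l y) (i : Fin 3) : ⟪p, y i⟫ = ∑ j, l j * (-⟪y i, u j⟫) := by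
  have : p = -∑ i, l i • u i := by rw [h.leq, neg_neg]
  conv_lhs => rw [this, inner_neg_left, sum_inner, ← Finset.sum_neg_distrib]
  apply Finset.sum_congr rfl
  intro j _
  rw [real_inner_smul_left, real_inner_comm]; ring

lemma py_lower (h : Cfg K w r p u l y) (i : Fin 3) : l i * sin w ≤ ⟪p, y i⟫ := by
  rw [h.py_eq i]
  calc l i * sin w ≤ l i * (-⟪y i, u i⟫) := mul_le_mul_of_nonneg_left (h.yu i) (h.lpos i).le
    _ ≤ _ := Finset.single_le_sum (f := fun j => l j * (-⟪y i, u j⟫)) (fun j _ => mul_nonneg (h.lpos j).le (by linarith [h.yj i j])) (Finset.mem_univ i)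

lemma py_pos (h : Cfg K w r p u l y) (i : Fin 3) : 0 < ⟪p, y i⟫ :=
  lt_of_lt_of_le (mul_pos (h.lpos i) h.sin_w) (h.py_lower i)

lemma sin_ineq (h : Cfg K w r p u l y) : sin w ≤ 3 * sin r * cos (w - r) := by
  have h1 : (∑ i, l i) * sin w ≤ 3 * cos (w - r) := by
    rw [Fin.sum_univ_three]
    linarith [h.py_lower 0, h.py_lower 1, h.py_lower 2, h.py 0, h.py 1, h.py 2]
  have h2 := mul_le_mul_of_nonneg_right h1 h.sin_r.le
  have h3 : (∑ i, l i) * sin w * sin r = sin w := by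
    rw [mul_right_comm, h.lsum, one_mul]
  linarith

lemma two_sin (h : Cfg K w r p u l y) : 2 * sin r * cos (w - r) < sin w := by
  have e1 : sin w = sin r * cos (w - r) + cos r * sin (w - r) := by rw [← sin_add]; ring_nf
  have e2 : sin (w - r - r) = sin (w - r) * cos r - cos (w - r) * sin r := sin_sub _ _
  have e3 : 0 < sin (w - r - r) := sin_pos_of_pos_of_lt_pi (by linarith [h.hrw]) (by linarith [h.hw1, h.hr0, pi_pos])
  linarith

/-- The open cone (of tangent directions) of the cap at `y`. -/
def I (p : E 2) (r : ℝ) (y g : E 2) : Prop := sin r * ⟪p, y⟫ * ‖g‖ < cos r * ⟪g, y⟫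

lemma I_add (h : Cfg K w r p u l y) {i : Fin 3} {g g' : E 2} (hg : I p r (y i) g) (hg' : I p r (y i) g') : I p r (y i) (g + g') := by
  unfold I at *
  rw [inner_add_left]
  have := mul_le_mul_of_nonneg_left (norm_add_le g g') (mul_pos h.sin_r (h.py_pos i)).le
  linarith

lemma I_smul {v : E 2} {g : E 2} (hg : I p r v g) {t : ℝ} (ht : 0 < t) : I p r v (t • g) := by
  unfold I at *
  rw [real_inner_smul_left, norm_smul, Real.norm_eq_abs, abs_of_pos ht]
  nlinarith [mul_lt_mul_of_pos_left hg ht]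

lemma I_add_smul (h : Cfg K w r p u l y) {i : Fin 3} {g g' : E 2} (hg : I p r (y i) g) (hg' : I p r (y i) g') {t : ℝ} (ht : 0 ≤ t) :
    I p r (y i) (g + t • g') := by
  rcases ht.eq_or_lt with rfl | ht
  · simpa using hg
  · exact h.I_add hg (I_smul hg' ht)

lemma E_norm (h : Cfg K w r p u l y) (i : Fin 3) : ‖u i + sin r • p‖ = cos r := by
  have : ‖u i + sin r • p‖ ^ 2 = cos r ^ 2 := by
    rw [← real_inner_self_eq_norm_sq, inner_add_left, inner_add_right, inner_add_right, real_inner_smul_left, real_inner_smul_left,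
      inner_smul_right, inner_smul_right, real_inner_comm p (u i), h.uu, h.pu, h.hp]
    nlinarith [sin_sq_add_cos_sq r]
  exact (pow_left_inj₀ (norm_nonneg _) h.cos_r.le two_ne_zero).1 this

lemma not_I (h : Cfg K w r p u l y) (i j : Fin 3) {t : ℝ} (ht : 0 ≤ t) : ¬ I p r (y i) (t • (u j + sin r • p)) := by
  intro hI
  unfold I at hI
  rw [norm_smul, h.E_norm, real_inner_smul_left, inner_add_left, real_inner_smul_left, real_inner_comm (y i) (u j), Real.norm_eq_abs, abs_of_nonneg ht] at hI
  have := mul_nonneg (mul_nonneg ht h.cos_r.le) (neg_nonneg.2 (h.yj i j))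
  nlinarith

lemma neg_I (h : Cfg K w r p u l y) (i : Fin 3) : I p r (y i) (-(u i + sin r • p)) := by
  unfold I
  rw [norm_neg, h.E_norm, inner_neg_left, inner_add_left, real_inner_smul_left, real_inner_comm (y i) (u i)]
  have h1 := h.two_sin
  have h2 := mul_le_mul_of_nonneg_left (h.py i) h.sin_r.le
  have h3 : 0 < -⟪y i, u i⟫ - 2 * (sin r * ⟪p, y i⟫) := by linarith [h.yu i]
  nlinarith [mul_pos h.cos_r h3]

lemma I_lt_aux (h : Cfg K w r p u l y) {i j k : Fin 3} {g : E 2} {a b c : ℝ}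
    (h0 : l i • (u i + sin r • p) + l j • (u j + sin r • p) + l k • (u k + sin r • p) = 0)
    (hg : g = (a * l i) • (u i + sin r • p) + (b * l j) • (u j + sin r • p) + (c * l k) • (u k + sin r • p))
    (hI : I p r (y i) g) : a < b := by
  by_contra hab
  push Not at hab
  have h1 := h.I_add_smul hI (h.neg_I i) (mul_nonneg (sub_nonneg.2 hab) (h.lpos i).le)
  set A := u i + sin r • p
  set B := u j + sin r • p
  set C := u k + sin r • p
  have e0 : l k • C = -(l i • A + l j • B) := by rw [← add_eq_zero_iff_eq_neg', h0]
  have e0' : l j • B = -(l i • A + l k • C) := by rw [e0]; abel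
  have e1 : g + ((a - b) * l i) • (-A) = ((c - b) * l k) • C := by
    have : (b * l j) • B = b • (-(l i • A + l k • C)) := by rw [← e0', smul_smul]
    rw [hg, this]; module
  rw [e1] at h1
  rcases le_or_gt b c with hbc | hbc
  · exact h.not_I i k (mul_nonneg (sub_nonneg.2 hbc) (h.lpos k).le) h1
  · have h2 := h.I_add_smul h1 (h.neg_I i) (mul_nonneg (sub_nonneg.2 hbc.le) (h.lpos i).le)
    have e2 : ((c - b) * l k) • C + ((b - c) * l i) • (-A) = ((b - c) * l j) • B := by
      rw [mul_smul, e0]; module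
    rw [e2] at h2
    exact h.not_I i j (mul_nonneg (sub_nonneg.2 hbc.le) (h.lpos j).le) h2

lemma E_sum (h : Cfg K w r p u l y) : ∑ i, l i • (u i + sin r • p) = 0 := by
  simp only [smul_add, Finset.sum_add_distrib, smul_smul]
  rw [h.leq, ← Finset.sum_smul, ← Finset.sum_mul, h.lsum]; simp

lemma tangent_expand (h : Cfg K w r p u l y) {g : E 2} (hg : ⟪p, g⟫ = 0) :
    ∃ a : Fin 3 → ℝ, g = ∑ i, (a i * l i) • (u i + sin r • p) := by
  have hcard : Fintype.card (Fin 3) = Module.finrank ℝ (E 2) := by simp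
  let b := basisOfLinearIndependentOfCardEqFinrank h.lin hcard
  have hb : ⇑b = u := coe_basisOfLinearIndependentOfCardEqFinrank h.lin hcard
  have hs := b.sum_repr g
  rw [hb] at hs
  have h1 : (∑ i, b.repr g i) * sin r = 0 := by
    have : ⟪p, ∑ i, b.repr g i • u i⟫ = 0 := by rw [hs]; exact hg
    rw [inner_sum] at this
    simp only [inner_smul_right, h.pu] at this
    rw [Finset.sum_mul, ← neg_eq_zero, ← Finset.sum_neg_distrib, ← this]
    apply Finset.sum_congr rfl; intro i _; ring
  refine ⟨fun i => b.repr g i / l i, ?_⟩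
  have : ∀ i, b.repr g i / l i * l i = b.repr g i := fun i => div_mul_cancel₀ _ (h.lpos i).ne'
  simp only [this, smul_add, Finset.sum_add_distrib, smul_smul]
  rw [hs, ← Finset.sum_smul, ← Finset.sum_mul, h1]; simp

lemma I_lt (h : Cfg K w r p u l y) {g : E 2} {a : Fin 3 → ℝ} (hg : g = ∑ i, (a i * l i) • (u i + sin r • p)) {i j : Fin 3} (hij : i ≠ j)
    (hI : I p r (y i) g) : a i < a j := by
  have h0 := h.E_sum
  rw [Fin.sum_univ_three] at h0 hg
  fin_cases i <;> fin_cases j <;> first | exact absurd rfl hij | skip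
  · exact h.I_lt_aux (i := 0) (j := 1) (k := 2) (a := a 0) (b := a 1) (c := a 2) h0 hg hI
  · exact h.I_lt_aux (i := 0) (j := 2) (k := 1) (a := a 0) (b := a 2) (c := a 1) (by rw [← h0]; abel) (by rw [hg]; abel) hI
  · exact h.I_lt_aux (i := 1) (j := 0) (k := 2) (a := a 1) (b := a 0) (c := a 2) (by rw [← h0]; abel) (by rw [hg]; abel) hI
  · exact h.I_lt_aux (i := 1) (j := 2) (k := 0) (a := a 1) (b := a 2) (c := a 0) (by rw [← h0]; abel) (by rw [hg]; abel) hI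
  · exact h.I_lt_aux (i := 2) (j := 0) (k := 1) (a := a 2) (b := a 0) (c := a 1) (by rw [← h0]; abel) (by rw [hg]; abel) hI
  · exact h.I_lt_aux (i := 2) (j := 1) (k := 0) (a := a 2) (b := a 1) (c := a 0) (by rw [← h0]; abel) (by rw [hg]; abel) hI

lemma I_disj (h : Cfg K w r p u l y) {g : E 2} (hg : ⟪p, g⟫ = 0) {i j : Fin 3} (hij : i ≠ j)
    (hI : I p r (y i) g) (hJ : I p r (y j) g) : False := by
  obtain ⟨a, ha⟩ := h.tangent_expand hg
  exact lt_asymm (h.I_lt ha hij hI) (h.I_lt ha hij.symm hJ)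

end Cfg
end PartF2

section PartF2b
open Filter Topology Metric Set

namespace Cfg
variable {K : Set (E 2)} {w r : ℝ} {p : E 2} {u : Fin 3 → E 2} {l : Fin 3 → ℝ} {y : Fin 3 → E 2}

lemma caps (h : Cfg K w r p u l y) (hK : SConvex K) {φ : ℝ} (hφ0 : 0 < φ) (hφ1 : φ < π / 2)
    (hφ : cos φ * tan (w - r) = tan r) (i : Fin 3) :
    ∃ B : Bool → OrthonormalBasis (Fin 3) ℝ (E 2), (∀ b, gset (B b) (QH (tan r) φ) ⊆ K) ∧
      (∀ b, ∀ x ∈ gset (B b) (QH (tan r) φ), ⟪p, x⟫ < cos r ∧ I p r (y i) (x - ⟪p, x⟫ • p)) ∧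
      Disjoint (gset (B true) (QH (tan r) φ)) (gset (B false) (QH (tan r) φ)) := by
  have hcr := h.cos_r
  have hsr := h.sin_r
  have hcR := h.cos_R
  have hsR := h.sin_R
  have hp := h.hp
  have hyy := h.yy i
  have hcc := h.py_pos i
  have hccR := h.py i
  have hcs := sin_sq_add_cos_sq (w - r)
  have hyp : ⟪y i, p⟫ = ⟪p, y i⟫ := real_inner_comm _ _
  have hY : y i ∈ Kcone K := Kcone_of_mem (h.yK i)
  set c := ⟪p, y i⟫ with hc
  set F := y i - c • p with hF
  have hpF : ⟪p, F⟫ = 0 := by rw [hF, inner_sub_right, inner_smul_right, hp, ← hc]; ring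
  have hFF : ⟪F, F⟫ = 1 - c ^ 2 := by
    rw [hF, inner_sub_left, inner_sub_right, inner_sub_right, real_inner_smul_left, real_inner_smul_left, inner_smul_right, inner_smul_right,
      hyy, hyp, hp, ← hc]; ring
  set s := ‖F‖ with hs
  have hs2 : s ^ 2 = 1 - c ^ 2 := by rw [hs, ← real_inner_self_eq_norm_sq, hFF]
  have hc2 : c ^ 2 ≤ cos (w - r) ^ 2 := pow_le_pow_left₀ hcc.le hccR 2
  have hsR2 : sin (w - r) ≤ s := by
    apply (pow_le_pow_iff_left₀ hsR.le (norm_nonneg _) two_ne_zero).1; linarith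
  have hs0 : 0 < s := by linarith
  have hcross : sin (w - r) * c ≤ cos (w - r) * s := by
    have h1 := mul_le_mul_of_nonneg_left hccR hsR.le
    have h2 := mul_le_mul_of_nonneg_left hsR2 hcR.le
    linarith
  obtain ⟨f, hf⟩ : ∃ f, f = s⁻¹ • F := ⟨_, rfl⟩
  have hff : ⟪f, f⟫ = 1 := by
    rw [hf, real_inner_smul_left, inner_smul_right, hFF, ← hs2]; field_simp
  have hpf : ⟪p, f⟫ = 0 := by rw [hf, inner_smul_right, hpF, mul_zero]
  have hFf : F = s • f := by rw [hf, smul_smul, mul_inv_cancel₀ hs0.ne', one_smul]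
  obtain ⟨g, hg, hpg, hfg⟩ := frame2 hp hff hpf
  have hpK : p ∈ Kcone K := Kcone_of_mem (h.ball p (us_of_inner hp) (by rw [hp]; exact cos_le_one r))
  have hYK : cos (w - r) • p + sin (w - r) • f ∈ K := by
    apply Kcone_unit hK.1
    · have : cos (w - r) • p + sin (w - r) • f = (cos (w - r) - sin (w - r) * c / s) • p + (sin (w - r) / s) • y i := by
        rw [hf, hF]; module
      rw [this]
      apply Kcone_add hK (Kcone_smul hpK _) (Kcone_smul hY (by positivity))
      rw [sub_nonneg, div_le_iff₀ hs0]; exact hcross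
    · apply us_of_inner
      have hfp : ⟪f, p⟫ = 0 := by rw [real_inner_comm]; exact hpf
      simp only [inner_add_left, inner_add_right, real_inner_smul_left, inner_smul_right, hp, hff, hpf, hfp]
      linarith
  have hR : w - r < π / 2 := by linarith [h.hr0, h.hw1]
  have hrR : r < w - r := by linarith [h.hrw]
  have conv : ∀ x : E 2, cos φ * ‖x - ⟪p, x⟫ • p‖ < ⟪f, x⟫ → I p r (y i) (x - ⟪p, x⟫ • p) := by
    intro x hx
    unfold I
    have e : ⟪x - ⟪p, x⟫ • p, y i⟫ = s * ⟪f, x⟫ := by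
      have : y i = s • f + c • p := by rw [← hFf, hF]; abel
      rw [this, inner_add_right, inner_smul_right, inner_smul_right, inner_sub_left, inner_sub_left, real_inner_smul_left, real_inner_smul_left, hpf, hp,
        real_inner_comm x f, real_inner_comm x p]; ring
    rw [e]
    set N := ‖x - ⟪p, x⟫ • p‖
    have hN : 0 ≤ N := norm_nonneg _
    have hfx : 0 < ⟪f, x⟫ := lt_of_le_of_lt (mul_nonneg (cos_pos_of_mem_Ioo ⟨by linarith, hφ1⟩).le hN) hx
    have e2 : cos φ * sin (w - r) * cos r = sin r * cos (w - r) := by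
      have := hφ
      rw [tan_eq_sin_div_cos, tan_eq_sin_div_cos] at this
      field_simp at this
      linarith
    have h1 : sin r * cos (w - r) * N < cos r * sin (w - r) * ⟪f, x⟫ := by
      have := mul_lt_mul_of_pos_left hx (mul_pos hsR hcr)
      rw [← e2]; linarith
    have h2 : sin r * c * N ≤ sin r * cos (w - r) * N := by gcongr
    have h3 : cos r * sin (w - r) * ⟪f, x⟫ ≤ cos r * (s * ⟪f, x⟫) := by
      rw [mul_assoc]; gcongr
    linarith
  obtain ⟨B1, hB1, hB1'⟩ := half_cap hK h.hr0 hrR hR hp hff hg hpf hpg hfg h.ball hYK hφ0 hφ1 hφ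
  obtain ⟨B2, hB2, hB2'⟩ := half_cap hK (g := -g) h.hr0 hrR hR hp hff (by rw [inner_neg_neg]; exact hg) hpf (by rw [inner_neg_right, hpg, neg_zero])
    (by rw [inner_neg_right, hfg, neg_zero]) h.ball hYK hφ0 hφ1 hφ
  refine ⟨fun b => if b then B1 else B2, ?_, ?_, ?_⟩
  · intro b; cases b
    · simpa using hB2
    · simpa using hB1
  · intro b x hx; cases b
    · have := hB2' x (by simpa using hx)
      exact ⟨this.1, conv x this.2.2⟩
    · have := hB1' x (by simpa using hx)
      exact ⟨this.1, conv x this.2.2⟩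
  · rw [Set.disjoint_left]
    intro x hx hx'
    have h1 := (hB1' x (by simpa using hx)).2.1
    have h2 := (hB2' x (by simpa using hx')).2.1
    rw [inner_neg_left] at h2; linarith

end Cfg

/-- The defining property of the area constant. -/
def AreaConst (c : ℝ) : Prop := 0 < c ∧ ∀ (B : OrthonormalBasis (Fin 3) ℝ (E 2)) (r : ℝ), 0 < r → r < π / 2 →
  μH[2] (gset B (QD (tan r))) = ENNReal.ofReal (c * (2 * π * (1 - cos r))) ∧ 
  ∀ φ, 0 < φ → φ < π / 2 → μH[2] (gset B (QH (tan r) φ)) = ENNReal.ofReal (c * FH r φ) ∧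
    μH[2] (gset B (QC (tan r) φ)) = ENNReal.ofReal (c * FH r φ)

lemma exists_areaConst : ∃ c, AreaConst c := by
  obtain ⟨c, hc, h⟩ := measure_summary
  exact ⟨c, hc, h⟩

lemma mu_ne_top {K : Set (E 2)} (hK : K ⊆ unitSphere 2) : μH[2] K ≠ ⊤ :=
  ((measure_mono hK).trans_lt mu_sphere_lt_top).ne

lemma exists_frame (p : E 2) (hp : p ∈ unitSphere 2) : ∃ B : OrthonormalBasis (Fin 3) ℝ (E 2), B 0 = p := by
  have hp' := us_inner hp
  obtain ⟨b, hb, hpb⟩ := exists_perp p hp'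
  obtain ⟨c, hc, hpc, hbc⟩ := frame2 hp' hb hpb
  obtain ⟨B, hB, -⟩ := frame3 hp' hb hc hpb hpc hbc
  exact ⟨B, hB⟩

lemma area_ball {c : ℝ} (hc : AreaConst c) {K : Set (E 2)} (hK : K ⊆ unitSphere 2) {p : E 2} {r : ℝ} (hr0 : 0 < r) (hr1 : r < π / 2)
    (hp : p ∈ unitSphere 2) (h : ∀ x ∈ unitSphere 2, cos r ≤ ⟪p, x⟫ → x ∈ K) : c * (2 * π * (1 - cos r)) ≤ area K := by
  obtain ⟨B, hB⟩ := exists_frame p hp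
  have h1 := (hc.2 B r hr0 hr1).1
  have hsub : gset B (QD (tan r)) ⊆ K := by
    intro x hx
    rw [gset_disc hr0 hr1, hB] at hx
    exact h x hx.1 hx.2
  unfold area
  rw [← ENNReal.ofReal_le_iff_le_toReal (mu_ne_top hK), ← h1]
  exact measure_mono hsub

lemma Cfg.area_lower {K : Set (E 2)} {w r : ℝ} {p : E 2} {u : Fin 3 → E 2} {l : Fin 3 → ℝ} {y : Fin 3 → E 2}
    (h : Cfg K w r p u l y) (hK : SConvex K) {c : ℝ} (hc : AreaConst c) :
    c * (2 * π * (1 - cos r) + 6 * FH r (arccos (tan r / tan (w - r)))) ≤ area K := by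
  have hr0 := h.hr0
  have hr1 : r < π / 2 := by linarith [h.hrw, h.hw1, h.hw0]
  have hRr : r < w - r := by linarith [h.hrw]
  have hR : w - r < π / 2 := by linarith [h.hr0, h.hw1]
  have htr : 0 < tan r := tan_pos_of_pos_of_lt_pi_div_two hr0 hr1
  have htR : tan r < tan (w - r) := tan_lt_tan_of_lt_of_lt_pi_div_two (by linarith [pi_pos]) hR hRr
  have htR0 : 0 < tan (w - r) := htr.trans htR
  set φ := arccos (tan r / tan (w - r)) with hφd
  have hφ0 : 0 < φ := arccos_pos.2 ((div_lt_one htR0).2 htR)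
  have hφ1 : φ < π / 2 := arccos_lt_pi_div_two.2 (by positivity)
  have hφ : cos φ * tan (w - r) = tan r := by
    rw [hφd, cos_arccos (by linarith [div_pos htr htR0]) (((div_lt_one htR0).2 htR).le), div_mul_cancel₀ _ htR0.ne']
  choose B hBK hBI hBd using h.caps hK hφ0 hφ1 hφ
  obtain ⟨B0, hB0⟩ := exists_frame p (us_of_inner h.hp)
  let S : Fin 3 × Bool → Set (E 2) := fun q => gset (B q.1 q.2) (QH (tan r) φ)
  have hSm : ∀ q, MeasurableSet (S q) := fun q => gset_meas _ (QH_meas _ _)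
  have hSd : Pairwise (Function.onFun Disjoint S) := by
    rintro ⟨i, b⟩ ⟨j, b'⟩ hne
    by_cases hij : i = j
    · subst hij
      cases b <;> cases b' <;> first | exact absurd rfl hne | exact hBd i | exact (hBd i).symm
    · show Disjoint (S (i, b)) (S (j, b'))
      rw [Set.disjoint_left]
      intro x hx hx'
      refine h.I_disj (g := x - ⟪p, x⟫ • p) ?_ hij (hBI i b x hx).2 (hBI j b' x hx').2
      rw [inner_sub_right, inner_smul_right, h.hp]; ring
  let D := gset B0 (QD (tan r))
  have hDS : Disjoint D (⋃ q, S q) := by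
    rw [Set.disjoint_left]
    intro x hx hx'
    obtain ⟨q, hq⟩ := mem_iUnion.1 hx'
    rw [gset_disc hr0 hr1, hB0] at hx
    linarith [(hBI q.1 q.2 x hq).1, hx.2]
  have hsub : D ∪ (⋃ q, S q) ⊆ K := by
    apply union_subset
    · intro x hx
      rw [gset_disc hr0 hr1, hB0] at hx
      exact h.ball x hx.1 hx.2
    · exact iUnion_subset fun q => hBK q.1 q.2
  have hm := measure_mono (μ := μH[2]) hsub
  rw [measure_union hDS (MeasurableSet.iUnion hSm), measure_iUnion hSd hSm, tsum_fintype] at hm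
  have hS : ∀ q, μH[2] (S q) = ENNReal.ofReal (c * FH r φ) := fun q => ((hc.2 (B q.1 q.2) r hr0 hr1).2 φ hφ0 hφ1).1
  simp only [hS] at hm
  rw [show μH[2] D = _ from (hc.2 B0 r hr0 hr1).1, Finset.sum_const] at hm
  have h6 : (Finset.univ : Finset (Fin 3 × Bool)).card = 6 := by decide
  rw [h6] at hm
  unfold area
  rw [← ENNReal.ofReal_le_iff_le_toReal (mu_ne_top hK.1)]
  refine le_trans ?_ hm
  rw [show c * (2 * π * (1 - cos r) + 6 * FH r φ) = c * (2 * π * (1 - cos r)) + 6 * (c * FH r φ) by ring]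
  refine le_trans ENNReal.ofReal_add_le ?_
  gcongr
  rw [ENNReal.ofReal_mul (by norm_num)]
  simp [nsmul_eq_mul]

end PartF2b

section PartF3
open Filter Topology Metric Set

/-- The lower-bound function. -/
def FF (w r : ℝ) : ℝ := 2 * π * (1 - cos r) + 6 * FH r (arccos (tan r / tan (w - r)))

lemma FF_deriv {w r : ℝ} (hr0 : 0 < r) (hrw : r < w / 2) (hw : w ≤ π / 2) :
    HasDerivAt (FF w) (sin r * (2 * π - 6 * arccos (tan r / tan (w - r))) + 
      6 * (sin (arccos (tan r / tan (w - r))) * (cos r * (1 - cos (w - r - r)) / sin (w - r - r)))) r := by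
  have hr1 : r < π / 2 := by linarith
  have hR : w - r < π / 2 := by linarith
  have hrR : r < w - r := by linarith
  have hcr : 0 < cos r := cos_pos_of_mem_Ioo ⟨by linarith, hr1⟩
  have hsr : 0 < sin r := sin_pos_of_pos_of_lt_pi hr0 (by linarith)
  have hcR : 0 < cos (w - r) := cos_pos_of_mem_Ioo ⟨by linarith, hR⟩
  have hsR : 0 < sin (w - r) := sin_pos_of_pos_of_lt_pi (by linarith) (by linarith)
  have hsD : 0 < sin (w - r - r) := sin_pos_of_pos_of_lt_pi (by linarith) (by linarith)
  have htr : 0 < tan r := tan_pos_of_pos_of_lt_pi_div_two hr0 hr1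
  have htR : tan r < tan (w - r) := tan_lt_tan_of_lt_of_lt_pi_div_two (by linarith [pi_pos]) hR hrR
  have htR0 : 0 < tan (w - r) := htr.trans htR
  have hq1 : tan r / tan (w - r) < 1 := (div_lt_one htR0).2 htR
  have hq0 : 0 < tan r / tan (w - r) := by positivity
  have hcos : cos (arccos (tan r / tan (w - r))) = tan r / tan (w - r) := cos_arccos (by linarith) hq1.le
  have hφ0 : 0 < arccos (tan r / tan (w - r)) := arccos_pos.2 hq1
  have hsφ : 0 < sin (arccos (tan r / tan (w - r))) := sin_pos_of_pos_of_lt_pi hφ0 (by linarith [arccos_lt_pi_div_two.2 hq0])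
  -- derivative of the quotient
  have hd1 : HasDerivAt tan (1 / cos r ^ 2) r := hasDerivAt_tan hcr.ne'
  have hd2 : HasDerivAt (fun r => tan (w - r)) (-(1 / cos (w - r) ^ 2)) r := by
    have := (hasDerivAt_tan hcR.ne').comp r ((hasDerivAt_id r).const_sub w)
    exact this.congr_deriv (by simp)
  have hdq := hd1.div hd2 htR0.ne'
  have hdφ := (hasDerivAt_arccos (by linarith : tan r / tan (w - r) ≠ -1) hq1.ne).comp r hdq
  have hssq : √(1 - (tan r / tan (w - r)) ^ 2) = sin (arccos (tan r / tan (w - r))) := (sin_arccos _).symm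
  rw [hssq] at hdφ
  have hC := hdφ
  set φ := arccos (tan r / tan (w - r)) with hφd
  have eD : sin (w - r - r) = sin (w - r) * cos r - cos (w - r) * sin r := sin_sub _ _
  have eD' : cos (w - r - r) = cos (w - r) * cos r + sin (w - r) * sin r := cos_sub _ _
  have p1 := sin_sq_add_cos_sq r
  have p2 := sin_sq_add_cos_sq (w - r)
  have p3 := sin_sq_add_cos_sq φ
  set S := sin (w - r)
  set C := cos (w - r)
  have ht1 : tan r = sin r / cos r := tan_eq_sin_div_cos r
  have ht2 : tan (w - r) = S / C := tan_eq_sin_div_cos _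
  have hq : cos φ * (cos r * S) = sin r * C := by
    rw [hcos, ht1, ht2]; field_simp
  have hs2 : sin φ ^ 2 * (cos r * S) ^ 2 = (S * cos r - C * sin r) * (S * cos r + C * sin r) := by
    have : sin φ ^ 2 = 1 - cos φ ^ 2 := by linarith
    rw [this, sub_mul, ← mul_pow, hq]; ring
  have hφ' : HasDerivAt (fun r => arccos (tan r / tan (w - r))) (-sin φ * cos (w - r - r) / sin (w - r - r)) r := by
    refine hC.congr_deriv ?_
    rw [ht1, ht2]
    set X := sin (w - r - r)
    set Y := cos (w - r - r)
    field_simp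
    have e : sin φ ^ 2 * (cos r * S) ^ 2 * (C * cos r + S * sin r) = (S * cos r - C * sin r) * (S * C + sin r * cos r) := by
      rw [hs2]
      linear_combination (S * cos r - C * sin r) * (S * C * p1 + sin r * cos r * p2)
    linear_combination e + sin φ ^ 2 * (cos r * S) ^ 2 * eD' - (S * C + cos r * sin r) * eD
  have hFH : HasDerivAt (fun r => FH r (arccos (tan r / tan (w - r)))) 
      (-φ * sin r + sin φ * (cos r * (1 - cos (w - r - r)) / sin (w - r - r))) r := by
    have hroot : 1 - (sin φ * cos r) ^ 2 = (sin r / S) ^ 2 := by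
      rw [div_pow, eq_div_iff (by positivity)]
      linear_combination (-1) * hs2 - S ^ 2 * p1 + sin r ^ 2 * p2
    have hroot' : √(1 - (sin φ * cos r) ^ 2) = sin r / S := by rw [hroot, sqrt_sq (by positivity)]
    have hlt : (sin φ * cos r) ^ 2 < 1 := by
      have : 0 < (sin r / S) ^ 2 := by positivity
      linarith
    have hpos : 0 < sin φ * cos r := by positivity
    have hlt1 : sin φ * cos r < 1 := by nlinarith
    have ha := hφ'.mul (hasDerivAt_cos r)
    have hb0 := (hφ'.sin).mul (hasDerivAt_cos r)
    have hb := (hasDerivAt_arcsin (by linarith : sin φ * cos r ≠ -1) hlt1.ne).comp r hb0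
    have hf := ha.sub hb
    unfold FH
    refine hf.congr_deriv ?_
    rw [hroot', ← hφd]
    set X := sin (w - r - r)
    set Y := cos (w - r - r)
    field_simp
    linear_combination sin φ * Y * hq + sin φ * sin r * (C * eD' + S * eD + cos r * p2)
  unfold FF
  have := (((hasDerivAt_cos r).const_sub 1).const_mul (2 * π)).add (hFH.const_mul 6)
  refine this.congr_deriv ?_
  ring

lemma FF_mono {w r0 : ℝ} (hr0 : 0 < r0) (hrw : r0 < w / 2) (hw : w ≤ π / 2) (ht : tan (w - r0) = 2 * tan r0) :
    StrictMonoOn (FF w) (Icc r0 (w / 2)) := by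
  have hpi := pi_pos
  apply strictMonoOn_of_deriv_pos (convex_Icc _ _)
  · unfold FF FH
    have h1 : ContinuousOn tan (Icc r0 (w / 2)) := by
      intro r hr
      apply ContinuousAt.continuousWithinAt
      exact continuousAt_tan.2 (cos_pos_of_mem_Ioo ⟨by linarith [hr.1], by linarith [hr.2]⟩).ne'
    have h2 : ContinuousOn (fun r => tan (w - r)) (Icc r0 (w / 2)) := by
      intro r hr
      apply ContinuousAt.continuousWithinAt
      exact (continuousAt_tan.2 (cos_pos_of_mem_Ioo ⟨by linarith [hr.2], by linarith [hr.1]⟩).ne').comp (f := fun r => w - r) (by fun_prop)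
    have h3 : ContinuousOn (fun r => arccos (tan r / tan (w - r))) (Icc r0 (w / 2)) := by
      apply continuous_arccos.comp_continuousOn
      apply h1.div h2
      intro r hr
      exact (tan_pos_of_pos_of_lt_pi_div_two (by linarith [hr.2]) (by linarith [hr.1])).ne'
    have h4 : ContinuousOn (fun r => arcsin (sin (arccos (tan r / tan (w - r))) * cos r)) (Icc r0 (w / 2)) :=
      continuous_arcsin.comp_continuousOn ((continuous_sin.comp_continuousOn h3).mul continuous_cos.continuousOn)
    exact ((continuous_const.mul (continuous_const.sub continuous_cos)).continuousOn).add
      (continuousOn_const.mul ((h3.mul continuous_cos.continuousOn).sub h4))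
  · intro r hr
    rw [interior_Icc] at hr
    obtain ⟨h1, h2⟩ := hr
    rw [(FF_deriv (by linarith) h2 hw).deriv]
    have hcr : 0 < cos r := cos_pos_of_mem_Ioo ⟨by linarith, by linarith⟩
    have hsr : 0 < sin r := sin_pos_of_pos_of_lt_pi (by linarith) (by linarith)
    have hsD : 0 < sin (w - r - r) := sin_pos_of_pos_of_lt_pi (by linarith) (by linarith)
    have hD : 0 ≤ 1 - cos (w - r - r) := by linarith [cos_le_one (w - r - r)]
    have hD' : cos (w - r - r) < 1 := by
      rw [← cos_zero]; exact cos_lt_cos_of_nonneg_of_le_pi le_rfl (by linarith) (by linarith)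
    have ht0 : 0 < tan r0 := tan_pos_of_pos_of_lt_pi_div_two hr0 (by linarith)
    have htr : tan r0 < tan r := tan_lt_tan_of_lt_of_lt_pi_div_two (by linarith) (by linarith) h1
    have htR : tan (w - r) < tan (w - r0) := tan_lt_tan_of_lt_of_lt_pi_div_two (by linarith) (by linarith) (by linarith)
    have htrR : tan r < tan (w - r) := tan_lt_tan_of_lt_of_lt_pi_div_two (by linarith) (by linarith) (by linarith)
    have htR0 : 0 < tan (w - r) := by linarith
    have hq : 1 / 2 ≤ tan r / tan (w - r) := by rw [div_le_div_iff₀ (by norm_num) htR0]; linarith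
    have hφ : arccos (tan r / tan (w - r)) ≤ π / 3 := by
      rw [← arccos_cos (by linarith : 0 ≤ π / 3) (by linarith), cos_pi_div_three]
      exact arccos_le_arccos hq
    have hφ0 : 0 < arccos (tan r / tan (w - r)) := arccos_pos.2 ((div_lt_one htR0).2 htrR)
    have hsφ := sin_pos_of_pos_of_lt_pi hφ0 (by linarith)
    have a1 : 0 ≤ sin r * (2 * π - 6 * arccos (tan r / tan (w - r))) := mul_nonneg hsr.le (by linarith)
    have a2 : 0 < sin (arccos (tan r / tan (w - r))) * (cos r * (1 - cos (w - r - r)) / sin (w - r - r)) := by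
      apply mul_pos hsφ
      apply div_pos (mul_pos hcr (by linarith)) hsD
    linarith

lemma FF_half {w : ℝ} (hw0 : 0 < w) (hw : w ≤ π / 2) : FF w (w / 2) = 2 * π * (1 - cos (w / 2)) := by
  have : 0 < tan (w / 2) := tan_pos_of_pos_of_lt_pi_div_two (by linarith) (by linarith [pi_pos])
  unfold FF FH
  rw [show w - w / 2 = w / 2 by ring, div_self this.ne']
  simp

lemma r0_facts {w r0 : ℝ} (hr0 : 0 < r0) (hrw : r0 < w / 2) (hw : w ≤ π / 2) (ht : tan (w - r0) = 2 * tan r0) :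
    arccos (tan r0 / tan (w - r0)) = π / 3 ∧ sin w = 3 * sin r0 * cos (w - r0) ∧
    ∀ r, 0 < r → sin w ≤ 3 * sin r * cos (w - r) → r0 ≤ r := by
  have hpi := pi_pos
  have ht0 : 0 < tan r0 := tan_pos_of_pos_of_lt_pi_div_two hr0 (by linarith)
  have hcr : 0 < cos r0 := cos_pos_of_mem_Ioo ⟨by linarith, by linarith⟩
  have hcR : 0 < cos (w - r0) := cos_pos_of_mem_Ioo ⟨by linarith, by linarith⟩
  have e : sin w = 3 * sin r0 * cos (w - r0) := by
    have e1 : sin w = sin r0 * cos (w - r0) + cos r0 * sin (w - r0) := by rw [← sin_add]; ring_nf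
    rw [tan_eq_sin_div_cos, tan_eq_sin_div_cos] at ht
    field_simp at ht
    linarith
  refine ⟨?_, e, ?_⟩
  · rw [ht, show tan r0 / (2 * tan r0) = 1 / 2 by field_simp, ← cos_pi_div_three, arccos_cos (by linarith) (by linarith)]
  · intro r hr h
    by_contra hlt
    push Not at hlt
    have key : ∀ r, 2 * (sin r * cos (w - r)) = sin w - sin (w - r - r) := by
      intro r
      have e1 : sin w = sin r * cos (w - r) + cos r * sin (w - r) := by rw [← sin_add]; ring_nf
      rw [sin_sub (w - r) r]; linarith
    have : sin (w - r0 - r0) < sin (w - r - r) := sin_lt_sin_of_lt_of_le_pi_div_two (by linarith) (by linarith) (by linarith)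
    linarith [key r, key r0]

lemma FH_nonneg {r φ : ℝ} (hr0 : 0 < r) (hr1 : r < π / 2) (hφ0 : 0 < φ) (hφ1 : φ < π / 2) : 0 ≤ FH r φ := by
  have hpi := pi_pos
  have hcr : 0 < cos r := cos_pos_of_mem_Ioo ⟨by linarith, by linarith⟩
  have h1 := cos_le_one r
  unfold FH
  rw [sub_nonneg]
  rw [arcsin_le_iff_le_sin' ⟨by nlinarith, by nlinarith⟩]
  have := strictConcaveOn_sin_Icc.concaveOn.2 (show (0 : ℝ) ∈ Icc 0 π from ⟨le_rfl, hpi.le⟩) (show φ ∈ Icc 0 π from ⟨hφ0.le, by linarith⟩)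
    (sub_nonneg.2 h1) hcr.le (by ring)
  simp only [smul_eq_mul, sin_zero, mul_zero, zero_add] at this
  rw [mul_comm φ]; linarith
end PartF3

section PartF4
open Filter Topology Metric Set

lemma lower_final {c : ℝ} (hc : AreaConst c) {K : Set (E 2)} (hK : IsConvexBody K) {w : ℝ} (hw : width K = w) (hw0 : 0 < w) (hw1 : w ≤ π / 2)
    {r0 : ℝ} (hr0 : 0 < r0) (hrw : r0 < w / 2) (ht : tan (w - r0) = 2 * tan r0) :
    c * FF w r0 ≤ area K ∧ (area K = c * FF w r0 → ∃ p u l y, Cfg K w r0 p u l y) := by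
  have hmono := FF_mono hr0 hrw hw1 ht
  obtain ⟨-, -, hge⟩ := r0_facts hr0 hrw hw1 ht
  rcases exists_cfg hK hw hw0 hw1 with ⟨p, hp, hball⟩ | ⟨r, p, u, l, y, h⟩
  · have h1 := area_ball hc hK.1.1 (by linarith) (by linarith [pi_pos]) hp hball
    rw [← FF_half hw0 hw1] at h1
    have h2 := hmono ⟨le_rfl, hrw.le⟩ ⟨hrw.le, le_rfl⟩ hrw
    have h3 := mul_lt_mul_of_pos_left h2 hc.1
    exact ⟨by linarith, fun h => by linarith⟩
  · have h1 : c * FF w r ≤ area K := h.area_lower hK.1 hc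
    have hr := hge r h.hr0 h.sin_ineq
    rcases hr.eq_or_lt with rfl | hr
    · exact ⟨h1, fun _ => ⟨p, u, l, y, h⟩⟩
    · have h2 := hmono ⟨le_rfl, hrw.le⟩ ⟨hr.le, h.hrw.le⟩ hr
      have h3 := mul_lt_mul_of_pos_left h2 hc.1
      exact ⟨by linarith, fun h => by linarith⟩

lemma Cfg.rigid {K : Set (E 2)} {w r : ℝ} {p : E 2} {u : Fin 3 → E 2} {l : Fin 3 → ℝ} {y : Fin 3 → E 2}
    (h : Cfg K w r p u l y) (hK : SConvex K) (hs : sin w = 3 * sin r * cos (w - r)) :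
    (∀ i j, i ≠ j → ⟪u i, u j⟫ = (3 * sin r ^ 2 - 1) / 2) ∧ K = {x ∈ unitSphere 2 | ∀ i, ⟪x, u i⟫ ≤ 0} := by
  have hsr := h.sin_r
  have hsw := h.sin_w
  have hcR := h.cos_R
  have hsum : (l 0 + l 1 + l 2) * sin w = 3 * cos (w - r) := by
    have := h.lsum
    rw [Fin.sum_univ_three] at this
    have h2 : ((l 0 + l 1 + l 2) * sin w - 3 * cos (w - r)) * sin r = 0 := by
      linear_combination sin w * this + hs
    rcases mul_eq_zero.1 h2 with h3 | h3
    · linarith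
    · exact absurd h3 hsr.ne'
  have hl : ∀ i, l i * sin w = cos (w - r) := by
    have a := fun i => (h.py_lower i).trans (h.py i)
    intro i
    have a0 := a 0
    have a1 := a 1
    have a2 := a 2
    fin_cases i <;> simp <;> linarith
  have hpy : ∀ i, ⟪p, y i⟫ = l i * sin w := fun i => le_antisymm ((h.py i).trans (hl i).ge) (h.py_lower i)
  have hl3 : ∀ i, l i * (3 * sin r) = 1 := by
    intro i
    have h1 := hl i
    rw [hs] at h1
    have : (l i * (3 * sin r) - 1) * cos (w - r) = 0 := by linear_combination h1
    rcases mul_eq_zero.1 this with h3 | h3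
    · linarith
    · exact absurd h3 hcR.ne'
  have hyu : ∀ i j, ⟪y i, u j⟫ = if i = j then -sin w else 0 := by
    intro i
    have e := h.py_eq i
    rw [hpy i] at e
    have hle : ∀ j, (if i = j then l i * sin w else 0) ≤ l j * (-⟪y i, u j⟫) := by
      intro j
      split_ifs with hij
      · subst hij; exact mul_le_mul_of_nonneg_left (h.yu i) (h.lpos i).le
      · exact mul_nonneg (h.lpos j).le (by linarith [h.yj i j])
    have heq : ∑ j, (if i = j then l i * sin w else 0) = ∑ j, l j * (-⟪y i, u j⟫) := by
      rw [← e]; simp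
    have hall := (Finset.sum_eq_sum_iff_of_le (fun j _ => hle j)).1 heq
    intro j
    have := hall j (Finset.mem_univ j)
    have hlj := (h.lpos j).ne'
    split_ifs at this ⊢ with hij
    · subst hij
      have := mul_left_cancel₀ hlj this
      linarith
    · have := (mul_eq_zero.1 this.symm).resolve_left hlj
      linarith
  constructor
  · have hu3 : u 0 + u 1 + u 2 = -((3 * sin r) • p) := by
      have := h.leq
      rw [Fin.sum_univ_three] at this
      have h1 : (3 * sin r) • (l 0 • u 0 + l 1 • u 1 + l 2 • u 2) = u 0 + u 1 + u 2 := by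
        simp only [smul_add, smul_smul]
        rw [mul_comm _ (l 0), mul_comm _ (l 1), mul_comm _ (l 2), hl3, hl3, hl3]; simp
      rw [← h1, this, smul_neg]
    have hrow : ∀ i, ⟪u 0, u i⟫ + ⟪u 1, u i⟫ + ⟪u 2, u i⟫ = 3 * sin r ^ 2 := by
      intro i
      rw [← inner_add_left, ← inner_add_left, hu3, inner_neg_left, real_inner_smul_left, h.pu]; ring
    have r0 := hrow 0
    have r1 := hrow 1
    have r2 := hrow 2
    rw [h.uu] at r0 r1 r2
    have c1 := real_inner_comm (u 0) (u 1)
    have c2 := real_inner_comm (u 0) (u 2)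
    have c3 := real_inner_comm (u 1) (u 2)
    intro i j hij
    fin_cases i <;> fin_cases j <;> first | exact absurd rfl hij | (simp; linarith)
  · ext x
    constructor
    · intro hx
      exact ⟨hK.1 hx, fun i => (h.upol i).2 x hx⟩
    · rintro ⟨hx, hxu⟩
      apply Kcone_unit hK.1 _ hx
      have hcard : Fintype.card (Fin 3) = Module.finrank ℝ (E 2) := by simp
      let b := basisOfLinearIndependentOfCardEqFinrank h.lin hcard
      have hb : ⇑b = u := coe_basisOfLinearIndependentOfCardEqFinrank h.lin hcard
      have hxe : x = ∑ i, (-⟪x, u i⟫ / sin w) • y i := by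
        apply InnerProductSpace.ext_inner_right_basis b
        intro j
        rw [hb, sum_inner]
        simp only [real_inner_smul_left, hyu]
        simp
        field_simp
      rw [hxe, Fin.sum_univ_three]
      have hk : ∀ i, (-⟪x, u i⟫ / sin w) • y i ∈ Kcone K := fun i =>
        Kcone_smul (Kcone_of_mem (h.yK i)) (div_nonneg (by linarith [hxu i]) hsw.le)
      exact Kcone_add hK (Kcone_add hK (hk 0) (hk 1)) (hk 2)

/-- Two triangles given by normals with the same Gram matrix are congruent. -/
lemma congr_of_gram {u v : Fin 3 → E 2} (hu : LinearIndependent ℝ u) (hv : LinearIndependent ℝ v) (h : ∀ i j, ⟪u i, u j⟫ = ⟪v i, v j⟫) :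
    Congruent {x ∈ unitSphere 2 | ∀ i, ⟪x, u i⟫ ≤ 0} {x ∈ unitSphere 2 | ∀ i, ⟪x, v i⟫ ≤ 0} := by
  have hcard : Fintype.card (Fin 3) = Module.finrank ℝ (E 2) := by simp
  let a := basisOfLinearIndependentOfCardEqFinrank hu hcard
  have ha : ⇑a = u := coe_basisOfLinearIndependentOfCardEqFinrank hu hcard
  let b := basisOfLinearIndependentOfCardEqFinrank hv hcard
  have hb : ⇑b = v := coe_basisOfLinearIndependentOfCardEqFinrank hv hcard
  let f : E 2 ≃ₗ[ℝ] E 2 := a.equiv b (Equiv.refl _)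
  have hf : ∀ i, f (u i) = v i := by
    intro i
    have := a.equiv_apply i b (Equiv.refl _)
    rw [ha, hb] at this
    exact this
  have hin : ∀ x y, ⟪f x, f y⟫ = ⟪x, y⟫ := by
    intro x y
    rw [← a.sum_repr x, ← a.sum_repr y]
    simp only [map_sum, map_smul, ha, hf, sum_inner, inner_sum, real_inner_smul_left, inner_smul_right, h]
  refine ⟨f.isometryOfInner hin, ?_⟩
  have hfi : ∀ x i, ⟪f x, v i⟫ = ⟪x, u i⟫ := fun x i => by rw [← hf i, hin]
  ext z
  constructor
  · rintro ⟨x, ⟨hx, hxu⟩, rfl⟩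
    refine ⟨us_of_inner ?_, fun i => ?_⟩
    · show ⟪f x, f x⟫ = 1
      rw [hin]; exact us_inner hx
    · show ⟪f x, v i⟫ ≤ 0
      rw [hfi]; exact hxu i
  · rintro ⟨hz, hzu⟩
    refine ⟨f.symm z, ⟨us_of_inner ?_, fun i => ?_⟩, f.apply_symm_apply z⟩
    · rw [← hin, f.apply_symm_apply]; exact us_inner hz
    · rw [← hfi, f.apply_symm_apply]; exact hzu i

lemma area_congr {A B : Set (E 2)} (h : Congruent A B) : area A = area B := by
  obtain ⟨f, rfl⟩ := h
  unfold area
  have := f.toIsometryEquiv.hausdorffMeasure_image 2 A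
  rw [← this]; rfl
end PartF4

section PartT1
open Filter Topology Metric Set

/-- A regular triangle with vertices `v`, unit outer normals `n`, cosine of side `b` and sine of height `d`. -/
structure Tri (v n : Fin 3 → E 2) (b d : ℝ) : Prop where
  lo : -1 / 2 < b
  hi : b < 1
  vv : ∀ i j, ⟪v i, v j⟫ = if i = j then 1 else b
  lin : LinearIndependent ℝ v
  dpos : 0 < d
  dd : d ^ 2 * (1 + b) = (1 + 2 * b) * (1 - b)
  vn : ∀ i j, ⟪v i, n j⟫ = if i = j then -d else 0
  nn : ∀ i j, ⟪n i, n j⟫ = if i = j then 1 else -(b / (1 + b))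

lemma exists_tri {v : Fin 3 → E 2} (hv : ∀ i, v i ∈ unitSphere 2) (lin : LinearIndependent ℝ v)
    (h1 : gdist (v 0) (v 1) = gdist (v 1) (v 2)) (h2 : gdist (v 1) (v 2) = gdist (v 0) (v 2)) :
    ∃ n b d, Tri v n b d := by
  have inj : ∀ i j k l, gdist (v i) (v j) = gdist (v k) (v l) → ⟪v i, v j⟫ = ⟪v k, v l⟫ := by
    intro i j k l h
    exact arccos_injOn ⟨us_le_inner (hv i) (hv j), us_inner_le (hv i) (hv j)⟩ ⟨us_le_inner (hv k) (hv l), us_inner_le (hv k) (hv l)⟩ h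
  obtain ⟨b, hb⟩ : ∃ b, b = ⟪v 0, v 1⟫ := ⟨_, rfl⟩
  have e12 : ⟪v 1, v 2⟫ = b := by rw [hb]; exact (inj _ _ _ _ h1).symm
  have e02 : ⟪v 0, v 2⟫ = b := by rw [← e12]; exact (inj _ _ _ _ h2).symm
  have e01 : ⟪v 0, v 1⟫ = b := hb.symm
  have e10 : ⟪v 1, v 0⟫ = b := by rw [real_inner_comm]; exact e01
  have e20 : ⟪v 2, v 0⟫ = b := by rw [real_inner_comm]; exact e02
  have e21 : ⟪v 2, v 1⟫ = b := by rw [real_inner_comm]; exact e12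
  have vv : ∀ i j, ⟪v i, v j⟫ = if i = j then 1 else b := by
    intro i j
    split_ifs with h
    · rw [h]; exact us_inner (hv j)
    · fin_cases i <;> fin_cases j <;> first | exact absurd rfl h | assumption
  have hi : b < 1 := by
    by_contra hcon
    push Not at hcon
    rw [← e01] at hcon
    have := us_eq (hv 0) (hv 1) hcon
    exact absurd (lin.injective this) (by decide)
  have vs : ∀ i, ⟪v i, ∑ j, v j⟫ = 1 + 2 * b := by
    intro i
    rw [inner_sum]
    simp only [vv]
    rw [Fin.sum_univ_three]
    fin_cases i <;> simp <;> ring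
  have ss : ⟪∑ j, v j, ∑ j, v j⟫ = 3 * (1 + 2 * b) := by
    rw [sum_inner]; simp only [vs]; simp; ring
  have hs0 : (∑ j, v j) ≠ 0 := by
    intro h0
    have := Fintype.linearIndependent_iff.1 lin (fun _ => 1) (by simpa using h0) 0
    norm_num at this
  have lo : -1 / 2 < b := by
    have : 0 < ⟪∑ j, v j, ∑ j, v j⟫ := real_inner_self_pos.2 hs0
    linarith
  have hP : 0 < (1 + b) * (1 - b) * (1 + 2 * b) := mul_pos (mul_pos (by linarith) (by linarith)) (by linarith)
  set M := √((1 + b) * (1 - b) * (1 + 2 * b)) with hM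
  have hM0 : 0 < M := sqrt_pos.2 hP
  have hM2 : M ^ 2 = (1 + b) * (1 - b) * (1 + 2 * b) := sq_sqrt hP.le
  set N : Fin 3 → E 2 := fun i => b • (∑ j, v j) - (1 + 2 * b) • v i with hN
  have vN : ∀ i j, ⟪v i, N j⟫ = if i = j then -((1 + 2 * b) * (1 - b)) else 0 := by
    intro i j
    rw [hN]
    simp only
    rw [inner_sub_right, inner_smul_right, inner_smul_right, vs, vv]
    split_ifs <;> ring
  have sN : ∀ j, ⟪∑ i, v i, N j⟫ = -((1 + 2 * b) * (1 - b)) := by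
    intro j; rw [sum_inner]; simp [vN]
  have NN : ∀ i j, ⟪N i, N j⟫ = if i = j then (1 + b) * (1 - b) * (1 + 2 * b) else -b * ((1 + 2 * b) * (1 - b)) := by
    intro i j
    have : N i = b • (∑ j, v j) - (1 + 2 * b) • v i := rfl
    rw [this, inner_sub_left, real_inner_smul_left, real_inner_smul_left, sN, vN]
    split_ifs <;> ring
  have h1b : 0 < 1 + b := by linarith
  refine ⟨fun i => M⁻¹ • N i, b, M⁻¹ * ((1 + 2 * b) * (1 - b)), lo, hi, vv, lin, ?_, ?_, ?_, ?_⟩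
  · exact mul_pos (inv_pos.2 hM0) (mul_pos (by linarith) (by linarith))
  · rw [mul_pow, inv_pow, hM2]
    have : 1 - b ≠ 0 := by linarith
    have : 1 + 2 * b ≠ 0 := by linarith
    field_simp
  · intro i j
    rw [inner_smul_right, vN]; split_ifs <;> ring
  · intro i j
    rw [real_inner_smul_left, inner_smul_right, NN, ← mul_assoc, ← mul_inv, ← sq, hM2]
    have : 1 - b ≠ 0 := by linarith
    have : 1 + 2 * b ≠ 0 := by linarith
    have h12 : 1 + b * 2 ≠ 0 := by linarith
    split_ifs
    · field_simp
    · field_simp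

/-- The triangle as an intersection of three hemispheres. -/
def HT (n : Fin 3 → E 2) : Set (E 2) := {x ∈ unitSphere 2 | ∀ i, ⟪x, n i⟫ ≤ 0}

namespace Tri
variable {v n : Fin 3 → E 2} {b d : ℝ}

lemma vS (h : Tri v n b d) (i : Fin 3) : v i ∈ unitSphere 2 := us_of_inner (by rw [h.vv]; simp)
lemma nS (h : Tri v n b d) (i : Fin 3) : n i ∈ unitSphere 2 := us_of_inner (by rw [h.nn]; simp)

lemma vs (h : Tri v n b d) (i : Fin 3) : ⟪v i, ∑ j, v j⟫ = 1 + 2 * b := by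
  rw [inner_sum]
  simp only [h.vv]
  rw [Fin.sum_univ_three]
  fin_cases i <;> simp <;> ring

lemma ss (h : Tri v n b d) : ⟪∑ j, v j, ∑ j, v j⟫ = 3 * (1 + 2 * b) := by
  rw [sum_inner]; simp only [h.vs]; simp; ring

lemma sn (h : Tri v n b d) (j : Fin 3) : ⟪∑ i, v i, n j⟫ = -d := by
  rw [sum_inner]; simp [h.vn]

/-- expansion in vertices -/
lemma expand_v (h : Tri v n b d) (x : E 2) : x = ∑ i, (-⟪x, n i⟫ / d) • v i := by
  have hcard : Fintype.card (Fin 3) = Module.finrank ℝ (E 2) := by simp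
  let B := basisOfLinearIndependentOfCardEqFinrank h.lin hcard
  have hB : ⇑B = v := coe_basisOfLinearIndependentOfCardEqFinrank h.lin hcard
  have hs := B.sum_repr x
  rw [hB] at hs
  have : ∀ j, ⟪x, n j⟫ = -(d * B.repr x j) := by
    intro j
    conv_lhs => rw [← hs]
    rw [sum_inner]
    simp only [real_inner_smul_left, h.vn]
    simp; ring
  conv_lhs => rw [← hs]
  apply Finset.sum_congr rfl
  intro i _
  rw [this, neg_neg, mul_div_cancel_left₀ _ h.dpos.ne']

lemma lin_n (h : Tri v n b d) : LinearIndependent ℝ n := by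
  rw [Fintype.linearIndependent_iff]
  intro g hg i
  have : ⟪v i, ∑ i, g i • n i⟫ = 0 := by rw [hg, inner_zero_right]
  rw [inner_sum] at this
  simp only [inner_smul_right, h.vn] at this
  simp at this
  exact this.resolve_right h.dpos.ne'

lemma expand_n (h : Tri v n b d) (x : E 2) : x = ∑ i, (-⟪v i, x⟫ / d) • n i := by
  have hcard : Fintype.card (Fin 3) = Module.finrank ℝ (E 2) := by simp
  let B := basisOfLinearIndependentOfCardEqFinrank h.lin_n hcard
  have hB : ⇑B = n := coe_basisOfLinearIndependentOfCardEqFinrank h.lin_n hcard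
  have hs := B.sum_repr x
  rw [hB] at hs
  have : ∀ j, ⟪v j, x⟫ = -(d * B.repr x j) := by
    intro j
    conv_lhs => rw [← hs]
    rw [inner_sum]
    simp only [inner_smul_right, h.vn]
    simp; ring
  conv_lhs => rw [← hs]
  apply Finset.sum_congr rfl
  intro i _
  rw [this, neg_neg, mul_div_cancel_left₀ _ h.dpos.ne']

lemma sx_pos (h : Tri v n b d) {x : E 2} (hx : x ∈ HT n) : 0 < ⟪∑ i, v i, x⟫ := by
  have e := h.expand_v x
  have hg : ∀ i, 0 ≤ -⟪x, n i⟫ / d := fun i => div_nonneg (by linarith [hx.2 i]) h.dpos.le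
  have e2 : ⟪∑ i, v i, x⟫ = (∑ i, -⟪x, n i⟫ / d) * (1 + 2 * b) := by
    conv_lhs => rw [e, real_inner_comm]
    rw [sum_inner, Finset.sum_mul]
    simp only [real_inner_smul_left, h.vs]
  rw [e2]
  apply mul_pos _ (by linarith [h.lo])
  apply lt_of_le_of_ne (Finset.sum_nonneg fun i _ => hg i)
  intro h0
  have h1 := (Finset.sum_eq_zero_iff_of_nonneg (fun i _ => hg i)).1 h0.symm
  have : x = 0 := by
    rw [e]; apply Finset.sum_eq_zero; intro i hi; rw [h1 i hi, zero_smul]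
  have hx1 := us_inner hx.1
  rw [this, inner_zero_left] at hx1
  norm_num at hx1

lemma s_ne (h : Tri v n b d) : (∑ i, v i) ≠ 0 := by
  intro h0
  have := h.ss
  rw [h0, inner_zero_left] at this
  linarith [h.lo]

lemma HT_sconvex (h : Tri v n b d) : SConvex (HT n) := by
  refine ⟨fun x hx => hx.1, ⟨_, us_normalize h.s_ne, fun x hx => ?_⟩, ?_⟩
  · rw [real_inner_smul_left]
    exact mul_pos (inv_pos.2 (norm_pos_iff.2 h.s_ne)) (h.sx_pos hx)
  · intro x hx y hy z hz
    have hxy : -1 < ⟪x, y⟫ := by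
      by_contra hcon
      push Not at hcon
      have : x = -y := us_eq hx.1 (by rw [us_norm, norm_neg]; exact us_norm.1 hy.1) (by rw [inner_neg_right]; linarith)
      have h1 := h.sx_pos hx
      rw [this, inner_neg_right] at h1
      linarith [h.sx_pos hy]
    obtain ⟨s, t, hs, ht, rfl⟩ := seg_cone hx.1 hy.1 hxy hz
    refine ⟨hz.1, fun i => ?_⟩
    rw [inner_add_left, real_inner_smul_left, real_inner_smul_left]
    nlinarith [hx.2 i, hy.2 i]

lemma v_mem (h : Tri v n b d) (i : Fin 3) : v i ∈ HT n := by
  refine ⟨h.vS i, fun j => ?_⟩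
  rw [h.vn]; split_ifs
  · linarith [h.dpos]
  · exact le_rfl

lemma sconv_eq (h : Tri v n b d) : sconv {v 0, v 1, v 2} = HT n := by
  apply subset_antisymm
  · apply sInter_subset_of_mem
    refine ⟨h.HT_sconvex, ?_⟩
    rintro x (rfl | rfl | rfl)
    · exact h.v_mem 0
    · exact h.v_mem 1
    · exact h.v_mem 2
  · intro x hx
    rintro C ⟨hC, hvC⟩
    apply Kcone_unit hC.1 _ hx.1
    rw [h.expand_v x, Fin.sum_univ_three]
    have hg : ∀ i, 0 ≤ -⟪x, n i⟫ / d := fun i => div_nonneg (by linarith [hx.2 i]) h.dpos.le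
    exact Kcone_add hC (Kcone_add hC (Kcone_smul (Kcone_of_mem (hvC (by simp))) (hg 0)) (Kcone_smul (Kcone_of_mem (hvC (by simp))) (hg 1)))
      (Kcone_smul (Kcone_of_mem (hvC (by simp))) (hg 2))

lemma HT_body (h : Tri v n b d) : IsConvexBody (HT n) := by
  refine ⟨h.HT_sconvex, ?_, ?_⟩
  · have e : HT n = sphere (0 : E 2) 1 ∩ ⋂ i, {x | ⟪x, n i⟫ ≤ 0} := by
      ext u; simp [HT, unitSphere]
    rw [e]
    apply (isCompact_sphere (0 : E 2) 1).inter_right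
    exact isClosed_iInter fun i => isClosed_le (by fun_prop) continuous_const
  · set s := ∑ i, v i with hs
    have hns : 0 < ‖s‖ := norm_pos_iff.2 h.s_ne
    set e := ‖s‖⁻¹ * d with he
    have he0 : 0 < e := mul_pos (inv_pos.2 hns) h.dpos
    have hxn : ∀ i, ⟪‖s‖⁻¹ • s, n i⟫ = -e := by
      intro i; rw [real_inner_smul_left, hs, h.sn]; ring
    have hxS := us_normalize h.s_ne
    rw [← hs] at hxS
    refine ⟨‖s‖⁻¹ • s, ⟨hxS, fun i => by rw [hxn]; linarith⟩, arccos (1 - e ^ 2 / 2), arccos_pos.2 (by nlinarith), ?_⟩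
    intro y hy hyd
    refine ⟨hy, fun i => ?_⟩
    set x := ‖s‖⁻¹ • s
    have h1 : 1 - e ^ 2 / 2 < ⟪x, y⟫ := by
      by_contra hcon
      push Not at hcon
      exact absurd (arccos_le_arccos hcon) (not_le.2 hyd)
    have h2 : ‖y - x‖ ^ 2 ≤ e ^ 2 := by
      rw [norm_sub_sq_real, us_norm.1 hy, us_norm.1 hxS, real_inner_comm]; linarith
    have h3 : ‖y - x‖ ≤ e := (pow_le_pow_iff_left₀ (norm_nonneg _) he0.le two_ne_zero).1 h2
    have h4 := real_inner_le_norm (y - x) (n i)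
    rw [us_norm.1 (h.nS i), mul_one, inner_sub_left, hxn] at h4
    linarith

lemma mem_polar (h : Tri v n b d) {u : E 2} (hu : u ∈ polar (HT n)) (i : Fin 3) : 0 ≤ -⟪v i, u⟫ / d :=
  div_nonneg (by linarith [hu.2 _ (h.v_mem i)]) h.dpos.le

lemma n_polar (h : Tri v n b d) (i : Fin 3) : n i ∈ polar (HT n) := ⟨h.nS i, fun _ ha => ha.2 i⟩

end Tri
end PartT1

section PartT2
open Filter Topology Metric Set

namespace Tri
variable {v n : Fin 3 → E 2} {b d : ℝ}

lemma perm (h : Tri v n b d) (σ : Equiv.Perm (Fin 3)) : Tri (v ∘ σ) (n ∘ σ) b d where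
  lo := h.lo
  hi := h.hi
  vv i j := by simp [h.vv]
  lin := h.lin.comp _ σ.injective
  dpos := h.dpos
  dd := h.dd
  vn i j := by simp [h.vn]
  nn i j := by simp [h.nn]

lemma HT_perm (n : Fin 3 → E 2) (σ : Equiv.Perm (Fin 3)) : HT (n ∘ σ) = HT n := by
  ext x
  constructor
  · rintro ⟨h1, h2⟩
    refine ⟨h1, fun i => ?_⟩
    have := h2 (σ.symm i)
    simpa using this
  · rintro ⟨h1, h2⟩
    exact ⟨h1, fun i => h2 (σ i)⟩

lemma un (h : Tri v n b d) (u : E 2) (i : Fin 3) :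
    ⟪u, n i⟫ = ∑ j, (-⟪v j, u⟫ / d) * (if j = i then 1 else -(b / (1 + b))) := by
  conv_lhs => rw [h.expand_n u]
  rw [sum_inner]
  simp only [real_inner_smul_left, h.nn]

lemma uv (h : Tri v n b d) (u x : E 2) :
    ⟪u, x⟫ = ∑ j, (-⟪v j, u⟫ / d) * ⟪x, n j⟫ := by
  conv_lhs => rw [h.expand_n u]
  rw [sum_inner]
  apply Finset.sum_congr rfl
  intro j _
  rw [real_inner_smul_left, real_inner_comm x (n j)]

lemma d_le (h : Tri v n b d) : d ≤ 1 := by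
  have h1 := h.dd
  have h2 := h.lo
  have : d ^ 2 ≤ 1 := by
    by_contra hc
    push Not at hc
    nlinarith [sq_nonneg b]
  nlinarith [h.dpos]

set_option maxHeartbeats 1000000 in
lemma far_sorted (h : Tri v n b d) (hb : 0 ≤ b) {u : E 2} (hu : u ∈ polar (HT n))
    (h01 : -⟪v 0, u⟫ / d ≤ -⟪v 1, u⟫ / d) (h12 : -⟪v 1, u⟫ / d ≤ -⟪v 2, u⟫ / d) :
    ∃ y ∈ HT n, d ≤ -⟪y, u⟫ := by
  have hb1 := h.hi
  have hd := h.dpos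
  obtain ⟨A, hA⟩ : ∃ A : Fin 3 → ℝ, A = fun i => -⟪v i, u⟫ / d := ⟨_, rfl⟩
  have hAi : ∀ i, -⟪v i, u⟫ / d = A i := fun i => by rw [hA]
  have hvu : ∀ i, ⟪v i, u⟫ = -(d * A i) := by intro i; rw [hA]; field_simp
  have hA0 : ∀ i, 0 ≤ A i := fun i => by rw [hA]; exact h.mem_polar hu i
  rw [hAi, hAi] at h01 h12
  obtain ⟨k, hk⟩ : ∃ k, k = b / (1 + b) := ⟨_, rfl⟩
  have hk' : k * (1 + b) = b := by rw [hk]; field_simp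
  have hk0 : 0 ≤ k := by rw [hk]; positivity
  have n0 : ⟪u, n 0⟫ = A 0 - k * (A 1 + A 2) := by
    rw [h.un, Fin.sum_univ_three]; simp only [hAi]; simp [← hk]; ring
  have n1 : ⟪u, n 1⟫ = A 1 - k * (A 0 + A 2) := by
    rw [h.un, Fin.sum_univ_three]; simp only [hAi]; simp [← hk]; ring
  have n2 : ⟪u, n 2⟫ = A 2 - k * (A 0 + A 1) := by
    rw [h.un, Fin.sum_univ_three]; simp only [hAi]; simp [← hk]; ring
  have hQ : A 0 ^ 2 + A 1 ^ 2 + A 2 ^ 2 - 2 * k * (A 0 * A 1 + A 0 * A 2 + A 1 * A 2) = 1 := by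
    have := h.uv u u
    rw [us_inner hu.1, Fin.sum_univ_three] at this
    simp only [hAi, n0, n1, n2] at this
    linarith
  have a0 := hA0 0
  have a1 := hA0 1
  have a2 := hA0 2
  by_cases c1 : k * (A 1 + A 2) ≤ A 0
  · refine ⟨-u, ⟨by rw [us_norm, norm_neg]; exact us_norm.1 hu.1, fun i => ?_⟩, ?_⟩
    · rw [inner_neg_left]
      fin_cases i
      · simp only [Fin.zero_eta, n0]; linarith
      · simp only [Fin.mk_one, n1]; nlinarith
      · simp only [Fin.reduceFinMk, n2]; nlinarith
    · rw [inner_neg_left, us_inner hu.1]; linarith [h.d_le]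
  push Not at c1
  by_cases c2 : A 1 ≤ b * A 2
  · refine ⟨v 2, h.v_mem 2, ?_⟩
    rw [hvu]
    have hkb : b ≤ 2 * k := by nlinarith
    have e1 : A 1 ≤ 2 * k * A 2 := by nlinarith
    have : 1 ≤ A 2 ^ 2 := by nlinarith [mul_nonneg a0 (sub_nonneg.2 c1.le), mul_nonneg a1 (sub_nonneg.2 e1), mul_nonneg (mul_nonneg hk0 a0) a1, mul_nonneg (mul_nonneg hk0 a0) a2]
    have : 1 ≤ A 2 := by nlinarith
    nlinarith
  push Not at c2
  obtain ⟨q, hq⟩ : ∃ q, q = A 2 ^ 2 + A 1 ^ 2 - 2 * b * A 2 * A 1 := ⟨_, rfl⟩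
  have hbb : 0 < 1 - b ^ 2 := by nlinarith
  have hq1 : 1 - b ^ 2 ≤ q := by
    have e : q - (1 - b ^ 2) = b ^ 2 * (A 2 - A 1) ^ 2 - (1 - b ^ 2) * A 0 * (A 0 - 2 * k * (A 1 + A 2)) := by
      rw [hq]
      have : (1 - b ^ 2) * (A 0 ^ 2 + A 1 ^ 2 + A 2 ^ 2 - 2 * k * (A 0 * A 1 + A 0 * A 2 + A 1 * A 2)) = 1 - b ^ 2 := by rw [hQ]; ring
      have e2 : (1 - b ^ 2) * k = b * (1 - b) := by linear_combination (1 - b) * hk'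
      linear_combination this + 2 * A 1 * A 2 * e2
    have : 0 ≤ (1 - b ^ 2) * A 0 * (2 * k * (A 1 + A 2) - A 0) := by
      apply mul_nonneg (mul_nonneg hbb.le a0)
      nlinarith
    nlinarith [mul_nonneg (sq_nonneg b) (sq_nonneg (A 2 - A 1))]
  have hq0 : 0 < q := by linarith
  obtain ⟨D, hD⟩ : ∃ D, D = √((1 - b ^ 2) * q) := ⟨_, rfl⟩
  have hD0 : 0 < D := by rw [hD]; exact sqrt_pos.2 (mul_pos hbb hq0)
  have hD2 : D ^ 2 = (1 - b ^ 2) * q := by rw [hD]; exact sq_sqrt (mul_pos hbb hq0).le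
  have hDq : D ≤ q := by nlinarith
  obtain ⟨x1, hx1⟩ : ∃ x1, x1 = (A 2 - b * A 1) / D := ⟨_, rfl⟩
  obtain ⟨x2, hx2⟩ : ∃ x2, x2 = (A 1 - b * A 2) / D := ⟨_, rfl⟩
  have p1 : 0 ≤ x1 := by rw [hx1]; exact div_nonneg (by nlinarith) hD0.le
  have p2 : 0 ≤ x2 := by rw [hx2]; exact div_nonneg (by linarith) hD0.le
  refine ⟨x1 • v 2 + x2 • v 1, ⟨us_of_inner ?_, fun i => ?_⟩, ?_⟩
  · simp only [inner_add_left, inner_add_right, real_inner_smul_left, inner_smul_right, h.vv]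
    simp
    rw [hx1, hx2]
    field_simp
    rw [hD2, hq]; ring
  · rw [inner_add_left, real_inner_smul_left, real_inner_smul_left, h.vn, h.vn]
    have := mul_nonneg p1 hd.le
    have := mul_nonneg p2 hd.le
    split_ifs <;> linarith
  · rw [inner_add_left, real_inner_smul_left, real_inner_smul_left, hvu, hvu]
    have : x1 * A 2 + x2 * A 1 = q / D := by rw [hx1, hx2, hq]; field_simp; ring
    have h1 : 1 ≤ q / D := by rw [le_div_iff₀ hD0]; linarith
    rw [← this] at h1
    have h2 := mul_le_mul_of_nonneg_left h1 hd.le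
    linarith

lemma far (h : Tri v n b d) (hb : 0 ≤ b) {u : E 2} (hu : u ∈ polar (HT n)) :
    ∃ y ∈ HT n, d ≤ -⟪y, u⟫ := by
  obtain ⟨A, hA⟩ : ∃ A : Fin 3 → ℝ, A = fun i => -⟪v i, u⟫ / d := ⟨_, rfl⟩
  have hm := Tuple.monotone_sort A
  have hp := h.perm (Tuple.sort A)
  rw [← HT_perm n (Tuple.sort A)] at hu ⊢
  have m1 := hm (show (0 : Fin 3) ≤ 1 by decide)
  have m2 := hm (show (1 : Fin 3) ≤ 2 by decide)
  rw [hA] at m1 m2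
  rw [hA] at hp hu ⊢
  exact hp.far_sorted hb hu m1 m2

lemma width_ge {K : Set (E 2)} (hw : 0 < width K) {m : ℝ} (hm : ∀ u ∈ polar K, ∀ v ∈ polar K, m ≤ ⟪u, v⟫) :
    arccos (-m) ≤ width K := by
  unfold width at hw ⊢
  apply le_csInf
  · by_contra hne
    rw [not_nonempty_iff_eq_empty] at hne
    rw [hne, Real.sInf_empty] at hw
    exact lt_irrefl _ hw
  · rintro x ⟨u, v, ⟨hu, hv, h1, h2, hKl, -⟩, rfl⟩
    rw [breadth_eq hu hv h1 h2]
    apply arccos_le_arccos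
    have := hm u ⟨hu, fun a ha => (hKl ha).2.1⟩ v ⟨hv, fun a ha => (hKl ha).2.2⟩
    linarith

lemma polar_sum (h : Tri v n b d) (hb : b ≤ 0) {u : E 2} (hu : u ∈ polar (HT n)) : 1 ≤ ∑ j, -⟪v j, u⟫ / d := by
  have e := h.uv u u
  rw [us_inner hu.1] at e
  rw [e]
  apply Finset.sum_le_sum
  intro i _
  have := us_inner_le hu.1 (h.nS i)
  have h0 := h.mem_polar hu i
  nlinarith

lemma b_nonneg (h : Tri v n b d) (hw0 : 0 < width (HT n)) (hw : width (HT n) ≤ π / 2) : 0 ≤ b := by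
  by_contra hb
  push Not at hb
  have hlo := h.lo
  obtain ⟨k, hk⟩ : ∃ k, k = -(b / (1 + b)) := ⟨_, rfl⟩
  have hk0 : 0 < k := by rw [hk, ← neg_div]; exact div_pos (by linarith) (by linarith)
  have hk1 : k ≤ 1 := by rw [hk, ← neg_div, div_le_one (by linarith)]; linarith
  have key : ∀ u ∈ polar (HT n), ∀ x ∈ polar (HT n), k ≤ ⟪u, x⟫ := by
    intro u hu x hx
    have s1 := h.polar_sum hb.le hu
    have s2 := h.polar_sum hb.le hx
    have e := h.uv u x
    have hxn : ∀ i, k ≤ ⟪x, n i⟫ := by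
      intro i
      rw [h.un x i]
      calc k ≤ (∑ j, -⟪v j, x⟫ / d) * k := by nlinarith
        _ ≤ _ := by
          rw [Finset.sum_mul]
          apply Finset.sum_le_sum
          intro j _
          apply mul_le_mul_of_nonneg_left _ (h.mem_polar hx j)
          split_ifs
          · exact hk1
          · exact hk.le
    rw [e]
    calc k ≤ (∑ j, -⟪v j, u⟫ / d) * k := by nlinarith
      _ ≤ _ := by
        rw [Finset.sum_mul]
        apply Finset.sum_le_sum
        intro j _
        exact mul_le_mul_of_nonneg_left (hxn j) (h.mem_polar hu j)
  have h1 := width_ge hw0 key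
  have h2 : π / 2 < arccos (-k) := by
    rw [← not_le, arccos_le_pi_div_two]; linarith
  linarith

/-- The width of a regular triangle. -/
lemma sin_width (h : Tri v n b d) {w : ℝ} (hTw : width (HT n) = w) (hw0 : 0 < w) (hw : w ≤ π / 2) : sin w = d := by
  have hb := h.b_nonneg (by rw [hTw]; exact hw0) (by rw [hTw]; exact hw)
  have hb1 := h.hi
  have hd := h.dpos
  have hdd := h.dd
  have hd1 := h.d_le
  have hcw : 0 ≤ cos w := cos_nonneg_of_mem_Icc ⟨by linarith, hw⟩
  have hsw : 0 ≤ sin w := sin_nonneg_of_nonneg_of_le_pi hw0.le (by linarith [pi_pos])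
  have hsc := sin_sq_add_cos_sq w
  have hd2 : 0 ≤ 1 - d ^ 2 := by nlinarith
  -- lower bound for the width
  have up : cos w ≤ √(1 - d ^ 2) := by
    have key : ∀ u ∈ polar (HT n), ∀ x ∈ polar (HT n), -√(1 - d ^ 2) ≤ ⟪u, x⟫ := by
      intro u hu x hx
      obtain ⟨y, hy, hyu⟩ := h.far hb hu
      have hyx := hx.2 y hy
      have hnu : -u ∈ unitSphere 2 := by rw [us_norm, norm_neg]; exact us_norm.1 hu.1
      have := inner_le_cs hy.1 hx.1 hnu
      rw [inner_neg_right, inner_neg_right] at this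
      have e1 : √(1 - ⟪y, x⟫ ^ 2) ≤ 1 := by
        rw [sqrt_le_iff]; constructor <;> nlinarith [sq_nonneg ⟪y, x⟫]
      have e2 : √(1 - (-⟪y, u⟫) ^ 2) ≤ √(1 - d ^ 2) := sqrt_le_sqrt (by nlinarith)
      have e3 : √(1 - ⟪y, x⟫ ^ 2) * √(1 - (-⟪y, u⟫) ^ 2) ≤ 1 * √(1 - d ^ 2) :=
        mul_le_mul e1 e2 (sqrt_nonneg _) zero_le_one
      have e4 : ⟪y, x⟫ * -⟪y, u⟫ ≤ 0 := by nlinarith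
      rw [real_inner_comm] at this
      linarith
    have h1 := width_ge (by rw [hTw]; exact hw0) key
    rw [neg_neg, hTw] at h1
    have h2 := cos_le_cos_of_nonneg_of_le_pi (arccos_nonneg _) (by linarith [pi_pos]) h1
    rwa [cos_arccos (by linarith [sqrt_nonneg (1 - d ^ 2)]) (by rw [sqrt_le_iff]; constructor <;> nlinarith [sq_nonneg d])] at h2
  have lo : √(1 - d ^ 2) ≤ cos w := by
    obtain ⟨k, hk⟩ : ∃ k, k = b / (1 + b) := ⟨_, rfl⟩
    have hk' : k * (1 + b) = b := by rw [hk]; field_simp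
    have e1 : ⟪n 0, n 1 + n 2⟫ = -(2 * k) := by
      rw [inner_add_right, h.nn, h.nn]; simp [← hk]; ring
    have e2 : ⟪n 1 + n 2, n 1 + n 2⟫ = 2 - 2 * k := by
      rw [inner_add_right, inner_add_left, inner_add_left, h.nn, h.nn, h.nn, h.nn]; simp [← hk]; ring
    have hk1 : k < 1 := by rw [hk, div_lt_one (by linarith)]; linarith
    have hne : n 1 + n 2 ≠ 0 := by
      intro h0; rw [h0, inner_zero_left] at e2; linarith
    have hpol := polar_normalize (K := HT n) hne (by
      intro a ha; rw [inner_add_right]; linarith [ha.2 1, ha.2 2])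
    have := W1 h.HT_body hTw hw0 hw (h.n_polar 0) hpol
    rw [inner_smul_right, e1] at this
    have hN : ‖n 1 + n 2‖ ^ 2 = 2 - 2 * k := by rw [← e2, real_inner_self_eq_norm_sq]
    have hN0 : 0 < ‖n 1 + n 2‖ := norm_pos_iff.2 hne
    have h3 : 2 * k ≤ cos w * ‖n 1 + n 2‖ := by
      have : ‖n 1 + n 2‖⁻¹ * (2 * k) ≤ cos w := by linarith
      rw [inv_mul_le_iff₀ hN0] at this
      linarith
    have hk0 : 0 ≤ k := by rw [hk]; positivity
    have h4 : (2 * k) ^ 2 ≤ cos w ^ 2 * (2 - 2 * k) := by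
      rw [← hN, ← mul_pow]; exact pow_le_pow_left₀ (by linarith) h3 2
    apply sqrt_le_iff.2 ⟨hcw, ?_⟩
    have e5 : (1 - d ^ 2) * (2 - 2 * k) = (2 * k) ^ 2 := by
      have hkk : k = b / (1 + b) := hk
      have : d ^ 2 = (1 + 2 * b) * (1 - b) / (1 + b) := by rw [eq_div_iff (by linarith)]; exact hdd
      rw [this, hkk]; field_simp; ring
    have h6 : 0 < 2 - 2 * k := by linarith
    by_contra hcon
    push Not at hcon
    nlinarith
  have hc : cos w = √(1 - d ^ 2) := le_antisymm up lo
  have hc2 : cos w ^ 2 = 1 - d ^ 2 := by rw [hc, sq_sqrt hd2]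
  have : sin w ^ 2 = d ^ 2 := by linarith
  exact (pow_left_inj₀ hsw hd.le two_ne_zero).1 this

end Tri
end PartT2

section PartT3
open Filter Topology Metric Set

namespace Tri
variable {v n : Fin 3 → E 2} {b d : ℝ}

lemma exists_r0 (h : Tri v n b d) (hb : 0 ≤ b) {w : ℝ} (hw0 : 0 < w) (hw : w ≤ π / 2) (hsw : sin w = d) :
    ∃ r, 0 < r ∧ r < w / 2 ∧ tan (w - r) = 2 * tan r ∧ sin r = d / ‖∑ i, v i‖ ∧
      sin r ^ 2 = (1 - b) / (3 * (1 + b)) := by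
  have hb1 := h.hi
  have hd := h.dpos
  have hdd := h.dd
  obtain ⟨N, hN⟩ : ∃ N, N = ‖∑ i, v i‖ := ⟨_, rfl⟩
  have hN0 : 0 < N := by rw [hN]; exact norm_pos_iff.2 h.s_ne
  have hN2 : N ^ 2 = 3 * (1 + 2 * b) := by rw [hN, ← real_inner_self_eq_norm_sq, h.ss]
  rw [← hN]
  have hd2 : d ^ 2 = (1 + 2 * b) * (1 - b) / (1 + b) := by rw [eq_div_iff (by linarith)]; exact hdd
  have s2 : (d / N) ^ 2 = (1 - b) / (3 * (1 + b)) := by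
    rw [div_pow, hN2, hd2]; field_simp
  have s0 : 0 < d / N := div_pos hd hN0
  have s1 : (d / N) ^ 2 < 1 := by
    rw [s2, div_lt_one (by linarith)]; linarith
  have c0 : 0 < N / 3 := by positivity
  have c2 : (N / 3) ^ 2 = (1 + 2 * b) / 3 := by rw [div_pow, hN2]; ring
  have c1 : (N / 3) ^ 2 < 1 := by rw [c2, div_lt_one (by norm_num)]; linarith
  obtain ⟨r, hr⟩ : ∃ r, r = arcsin (d / N) := ⟨_, rfl⟩
  obtain ⟨R, hR⟩ : ∃ R, R = arccos (N / 3) := ⟨_, rfl⟩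
  have hsr : sin r = d / N := by rw [hr]; exact sin_arcsin (by linarith) (by nlinarith)
  have hcR : cos R = N / 3 := by rw [hR]; exact cos_arccos (by linarith) (by nlinarith)
  have hr0 : 0 < r := by rw [hr]; exact arcsin_pos.2 s0
  have hr1 : r < π / 2 := by rw [hr]; exact arcsin_lt_pi_div_two.2 (by nlinarith)
  have hR0 : 0 < R := by rw [hR]; exact arccos_pos.2 (by nlinarith)
  have hR1 : R < π / 2 := by rw [hR]; exact arccos_lt_pi_div_two.2 c0
  have hcr0 : 0 < cos r := cos_pos_of_mem_Ioo ⟨by linarith, hr1⟩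
  have hsR0 : 0 < sin R := sin_pos_of_pos_of_lt_pi hR0 (by linarith)
  have hcr2 : cos r ^ 2 = 2 * (1 + 2 * b) / (3 * (1 + b)) := by
    rw [cos_sq', hsr, s2]; field_simp; ring
  have hsR2 : sin R ^ 2 = 2 * (1 - b) / 3 := by
    rw [sin_sq, hcR, c2]; ring
  have m1 : sin r * cos R = d / 3 := by rw [hsr, hcR]; field_simp
  have m2 : cos r * sin R = 2 * d / 3 := by
    apply (pow_left_inj₀ (by positivity) (by positivity) two_ne_zero).1
    rw [mul_pow, hcr2, hsR2, div_pow, mul_pow, hd2]; field_simp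
  have hle : r + R ≤ π / 2 := by
    by_contra hcon
    push Not at hcon
    have hneg : cos (r + R) < 0 := cos_neg_of_pi_div_two_lt_of_lt hcon (by linarith)
    rw [cos_add] at hneg
    have : sin r * sin R ≤ cos r * cos R := by
      apply (pow_le_pow_iff_left₀ (by rw [hsr]; positivity) (by rw [hcR]; positivity) two_ne_zero).1
      rw [mul_pow, mul_pow, hsr, s2, hsR2, hcr2, hcR, c2, div_mul_div_comm, div_mul_div_comm]
      apply div_le_div_of_nonneg_right _ (by positivity)
      nlinarith
    linarith
  have hsum : r + R = w := by
    apply injOn_sin ⟨by linarith, hle⟩ ⟨by linarith, hw⟩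
    rw [sin_add, m1, m2, hsw]; ring
  have hRw : w - r = R := by linarith
  have hrR : r < R := by
    by_contra hcon
    push Not at hcon
    have h1 : sin R ≤ sin r := sin_le_sin_of_le_of_le_pi_div_two (by linarith) hr1.le hcon
    have h2 : cos r ≤ cos R := cos_le_cos_of_nonneg_of_le_pi hR0.le (by linarith) hcon
    have h3 : cos r * sin R ≤ cos R * sin r := mul_le_mul h2 h1 hsR0.le (by rw [hcR]; exact c0.le)
    linarith
  refine ⟨r, hr0, by linarith, ?_, hsr, by rw [hsr, s2]⟩
  rw [hRw, tan_eq_sin_div_cos, tan_eq_sin_div_cos]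
  have : cos R ≠ 0 := by rw [hcR]; exact c0.ne'
  field_simp
  linarith

lemma cover (h : Tri v n b d) {r : ℝ} (hr0 : 0 < r) (hr1 : r < π / 2)
    (hs : sin r = d / ‖∑ i, v i‖) (hs2 : sin r ^ 2 = (1 - b) / (3 * (1 + b))) :
    ∃ B : Equiv.Perm (Fin 3) → OrthonormalBasis (Fin 3) ℝ (E 2),
      HT n ⊆ gset (B 1) (QD (tan r)) ∪ ⋃ σ, gset (B σ) (QC (tan r) (π / 3)) := by
  have hlo := h.lo
  have h1b : 0 < 1 + b := by linarith
  obtain ⟨N, hN⟩ : ∃ N, N = ‖∑ i, v i‖ := ⟨_, rfl⟩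
  have hN0 : 0 < N := by rw [hN]; exact norm_pos_iff.2 h.s_ne
  obtain ⟨p, hp⟩ : ∃ p : E 2, p = N⁻¹ • ∑ i, v i := ⟨_, rfl⟩
  have hpS : p ∈ unitSphere 2 := by rw [hp, hN]; exact us_normalize h.s_ne
  have hpp := us_inner hpS
  rw [← hN] at hs
  have hpn : ∀ i, ⟪p, n i⟫ = -sin r := by
    intro i; rw [hp, real_inner_smul_left, h.sn, hs]; field_simp
  have hcr : 0 < cos r := cos_pos_of_mem_Ioo ⟨by linarith, hr1⟩
  have hc2 : cos r ^ 2 = 2 * (1 + 2 * b) / (3 * (1 + b)) := by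
    rw [cos_sq', hs2]; field_simp; ring
  obtain ⟨e, he⟩ : ∃ e : Fin 3 → E 2, e = fun i => (cos r)⁻¹ • (n i + sin r • p) := ⟨_, rfl⟩
  have hpe : ∀ i, ⟪p, e i⟫ = 0 := by
    intro i; rw [he]; simp only
    rw [inner_smul_right, inner_add_right, inner_smul_right, hpn, hpp]; ring
  have hee : ∀ i j, ⟪e i, e j⟫ = if i = j then 1 else -1 / 2 := by
    intro i j
    have hnp : ⟪n i, p⟫ = -sin r := by rw [real_inner_comm]; exact hpn i
    have e1 : ⟪e i, e j⟫ = (cos r ^ 2)⁻¹ * (⟪n i, n j⟫ - sin r ^ 2) := by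
      rw [he]; simp only
      rw [inner_smul_right, real_inner_smul_left, inner_add_right, inner_add_left, inner_add_left, inner_smul_right, inner_smul_right,
        real_inner_smul_left, real_inner_smul_left, hpn, hnp, hpp]; ring
    rw [e1, h.nn, hs2, hc2]
    have : 1 + 2 * b ≠ 0 := by linarith
    have : 1 + b * 2 ≠ 0 := by linarith
    split_ifs <;> field_simp <;> ring
  have hsum : ∑ i, e i = 0 := by
    rw [← inner_self_eq_zero (𝕜 := ℝ), sum_inner]
    simp only [Fin.sum_univ_three, inner_add_right, hee]
    norm_num [Fin.ext_iff]
  have h3 : (√3 : ℝ) ^ 2 = 3 := sq_sqrt (by norm_num)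
  have h30 : (0 : ℝ) < √3 := sqrt_pos.2 (by norm_num)
  have hB : ∀ σ : Equiv.Perm (Fin 3), ∃ B : OrthonormalBasis (Fin 3) ℝ (E 2), B 0 = p ∧ B 1 = e (σ 2) ∧
      B 2 = (√3)⁻¹ • ((2 : ℝ) • e (σ 1) + e (σ 2)) := by
    intro σ
    have n12 : σ 1 ≠ σ 2 := fun hh => absurd (σ.injective hh) (by decide)
    apply frame3 hpp
    · rw [hee]; simp
    · rw [inner_smul_right, real_inner_smul_left, inner_add_right, inner_add_left, inner_add_left, inner_smul_right, inner_smul_right,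
        real_inner_smul_left, real_inner_smul_left, hee, hee, hee, hee]
      simp only [if_true, if_neg n12, if_neg n12.symm]
      field_simp; rw [h3]; norm_num
    · exact hpe _
    · rw [inner_smul_right, inner_add_right, inner_smul_right, hpe, hpe]; simp
    · rw [inner_smul_right, inner_add_right, inner_smul_right, hee, hee]
      simp only [if_true, if_neg n12.symm]; ring
  choose B hB0 hB1 hB2 using hB
  refine ⟨B, fun x hx => ?_⟩
  have hz : 0 < ⟪p, x⟫ := by
    rw [hp, real_inner_smul_left]; exact mul_pos (inv_pos.2 hN0) (h.sx_pos hx)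
  by_cases hcap : cos r ≤ ⟪p, x⟫
  · left
    rw [gset_disc hr0 hr1, hB0]
    exact ⟨hx.1, hcap⟩
  right
  obtain ⟨a, ha⟩ : ∃ a : Fin 3 → ℝ, a = fun i => ⟪e i, x⟫ := ⟨_, rfl⟩
  have ha' : ∀ i, ⟪e i, x⟫ = a i := fun i => by rw [ha]
  have hat : ∀ i, a i ≤ ⟪p, x⟫ * tan r := by
    intro i
    have h1 := hx.2 i
    rw [real_inner_comm] at h1
    have h2 : a i = (cos r)⁻¹ * (⟪n i, x⟫ + sin r * ⟪p, x⟫) := by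
      rw [← ha', he]; simp only
      rw [real_inner_smul_left, inner_add_left, real_inner_smul_left]
    rw [h2, tan_eq_sin_div_cos, inv_mul_le_iff₀ hcr]
    field_simp
    linarith
  obtain ⟨σ, hσ⟩ : ∃ σ, σ = Tuple.sort a := ⟨_, rfl⟩
  have hm : Monotone (a ∘ σ) := by rw [hσ]; exact Tuple.monotone_sort a
  have m1 : a (σ 0) ≤ a (σ 1) := hm (show (0 : Fin 3) ≤ 1 by decide)
  have m2 : a (σ 1) ≤ a (σ 2) := hm (show (1 : Fin 3) ≤ 2 by decide)
  have hs0 : a (σ 0) + a (σ 1) + a (σ 2) = 0 := by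
    have h1 : ∑ i, a (σ i) = 0 := by
      rw [Equiv.sum_comp σ a]
      simp only [← ha']
      rw [← sum_inner, hsum, inner_zero_left]
    rwa [Fin.sum_univ_three] at h1
  have hnd : x ∉ gset (B σ) (QD (tan r)) := by
    rw [gset_disc hr0 hr1, hB0]; exact fun hh => hcap hh.2
  rw [mem_iUnion]
  refine ⟨σ, ⟨hx.1, by rw [hB0]; exact hz, ?_⟩⟩
  have i2 : ⟪B σ 2, x⟫ = (√3)⁻¹ * (2 * a (σ 1) + a (σ 2)) := by
    rw [hB2, real_inner_smul_left, inner_add_left, real_inner_smul_left, ha', ha']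
  have i1 : ⟪B σ 1, x⟫ = a (σ 2) := by rw [hB1, ha']
  refine ⟨?_, ?_, ?_, ?_⟩
  · simp only [i2, hB0]
    apply div_nonneg _ hz.le
    apply mul_nonneg (by positivity)
    linarith
  · simp only [i1, hB0]
    rw [div_le_iff₀ hz]; linarith [hat (σ 2)]
  · simp only [i1, i2, hB0, cos_pi_div_three, sin_pi_div_three]
    rw [div_mul_eq_mul_div, div_mul_eq_mul_div]
    apply div_le_div_of_nonneg_right _ hz.le
    field_simp
    rw [h3]; linarith
  · by_contra hcon
    push Not at hcon
    exact hnd ⟨hx.1, by rw [hB0]; exact hz, hcon⟩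

lemma area_upper (h : Tri v n b d) {r w c : ℝ} (hc : AreaConst c) (hw : w ≤ π / 2) (hr0 : 0 < r) (hrw : r < w / 2)
    (ht : tan (w - r) = 2 * tan r)
    (hs : sin r = d / ‖∑ i, v i‖) (hs2 : sin r ^ 2 = (1 - b) / (3 * (1 + b))) :
    area (HT n) ≤ c * FF w r := by
  have hpi := pi_pos
  have hr1 : r < π / 2 := by linarith
  obtain ⟨B, hB⟩ := h.cover hr0 hr1 hs hs2
  obtain ⟨ha, -, -⟩ := r0_facts hr0 hrw hw ht
  have hF := FH_nonneg hr0 hr1 (show 0 < π / 3 by linarith) (show π / 3 < π / 2 by linarith)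
  have hc0 := hc.1
  have hcos := cos_le_one r
  have h1 : μH[2] (HT n) ≤ ENNReal.ofReal (c * FF w r) := by
    calc μH[2] (HT n) ≤ μH[2] (gset (B 1) (QD (tan r))) + ∑ σ, μH[2] (gset (B σ) (QC (tan r) (π / 3))) := 
          (measure_mono hB).trans ((measure_union_le _ _).trans (add_le_add le_rfl (measure_iUnion_fintype_le _ _)))
      _ = ENNReal.ofReal (c * (2 * π * (1 - cos r))) + ∑ σ : Equiv.Perm (Fin 3), ENNReal.ofReal (c * FH r (π / 3)) := by
          rw [(hc.2 (B 1) r hr0 hr1).1]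
          congr 1
          apply Finset.sum_congr rfl
          intro σ _
          exact ((hc.2 (B σ) r hr0 hr1).2 (π / 3) (by linarith) (by linarith)).2
      _ = ENNReal.ofReal (c * FF w r) := by
          rw [← ENNReal.ofReal_sum_of_nonneg (fun _ _ => mul_nonneg hc0.le hF), ← ENNReal.ofReal_add
            (mul_nonneg hc0.le (mul_nonneg (by linarith) (by linarith))) (Finset.sum_nonneg fun _ _ => mul_nonneg hc0.le hF)]
          congr 1
          rw [Finset.sum_const, Finset.card_univ, Fintype.card_perm, Fintype.card_fin]
          unfold FF
          rw [ha]
          simp [Nat.factorial]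
          ring
  unfold area
  apply ENNReal.toReal_le_of_le_ofReal _ h1
  unfold FF
  rw [ha]
  apply mul_nonneg hc0.le
  exact add_nonneg (mul_nonneg (by linarith) (by linarith)) (by linarith)

end Tri

theorem pal_aux (w : ℝ) (hw0 : 0 < w) (hw : w ≤ π / 2)
    (K T : Set (E 2)) (hK : IsConvexBody K) (hKw : width K = w)
    (hT : IsRegularTriangle T) (hTw : width T = w) :
    area T ≤ area K ∧ (area K = area T ↔ Congruent K T) := by
  obtain ⟨v₁, v₂, v₃, h1, h2, h3, lin, g1, g2, rfl⟩ := hT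
  obtain ⟨n, b, d, h⟩ := exists_tri (v := ![v₁, v₂, v₃]) (by intro i; fin_cases i <;> assumption) lin g1 g2
  have hTe : sconv {v₁, v₂, v₃} = HT n := h.sconv_eq
  rw [hTe] at hTw ⊢
  have hb := h.b_nonneg (by rw [hTw]; exact hw0) (by rw [hTw]; exact hw)
  obtain ⟨r, hr0, hrw, ht, hs, hs2⟩ := h.exists_r0 hb hw0 hw (h.sin_width hTw hw0 hw)
  obtain ⟨c, hc⟩ := exists_areaConst
  have up := h.area_upper hc hw hr0 hrw ht hs hs2
  obtain ⟨lo, hcfg⟩ := lower_final hc hK hKw hw0 hw hr0 hrw ht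
  refine ⟨up.trans lo, fun heq => ?_, area_congr⟩
  obtain ⟨p, u, l, y, hC⟩ := hcfg (le_antisymm (by rw [heq]; exact up) lo)
  obtain ⟨hg, hKe⟩ := hC.rigid hK.1 (r0_facts hr0 hrw hw ht).2.1
  rw [hKe]
  apply congr_of_gram hC.lin h.lin_n
  intro i j
  rw [h.nn]
  split_ifs with hij
  · rw [hij]; exact hC.uu j
  · rw [hg i j hij, hs2]
    field_simp
    ring

end PartT3

end SphericalPal

/-- Bezdek–Blekherman, with equality case: for a convex body `K ⊂ S²`
of width `0 < w ≤ π/2` and a regular spherical triangle `T` of width `w`,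
`area K ≥ area T`, with equality iff `K` is congruent to `T`. -/
theorem pal_isominwidth (w : ℝ) (hw0 : 0 < w) (hw : w ≤ π / 2)
    (K T : Set (E 2)) (hK : IsConvexBody K) (hKw : width K = w)
    (hT : IsRegularTriangle T) (hTw : width T = w) :
    area T ≤ area K ∧ (area K = area T ↔ Congruent K T) := by
  exact pal_aux w hw0 hw K T hK hKw hT hTw
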